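/- (Stable branching rule for GL_n × GL_m ⊂ GL_{n+m}.) Let p, q be non-negative integers with p+q ≤ min(n,m), and let λ⁺,μ⁺,ν⁺ and λ⁻,μ⁻,ν⁻ be non-negative integer partitions with ℓ(λ⁺), ℓ(μ⁺), ℓ(ν⁺) ≤ p and ℓ(λ⁻), ℓ(μ⁻), ℓ(ν⁻) ≤ q. Then [F^{(λ⁺,λ⁻)}_(n+m), F^{(μ⁺,μ⁻)}_(n) ⊗ F^{(ν⁺,ν⁻)}_(m)] = Σ c^{γ⁺}_{μ⁺ν⁺} c^{γ⁻}_{μ⁻ν⁻} c^{λ⁺}_{γ⁺δ} c^{λ⁻}_{γ⁻δ}, the sum over all triples of non-negative integer partitions (γ⁺, γ⁻, δ). -/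

import Mathlib

open scoped BigOperators TensorProduct
open Matrix

noncomputable section

def IsPartition (f : ℕ → ℕ) : Prop :=
  (∀ ⦃i j : ℕ⦄, i ≤ j → f j ≤ f i) ∧ ∃ N, f N = 0

def Ptn : Type := {f : ℕ → ℕ // IsPartition f}

def plen (f : ℕ → ℕ) : ℕ := sInf {k | f k = 0}

def conj (f : ℕ → ℕ) : ℕ → ℕ := fun i => Set.ncard {j | i < f j}

def double (f : ℕ → ℕ) : ℕ → ℕ := fun i => 2 * f i

def InSkew (l m : ℕ → ℕ) (i j : ℕ) : Prop := m i ≤ j ∧ j < l i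

def IsLRTableau (l m nu : ℕ → ℕ) (T : ℕ → ℕ → ℕ) : Prop :=
  (∀ i, m i ≤ l i) ∧
  (∀ i j, T i j ≠ 0 ↔ InSkew l m i j) ∧
  (∀ i j k, InSkew l m i j → InSkew l m i k → j ≤ k → T i j ≤ T i k) ∧
  (∀ i k j, InSkew l m i j → InSkew l m k j → i < k → T i j < T k j) ∧
  (∀ r, Set.ncard {p : ℕ × ℕ | T p.1 p.2 = r + 1} = nu r) ∧
  (∀ i j r, Set.ncard {p : ℕ × ℕ | (p.1 < i ∨ (p.1 = i ∧ j ≤ p.2)) ∧ T p.1 p.2 = r + 2}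
          ≤ Set.ncard {p : ℕ × ℕ | (p.1 < i ∨ (p.1 = i ∧ j ≤ p.2)) ∧ T p.1 p.2 = r + 1})

def lrCoeff (l m nu : ℕ → ℕ) : ℕ := Set.ncard {T : ℕ → ℕ → ℕ | IsLRTableau l m nu T}

section Reps

variable {G : Type*} [Group G] {V W : Type*}
  [AddCommGroup V] [Module ℂ V] [AddCommGroup W] [Module ℂ W]

def IsSubrep (ρ : Representation ℂ G V) (U : Submodule ℂ V) : Prop :=
  ∀ g : G, ∀ x ∈ U, ρ g x ∈ U

def IsIrreducibleRep (ρ : Representation ℂ G V) : Prop :=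
  Nontrivial V ∧ ∀ U : Submodule ℂ V, IsSubrep ρ U → U = ⊥ ∨ U = ⊤

def equivariantMaps (π : Representation ℂ G W) (ρ : Representation ℂ G V) :
    Submodule ℂ (W →ₗ[ℂ] V) where
  carrier := {f | ∀ g : G, f ∘ₗ (π g) = (ρ g) ∘ₗ f}
  add_mem' := by
    intro f h hf hh g
    simp only [Set.mem_setOf_eq] at *
    rw [LinearMap.add_comp, LinearMap.comp_add, hf g, hh g]
  zero_mem' := by
    intro g
    simp only [Set.mem_setOf_eq, LinearMap.zero_comp, LinearMap.comp_zero]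
  smul_mem' := by
    intro c f hf g
    simp only [Set.mem_setOf_eq] at *
    rw [LinearMap.smul_comp, LinearMap.comp_smul, hf g]

def repMult (ρ : Representation ℂ G V) (π : Representation ℂ G W) : ℕ :=
  Module.finrank ℂ (equivariantMaps π ρ)

end Reps

def IsUpperUni {N : ℕ} (A : Matrix (Fin N) (Fin N) ℂ) : Prop :=
  (∀ i, A i i = 1) ∧ ∀ i j : Fin N, (j : ℕ) < (i : ℕ) → A i j = 0

def IsGLHW (n : ℕ) (a : Fin n → ℤ) {V : Type*} [AddCommGroup V] [Module ℂ V]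
    (ρ : Representation ℂ (GL (Fin n) ℂ) V) : Prop :=
  IsIrreducibleRep ρ ∧ FiniteDimensional ℂ V ∧
  ∃ v : V, v ≠ 0 ∧
    (∀ g : GL (Fin n) ℂ, IsUpperUni (g : Matrix (Fin n) (Fin n) ℂ) → ρ g v = v) ∧
    (∀ (g : GL (Fin n) ℂ) (d : Fin n → ℂ),
      (g : Matrix (Fin n) (Fin n) ℂ) = Matrix.diagonal d →
      ρ g v = (∏ i, d i ^ (a i)) • v)

def polyWeight (n : ℕ) (lam : ℕ → ℕ) : Fin n → ℤ := fun i => (lam (i : ℕ) : ℤ)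

def ratWeight (n : ℕ) (lp lm : ℕ → ℕ) : Fin n → ℤ :=
  fun i => (lp (i : ℕ) : ℤ) - (lm (n - 1 - (i : ℕ)) : ℤ)

def formGroup {ι : Type*} [Fintype ι] [DecidableEq ι] (S : Matrix ι ι ℂ) :
    Subgroup (GL ι ℂ) where
  carrier := {g | (g : Matrix ι ι ℂ)ᵀ * S * (g : Matrix ι ι ℂ) = S}
  one_mem' := by
    simp [Matrix.transpose_one]
  mul_mem' := by
    intro a b ha hb
    set A : Matrix ι ι ℂ := (a : Matrix ι ι ℂ) with hA
    set B : Matrix ι ι ℂ := (b : Matrix ι ι ℂ) with hB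
    have ha' : Aᵀ * S * A = S := ha
    have hb' : Bᵀ * S * B = S := hb
    show ((↑(a * b) : Matrix ι ι ℂ))ᵀ * S * (↑(a * b) : Matrix ι ι ℂ) = S
    have hab : (↑(a * b) : Matrix ι ι ℂ) = A * B := Units.val_mul a b
    rw [hab, Matrix.transpose_mul]
    calc Bᵀ * Aᵀ * S * (A * B) = Bᵀ * (Aᵀ * S * A) * B := by noncomm_ring
    _ = S := by rw [ha', hb']
  inv_mem' := by
    intro a ha
    set A : Matrix ι ι ℂ := (a : Matrix ι ι ℂ) with hA
    have ha' : Aᵀ * S * A = S := ha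
    set C : Matrix ι ι ℂ := ((a⁻¹ : GL ι ℂ) : Matrix ι ι ℂ) with hC
    show Cᵀ * S * C = S
    have hac : A * C = 1 := by
      rw [hA, hC, ← Units.val_mul, mul_inv_cancel, Units.val_one]
    calc Cᵀ * S * C = Cᵀ * (Aᵀ * S * A) * C := by rw [ha']
    _ = (A * C)ᵀ * S * (A * C) := by rw [Matrix.transpose_mul]; noncomm_ring
    _ = S := by rw [hac]; simp [Matrix.transpose_one]

def symForm (n : ℕ) : Matrix (Fin n) (Fin n) ℂ :=
  Matrix.of fun i j => if (i : ℕ) + (j : ℕ) = n - 1 then 1 else 0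

def sympForm (n : ℕ) : Matrix (Fin (2 * n)) (Fin (2 * n)) ℂ :=
  Matrix.of fun i j =>
    if (i : ℕ) + (j : ℕ) = 2 * n - 1 then (if (i : ℕ) < n then 1 else -1) else 0

def OGL (n : ℕ) : Subgroup (GL (Fin n) ℂ) := formGroup (symForm n)

def SpGL (n : ℕ) : Subgroup (GL (Fin (2 * n)) ℂ) := formGroup (sympForm n)

/-- The matrix of a distinguished reflection (an element of `O_n(ℂ)` of determinant `-1`
fixing the highest weight vectors of the representations `E^mu_(n)` for
`ℓ(mu) < n/2`): for odd `n`, the reflection negating the middle basis vector; for even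
`n`, the permutation swapping the two middle basis vectors. -/
def reflMatrix (n : ℕ) : Matrix (Fin n) (Fin n) ℂ :=
  Matrix.of fun i j =>
    if 2 * (i : ℕ) + 1 = n ∧ i = j then -1
    else if (2 * (i : ℕ) = n ∧ 2 * (j : ℕ) + 2 = n) ∨ (2 * (i : ℕ) + 2 = n ∧ 2 * (j : ℕ) = n)
      then 1
    else if i = j ∧ ¬(2 * (i : ℕ) = n ∨ 2 * (i : ℕ) + 2 = n) then 1
    else 0

/-- The partition associated to `mu` (with `(mu')_1 + (mu')_2 ≤ n`): the first column
length `(mu')_1` is replaced by `n - (mu')_1`.  One has `E^{assoc n mu} = E^mu ⊗ det`. -/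
def assocPtn (n : ℕ) (mu : ℕ → ℕ) : ℕ → ℕ :=
  conj (fun j => if j = 0 then n - conj mu 0 else conj mu j)

/-- `v` is a highest weight vector of weight `mu` for (the identity component of)
`O_n(ℂ)`: it is fixed by all upper triangular unipotent elements, and the diagonal
torus elements of determinant one act via the character attached to `mu`. -/
def IsOHWvec (n : ℕ) (mu : ℕ → ℕ) {V : Type*} [AddCommGroup V] [Module ℂ V]
    (ρ : Representation ℂ (OGL n) V) (v : V) : Prop :=
  (∀ g : OGL n, IsUpperUni ((g : GL (Fin n) ℂ) : Matrix (Fin n) (Fin n) ℂ) → ρ g v = v) ∧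
  (∀ (g : OGL n) (d : Fin n → ℂ),
    ((g : GL (Fin n) ℂ) : Matrix (Fin n) (Fin n) ℂ) = Matrix.diagonal d →
    (∏ i, d i) = 1 →
    ρ g v = (∏ i, d i ^ (mu (i : ℕ))) • v)

/-- `ρ` is the irreducible rational representation `E^mu_(n)` of the complex orthogonal
group `O_n(ℂ)`, indexed by a partition `mu` with `(mu')_1 + (mu')_2 ≤ n`. -/
def IsOIrrep (n : ℕ) (mu : ℕ → ℕ) {V : Type*} [AddCommGroup V] [Module ℂ V]
    (ρ : Representation ℂ (OGL n) V) : Prop :=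
  IsIrreducibleRep ρ ∧ FiniteDimensional ℂ V ∧
  (if 2 * conj mu 0 ≤ n then
    ∃ v : V, v ≠ 0 ∧ IsOHWvec n mu ρ v ∧
      (2 * conj mu 0 = n ∨
        ∀ g : OGL n, ((g : GL (Fin n) ℂ) : Matrix (Fin n) (Fin n) ℂ) = reflMatrix n →
          ρ g v = v)
  else
    ∃ v : V, v ≠ 0 ∧ IsOHWvec n (assocPtn n mu) ρ v ∧
      (∀ g : OGL n, ((g : GL (Fin n) ℂ) : Matrix (Fin n) (Fin n) ℂ) = reflMatrix n →
        ρ g v = - v))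

/-- `ρ` is the irreducible rational representation `V^mu_(2n)` of `Sp_{2n}(ℂ)` with
highest weight `mu` (a partition with at most `n` parts). -/
def IsSpHW (n : ℕ) (mu : ℕ → ℕ) {V : Type*} [AddCommGroup V] [Module ℂ V]
    (ρ : Representation ℂ (SpGL n) V) : Prop :=
  IsIrreducibleRep ρ ∧ FiniteDimensional ℂ V ∧
  ∃ v : V, v ≠ 0 ∧
    (∀ g : SpGL n,
      IsUpperUni ((g : GL (Fin (2 * n)) ℂ) : Matrix (Fin (2 * n)) (Fin (2 * n)) ℂ) →
      ρ g v = v) ∧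
    (∀ (g : SpGL n) (d : Fin (2 * n) → ℂ),
      ((g : GL (Fin (2 * n)) ℂ) : Matrix (Fin (2 * n)) (Fin (2 * n)) ℂ) = Matrix.diagonal d →
      ρ g v = (∏ i, d i ^ (mu (i : ℕ))) • v)


/-- `φ` is the block-diagonal embedding `GL_n × GL_m ↪ GL_{n+m}`. -/
def IsBlockDiagEmbed (n m : ℕ)
    (φ : GL (Fin n) ℂ × GL (Fin m) ℂ →* GL (Fin (n + m)) ℂ) : Prop :=
  ∀ (g : GL (Fin n) ℂ) (h : GL (Fin m) ℂ) (i j : Fin (n + m)),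
    (↑(φ (g, h)) : Matrix (Fin (n + m)) (Fin (n + m)) ℂ) i j =
      if hi : (i : ℕ) < n then
        (if hj : (j : ℕ) < n then
          (↑g : Matrix (Fin n) (Fin n) ℂ) ⟨(i : ℕ), hi⟩ ⟨(j : ℕ), hj⟩ else 0)
      else
        (if hj : (j : ℕ) < n then 0
         else (↑h : Matrix (Fin m) (Fin m) ℂ)
            ⟨(i : ℕ) - n, by have := i.isLt; omega⟩
            ⟨(j : ℕ) - n, by have := j.isLt; omega⟩)

noncomputable section

/-- Two rows of a Gelfand-Tsetlin pattern interlace. -/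
def Interlace (P Q : ℕ → ℤ) : Prop := ∀ r, P r ≤ Q r ∧ Q (r + 1) ≤ P r

/-- Semistandard fillings of the skew shape `l / u` with `m` letters, recorded by the chain of
shapes `T k` occupied by the first `k` letters. -/
structure IsGT (m : ℕ) (l u : ℕ → ℤ) (T : ℕ → ℕ → ℤ) : Prop where
  zero : T 0 = u
  top : ∀ k, m ≤ k → T k = l
  inter : ∀ k, Interlace (T k) (T (k + 1))

/-- The number of letters `k` in the first `i` rows. -/
def cnt (T : ℕ → ℕ → ℤ) (k i : ℕ) : ℤ := ∑ r ∈ Finset.range i, (T (k + 1) r - T k r)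

lemma cnt_succ (T : ℕ → ℕ → ℤ) (k i : ℕ) : cnt T k (i + 1) = cnt T k i + (T (k + 1) i - T k i) := by
  exact Finset.sum_range_succ _ _

lemma cnt_zero (T : ℕ → ℕ → ℤ) (k : ℕ) : cnt T k 0 = 0 := by simp [cnt]

/-- The lattice condition for a filling, starting from the content `v`. -/
def IsGood (m : ℕ) (v : ℕ → ℤ) (T : ℕ → ℕ → ℤ) : Prop :=
  ∀ i k, k + 1 < m → v (k + 1) + cnt T (k + 1) (i + 1) ≤ v k + cnt T k i

/-- The content of a filling. -/
def gtwt (m ℓ : ℕ) (T : ℕ → ℕ → ℤ) : Fin m → ℤ := fun k => cnt T k ℓ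

namespace IsGT
variable {m ℓ : ℕ} {l u : ℕ → ℤ} {T : ℕ → ℕ → ℤ}

lemma mono (h : IsGT m l u T) {a b : ℕ} (hab : a ≤ b) (r : ℕ) : T a r ≤ T b r :=
  monotone_nat_of_le_succ (f := fun k => T k r) (fun k => (h.inter k r).1) hab

lemma le_top (h : IsGT m l u T) (k r : ℕ) : T k r ≤ l r := by
  rw [← h.top (max k m) (le_max_right _ _)]
  exact h.mono (le_max_left _ _) r

lemma bot_le (h : IsGT m l u T) (k r : ℕ) : u r ≤ T k r := by
  rw [← h.zero]; exact h.mono (Nat.zero_le _) r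

lemma cnt_mono (h : IsGT m l u T) (k : ℕ) : Monotone (cnt T k) := by
  refine monotone_nat_of_le_succ fun i => ?_
  rw [cnt_succ]; have := (h.inter k i).1; omega

lemma cnt_nonneg (h : IsGT m l u T) (k i : ℕ) : 0 ≤ cnt T k i := by
  rw [← cnt_zero T k]; exact h.cnt_mono k (Nat.zero_le _)

lemma eq_zero (h : IsGT m l u T) (hl : ∀ i, ℓ ≤ i → l i = 0) (hu : ∀ i, 0 ≤ u i) (k : ℕ) {r : ℕ}
    (hr : ℓ ≤ r) : T k r = 0 := by
  have h1 := h.le_top k r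
  have h2 := h.bot_le k r
  have h3 := hl r hr
  have h4 := hu r
  omega

lemma cnt_eq (h : IsGT m l u T) (hl : ∀ i, ℓ ≤ i → l i = 0) (hu : ∀ i, 0 ≤ u i) (k : ℕ) {i : ℕ}
    (hi : ℓ ≤ i) : cnt T k i = cnt T k ℓ := by
  induction i, hi using Nat.le_induction with
  | base => rfl
  | succ i hi ih => rw [cnt_succ, ih, h.eq_zero hl hu _ hi, h.eq_zero hl hu _ hi]; simp

lemma cnt_top (h : IsGT m l u T) {k : ℕ} (hk : m ≤ k) (i : ℕ) : cnt T k i = 0 := by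
  simp [cnt, h.top k hk, h.top (k + 1) (by omega)]

lemma anti (h : IsGT m l u T) (k : ℕ) : Antitone (T k) := by
  refine antitone_nat_of_succ_le fun r => ?_
  exact ((h.inter k (r + 1)).1).trans (h.inter k r).2

end IsGT

lemma finite_setOf_isGT (m ℓ : ℕ) {l u : ℕ → ℤ} (hl : ∀ i, ℓ ≤ i → l i = 0) (hu : ∀ i, 0 ≤ u i) :
    {T | IsGT m l u T}.Finite := by
  let F : (ℕ → ℕ → ℤ) → (Fin m → Fin ℓ → ℤ) := fun T k i => T k i
  refine Set.Finite.of_finite_image (f := F) ?_ ?_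
  · refine Set.Finite.subset (Set.Finite.pi' (ι := Fin m)
      (t := fun _ => {x : Fin ℓ → ℤ | ∀ i : Fin ℓ, x i ∈ Set.Icc (u i) (l i)}) fun _ =>
        Set.Finite.pi' fun i => Set.finite_Icc _ _) ?_
    rintro _ ⟨T, hT, rfl⟩ k i
    exact ⟨hT.bot_le _ _, hT.le_top _ _⟩
  · intro T hT S hS hTS
    funext k i
    by_cases hk : k < m
    · by_cases hi : i < ℓ
      · exact congrFun (congrFun hTS ⟨k, hk⟩) ⟨i, hi⟩
      · rw [hT.eq_zero hl hu k (not_lt.1 hi), hS.eq_zero hl hu k (not_lt.1 hi)]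
    · rw [hT.top k (not_lt.1 hk), hS.top k (not_lt.1 hk)]

open Classical in
/-- The finite set of all fillings. -/
def gtFin (m : ℕ) (l u : ℕ → ℤ) : Finset (ℕ → ℕ → ℤ) :=
  if h : {T | IsGT m l u T}.Finite then h.toFinset else ∅

lemma mem_gtFin {m ℓ : ℕ} {l u : ℕ → ℤ} (hl : ∀ i, ℓ ≤ i → l i = 0) (hu : ∀ i, 0 ≤ u i)
    {T : ℕ → ℕ → ℤ} : T ∈ gtFin m l u ↔ IsGT m l u T := by
  rw [gtFin, dif_pos (finite_setOf_isGT m ℓ hl hu)]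
  simp

/-- The generalized Bender-Knuth move on the middle one of three rows. -/
def bkRow (P Q R : ℕ → ℤ) (i : ℕ) (t : ℤ) (r : ℕ) : ℤ :=
  if r < i then Q r
  else if r = i then max (P i) (R (i + 1)) + (R i - t) - Q i
  else max (P r) (R (r + 1)) + min (R r) (P (r - 1)) - Q r

section bk
variable {P Q R : ℕ → ℤ} {i : ℕ} {t : ℤ}

lemma bkRow_of_lt {r : ℕ} (h : r < i) : bkRow P Q R i t r = Q r := by simp [bkRow, h]

lemma bkRow_self : bkRow P Q R i t i = max (P i) (R (i + 1)) + (R i - t) - Q i := by simp [bkRow]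

lemma bkRow_of_gt {r : ℕ} (h : i < r) :
    bkRow P Q R i t r = max (P r) (R (r + 1)) + min (R r) (P (r - 1)) - Q r := by
  simp [bkRow, h.not_gt, h.ne']

lemma bkRow_bkRow : bkRow P (bkRow P Q R i t) R i t = Q := by
  funext r
  rcases lt_trichotomy r i with h | rfl | h
  · rw [bkRow_of_lt h, bkRow_of_lt h]
  · rw [bkRow_self, bkRow_self]; ring
  · rw [bkRow_of_gt h, bkRow_of_gt h]; ring

lemma interlace_bkRow (h1 : Interlace P Q) (h2 : Interlace Q R) (ht : 0 ≤ t) (hQ : Q i ≤ R i - t)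
    (hP : ∀ j, i = j + 1 → R i - t ≤ P j) :
    Interlace P (bkRow P Q R i t) ∧ Interlace (bkRow P Q R i t) R := by
  have e1 := h1 i
  have e2 := h2 i
  have key : ∀ r, P r ≤ bkRow P Q R i t r ∧ R (r + 1) ≤ bkRow P Q R i t r ∧
      bkRow P Q R i t r ≤ R r ∧ bkRow P Q R i t (r + 1) ≤ P r := by
    intro r
    have a1 := h1 r
    have a2 := h2 r
    have a3 := h1 (r + 1)
    have a4 := h2 (r + 1)
    refine ⟨?_, ?_, ?_, ?_⟩
    · rcases lt_trichotomy r i with h | rfl | h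
      · rw [bkRow_of_lt h]; omega
      · rw [bkRow_self]; omega
      · rw [bkRow_of_gt h]
        obtain ⟨s, rfl⟩ : ∃ s, r = s + 1 := ⟨r - 1, by omega⟩
        have := h1 s
        simp only [Nat.add_sub_cancel]; omega
    · rcases lt_trichotomy r i with h | rfl | h
      · rw [bkRow_of_lt h]; omega
      · rw [bkRow_self]; omega
      · rw [bkRow_of_gt h]
        obtain ⟨s, rfl⟩ : ∃ s, r = s + 1 := ⟨r - 1, by omega⟩
        have := h1 s
        simp only [Nat.add_sub_cancel]; omega
    · rcases lt_trichotomy r i with h | rfl | h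
      · rw [bkRow_of_lt h]; omega
      · rw [bkRow_self]; omega
      · rw [bkRow_of_gt h]; omega
    · rcases lt_trichotomy (r + 1) i with h | rfl | h
      · rw [bkRow_of_lt h]; omega
      · rw [bkRow_self]; have := hP r rfl; omega
      · rw [bkRow_of_gt h]; simp only [Nat.add_sub_cancel]; omega
  exact ⟨fun r => ⟨(key r).1, (key r).2.2.2⟩, fun r => ⟨(key r).2.2.1, (key r).2.1⟩⟩

lemma sum_bkRow_aux {n : ℕ} (hn : i ≤ n) :
    ∑ r ∈ Finset.range (n + 1), bkRow P Q R i t r + min (P n) (R (n + 1))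
      = ∑ r ∈ Finset.range i, (Q r + Q r - P r - R r)
        + ∑ r ∈ Finset.range (n + 1), (P r + R r - Q r) + R (n + 1) - t := by
  induction n, hn using Nat.le_induction with
  | base =>
    rw [Finset.sum_range_succ, Finset.sum_range_succ, bkRow_self,
      Finset.sum_congr rfl (fun r hr => bkRow_of_lt (Finset.mem_range.1 hr))]
    have : ∑ r ∈ Finset.range i, (Q r + Q r - P r - R r) + ∑ r ∈ Finset.range i, (P r + R r - Q r)
        = ∑ r ∈ Finset.range i, Q r := by
      rw [← Finset.sum_add_distrib]; exact Finset.sum_congr rfl fun _ _ => by ring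
    omega
  | succ n hn ih =>
    rw [Finset.sum_range_succ, Finset.sum_range_succ _ (n + 1), bkRow_of_gt (by omega)]
    simp only [Nat.add_sub_cancel] at *
    omega

lemma sum_bkRow {ℓ : ℕ} (hi : i < ℓ) (hR : R ℓ = 0) (hP : ∀ r, 0 ≤ P r) :
    ∑ r ∈ Finset.range ℓ, (bkRow P Q R i t r - P r)
      = ∑ r ∈ Finset.range ℓ, (R r - Q r) + ∑ r ∈ Finset.range i, (Q r - P r)
        - ∑ r ∈ Finset.range i, (R r - Q r) - t := by
  obtain ⟨n, rfl⟩ : ∃ n, ℓ = n + 1 := ⟨ℓ - 1, by omega⟩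
  have h := sum_bkRow_aux (P := P) (Q := Q) (R := R) (t := t) (show i ≤ n by omega)
  have hp := hP n
  rw [hR, min_eq_right hp] at h
  simp only [Finset.sum_sub_distrib, Finset.sum_add_distrib] at h ⊢
  linarith

end bk
end

noncomputable section

/-- The Bender-Knuth move on level `k + 1` of a filling. -/
def bkMove (T : ℕ → ℕ → ℤ) (k i : ℕ) (t : ℤ) : ℕ → ℕ → ℤ :=
  Function.update T (k + 1) (bkRow (T k) (T (k + 1)) (T (k + 2)) i t)

section bkMove
variable {m ℓ : ℕ} {l u : ℕ → ℤ} {T : ℕ → ℕ → ℤ} {k i : ℕ} {t : ℤ}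

lemma bkMove_self : bkMove T k i t (k + 1) = bkRow (T k) (T (k + 1)) (T (k + 2)) i t := by
  simp [bkMove]

lemma bkMove_ne {j : ℕ} (h : j ≠ k + 1) : bkMove T k i t j = T j := by
  simp [bkMove, h]

lemma bkMove_bkMove : bkMove (bkMove T k i t) k i t = T := by
  funext j
  by_cases h : j = k + 1
  · subst h
    rw [bkMove_self, bkMove_self, bkMove_ne (by omega), bkMove_ne (by omega), bkRow_bkRow]
  · rw [bkMove_ne h, bkMove_ne h]

lemma bkMove_apply_of_lt {j r : ℕ} (hr : r < i) : bkMove T k i t j r = T j r := by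
  by_cases h : j = k + 1
  · subst h; rw [bkMove_self, bkRow_of_lt hr]
  · rw [bkMove_ne h]

lemma cnt_bkMove_of_le {j r : ℕ} (hr : r ≤ i) : cnt (bkMove T k i t) j r = cnt T j r := by
  refine Finset.sum_congr rfl fun s hs => ?_
  have := Finset.mem_range.1 hs
  rw [bkMove_apply_of_lt (by omega), bkMove_apply_of_lt (by omega)]

lemma cnt_bkMove_of_ne {j r : ℕ} (h1 : j ≠ k) (h2 : j ≠ k + 1) :
    cnt (bkMove T k i t) j r = cnt T j r := by
  rw [cnt, bkMove_ne h2, bkMove_ne (by omega), cnt]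

lemma isGT_bkMove (h : IsGT m l u T) (hk : k + 1 < m) (ht : 0 ≤ t)
    (hQ : T (k + 1) i ≤ T (k + 2) i - t) (hP : ∀ j, i = j + 1 → T (k + 2) i - t ≤ T k j) :
    IsGT m l u (bkMove T k i t) := by
  obtain ⟨h1, h2⟩ := interlace_bkRow (h.inter k) (h.inter (k + 1)) ht hQ hP
  refine ⟨?_, ?_, ?_⟩
  · rw [bkMove_ne (by omega), h.zero]
  · intro j hj; rw [bkMove_ne (by omega), h.top j hj]
  · intro j
    by_cases e1 : j = k
    · subst e1; rwa [bkMove_self, bkMove_ne (by omega)]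
    · by_cases e2 : j = k + 1
      · subst e2; rwa [bkMove_self, bkMove_ne (by omega)]
      · rw [bkMove_ne e2, bkMove_ne (by omega)]; exact h.inter j

lemma cnt_bkMove_left (h : IsGT m l u T) (hl : ∀ i, ℓ ≤ i → l i = 0) (hu : ∀ i, 0 ≤ u i)
    (hi : i < ℓ) :
    cnt (bkMove T k i t) k ℓ = cnt T (k + 1) ℓ + cnt T k i - cnt T (k + 1) i - t := by
  have := sum_bkRow (P := T k) (Q := T (k + 1)) (R := T (k + 2)) (t := t) hi
    (h.eq_zero hl hu _ le_rfl) (fun r => (hu r).trans (h.bot_le k r))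
  rw [cnt, bkMove_self, bkMove_ne (by omega), this]
  rfl

lemma cnt_bkMove_right (h : IsGT m l u T) (hl : ∀ i, ℓ ≤ i → l i = 0) (hu : ∀ i, 0 ≤ u i)
    (hi : i < ℓ) :
    cnt (bkMove T k i t) (k + 1) ℓ = cnt T k ℓ + cnt T (k + 1) i - cnt T k i + t := by
  have h1 := cnt_bkMove_left (k := k) (t := t) h hl hu hi
  have h2 : cnt (bkMove T k i t) k ℓ + cnt (bkMove T k i t) (k + 1) ℓ
      = cnt T k ℓ + cnt T (k + 1) ℓ := by
    simp only [cnt, ← Finset.sum_add_distrib]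
    refine Finset.sum_congr rfl fun r _ => ?_
    rw [bkMove_ne (j := k) (by omega), bkMove_ne (j := k + 1 + 1) (by omega)]
    ring
  omega

end bkMove

/-- The adjacent transposition of `k` and `k + 1`. -/
def adjSwap {m : ℕ} (k : ℕ) (hk : k + 1 < m) : Equiv.Perm (Fin m) :=
  Equiv.swap ⟨k, by omega⟩ ⟨k + 1, hk⟩

lemma adjSwap_cases {m : ℕ} {k : ℕ} (hk : k + 1 < m) (x y : Fin m → ℤ)
    (h1 : x ⟨k, by omega⟩ = y ⟨k + 1, hk⟩) (h2 : x ⟨k + 1, hk⟩ = y ⟨k, by omega⟩)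
    (h3 : ∀ j : Fin m, (j : ℕ) ≠ k → (j : ℕ) ≠ k + 1 → x j = y j) : x = y ∘ adjSwap k hk := by
  funext j
  simp only [adjSwap, Function.comp]
  by_cases e1 : j = ⟨k, by omega⟩
  · rw [e1, Equiv.swap_apply_left, h1]
  · by_cases e2 : j = ⟨k + 1, hk⟩
    · rw [e2, Equiv.swap_apply_right, h2]
    · rw [Equiv.swap_apply_of_ne_of_ne e1 e2, h3 j (fun h => e1 (Fin.ext h)) (fun h => e2 (Fin.ext h))]

lemma perm_induction_adj {m : ℕ} {P : Equiv.Perm (Fin m) → Prop} (h1 : P 1)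
    (h2 : ∀ k (hk : k + 1 < m) w, P w → P (w * adjSwap k hk)) (w : Equiv.Perm (Fin m)) : P w := by
  rcases m with _ | n
  · rwa [Subsingleton.elim w 1]
  · have hw : w ∈ Submonoid.closure (Set.range fun i : Fin n => Equiv.swap i.castSucc i.succ) := by
      rw [Equiv.Perm.mclosure_swap_castSucc_succ]; trivial
    induction hw using Submonoid.closure_induction_right with
    | one => exact h1
    | mul_right x hx y hy ih =>
      obtain ⟨i, rfl⟩ := hy
      exact h2 i.1 (by omega) x ih

/-- A family of integer vectors whose distribution is symmetric. -/
def SymFam {ι : Type*} {m : ℕ} (X : Finset ι) (x : ι → Fin m → ℤ) : Prop :=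
  ∀ (w : Equiv.Perm (Fin m)) (F : (Fin m → ℤ) → ℤ), ∑ a ∈ X, F (x a ∘ w) = ∑ a ∈ X, F (x a)

/-- Antisymmetric functions. -/
def Asym {m : ℕ} (f : (Fin m → ℤ) → ℤ) : Prop :=
  ∀ (w : Equiv.Perm (Fin m)) (x : Fin m → ℤ), f (x ∘ w) = Equiv.Perm.sign w * f x

lemma symFam_gtwt {m ℓ : ℕ} {l u : ℕ → ℤ} (hl : ∀ i, ℓ ≤ i → l i = 0) (hu : ∀ i, 0 ≤ u i) :
    SymFam (gtFin m l u) (gtwt m ℓ) := by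
  have key : ∀ k (hk : k + 1 < m) (F : (Fin m → ℤ) → ℤ),
      ∑ T ∈ gtFin m l u, F (gtwt m ℓ T ∘ adjSwap k hk) = ∑ T ∈ gtFin m l u, F (gtwt m ℓ T) := by
    intro k hk F
    rcases Nat.eq_zero_or_pos ℓ with rfl | hℓ
    · refine Finset.sum_congr rfl fun T hT => congrArg F ?_
      funext j; simp [gtwt, cnt]
    · have hmem : ∀ T ∈ gtFin m l u, bkMove T k 0 0 ∈ gtFin m l u := by
        intro T hT
        rw [mem_gtFin hl hu] at hT ⊢
        exact isGT_bkMove hT hk le_rfl (by simpa using (hT.inter (k + 1) 0).1) (by simp)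
      refine Finset.sum_nbij' (fun T => bkMove T k 0 0) (fun T => bkMove T k 0 0) hmem hmem
        (fun _ _ => bkMove_bkMove) (fun _ _ => bkMove_bkMove) ?_
      intro T hT
      rw [mem_gtFin hl hu] at hT
      refine congrArg F (adjSwap_cases hk _ _ ?_ ?_ ?_).symm
      · simp [gtwt, cnt_bkMove_left hT hl hu hℓ, cnt_zero]
      · simp [gtwt, cnt_bkMove_right hT hl hu hℓ, cnt_zero]
      · intro j h1 h2; simp [gtwt, cnt_bkMove_of_ne h1 h2]
  intro w
  induction w using perm_induction_adj with
  | h1 => intro F; rfl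
  | h2 k hk w ih =>
    intro F
    rw [← key k hk F, ← ih (fun x => F (x ∘ adjSwap k hk))]
    rfl

/-- The position of the bad pair used in the sign-reversing involution: the first row at which the
lattice condition fails, and the largest letter for which it fails there. -/
structure IsBadPair (m : ℕ) (v : ℕ → ℤ) (T : ℕ → ℕ → ℤ) (i k : ℕ) : Prop where
  lt : k + 1 < m
  viol : v k + cnt T k i < v (k + 1) + cnt T (k + 1) (i + 1)
  rows : ∀ i' < i, ∀ k', k' + 1 < m → v (k' + 1) + cnt T (k' + 1) (i' + 1) ≤ v k' + cnt T k' i'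
  letters : ∀ k', k < k' → k' + 1 < m →
    v (k' + 1) + cnt T (k' + 1) (i + 1) ≤ v k' + cnt T k' i

section involution
variable {m ℓ : ℕ} {l u v : ℕ → ℤ} {T : ℕ → ℕ → ℤ} {i k : ℕ}

lemma IsBadPair.unique {i' k' : ℕ} (h : IsBadPair m v T i k) (h' : IsBadPair m v T i' k') :
    i = i' ∧ k = k' := by
  have e : i = i' := by
    rcases lt_trichotomy i i' with e | e | e
    · exact absurd (h'.rows i e k h.lt) (not_le.2 h.viol)
    · exact e
    · exact absurd (h.rows i' e k' h'.lt) (not_le.2 h'.viol)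
  subst e
  refine ⟨rfl, ?_⟩
  rcases lt_trichotomy k k' with e | e | e
  · exact absurd (h.letters k' e h'.lt) (not_le.2 h'.viol)
  · exact e
  · exact absurd (h'.letters k e h.lt) (not_le.2 h.viol)

lemma exists_isBadPair (h : ¬ IsGood m v T) : ∃ p : ℕ × ℕ, IsBadPair m v T p.1 p.2 := by
  classical
  have h0 : ∃ i k, k + 1 < m ∧ v k + cnt T k i < v (k + 1) + cnt T (k + 1) (i + 1) := by
    unfold IsGood at h; push Not at h; exact h
  obtain ⟨k₁, hk₁, hv₁⟩ := Nat.find_spec h0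
  set i := Nat.find h0
  let S := (Finset.range m).filter fun k =>
    k + 1 < m ∧ v k + cnt T k i < v (k + 1) + cnt T (k + 1) (i + 1)
  have hS : S.Nonempty := ⟨k₁, by simp only [S, Finset.mem_filter, Finset.mem_range]; exact ⟨by omega, hk₁, hv₁⟩⟩
  have hmax := Finset.max'_mem S hS
  set k := S.max' hS with hk
  simp only [S, Finset.mem_filter, Finset.mem_range] at hmax
  refine ⟨(i, k), hmax.2.1, hmax.2.2, ?_, ?_⟩
  · intro i' hi' k' hk'
    by_contra hc
    exact Nat.find_min h0 hi' ⟨k', hk', not_le.1 hc⟩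
  · intro k' hk' hkm
    by_contra hc
    have : k' ≤ k := Finset.le_max' S k' (by
      simp only [S, Finset.mem_filter, Finset.mem_range]; exact ⟨by omega, hkm, not_le.1 hc⟩)
    omega

/-- The shift in the generalized Bender-Knuth move at a bad pair. -/
def badShift (v : ℕ → ℤ) (T : ℕ → ℕ → ℤ) (i k : ℕ) : ℤ :=
  v k + cnt T k i + 1 - v (k + 1) - cnt T (k + 1) i

lemma IsBadPair.bounds (h : IsGT m l u T) (hb : IsBadPair m v T i k)
    (hv : ∀ k, k + 1 < m → v (k + 1) ≤ v k) :
    0 ≤ badShift v T i k ∧ T (k + 1) i ≤ T (k + 2) i - badShift v T i k ∧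
      ∀ j, i = j + 1 → T (k + 2) i - badShift v T i k ≤ T k j := by
  have h1 := hb.viol
  rw [cnt_succ, show k + 1 + 1 = k + 2 from rfl] at h1
  refine ⟨?_, ?_, ?_⟩
  · rcases i with _ | j
    · have := hv k hb.lt; simp [badShift, cnt_zero]; omega
    · have h2 := hb.rows j (by omega) k hb.lt
      have h3 := h.cnt_mono k (Nat.le_succ j)
      simp only [badShift, Nat.succ_eq_add_one] at *; omega
  · simp only [badShift]; omega
  · rintro j rfl
    have h2 := hb.rows j (by omega) k hb.lt
    have h3 := (h.inter (k + 1) j).2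
    rw [show k + 1 + 1 = k + 2 from rfl] at h3
    have h4 := cnt_succ T k j
    simp only [badShift]; omega

lemma IsBadPair.lt_row (h : IsGT m l u T) (hl : ∀ i, ℓ ≤ i → l i = 0) (hu : ∀ i, 0 ≤ u i)
    (hb : IsBadPair m v T i k) (hv : ∀ k, k + 1 < m → v (k + 1) ≤ v k) : i < ℓ := by
  by_contra hc
  have h1 := hb.viol
  rw [h.cnt_eq hl hu k (i := i) (by omega), h.cnt_eq hl hu (k + 1) (i := i + 1) (by omega)] at h1
  rcases ℓ with _ | j
  · have := hv k hb.lt; simp only [cnt_zero] at h1; omega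
  · have h2 := hb.rows j (by omega) k hb.lt
    have h3 := h.cnt_mono k (Nat.le_succ j)
    simp only [Nat.succ_eq_add_one] at *; omega

lemma IsBadPair.bkMove (h : IsGT m l u T) (hb : IsBadPair m v T i k)
    (hv : ∀ k, k + 1 < m → v (k + 1) ≤ v k) :
    IsBadPair m v (bkMove T k i (badShift v T i k)) i k := by
  obtain ⟨h1, h2, h3⟩ := hb.bounds h hv
  refine ⟨hb.lt, ?_, ?_, ?_⟩
  · rw [cnt_succ, cnt_bkMove_of_le le_rfl, cnt_bkMove_of_le le_rfl, bkMove_ne (by omega), bkMove_self,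
      bkRow_self]
    have e1 := (h.inter k i).1
    have e2 := (h.inter (k + 1) i).2
    simp only [badShift, add_assoc, Nat.reduceAdd] at *
    omega
  · intro i' hi' k' hk'
    rw [cnt_bkMove_of_le (by omega), cnt_bkMove_of_le (by omega)]
    exact hb.rows i' hi' k' hk'
  · intro k' hk' hkm
    rw [cnt_bkMove_of_le le_rfl, cnt_bkMove_of_ne (by omega) (by omega)]
    exact hb.letters k' hk' hkm

lemma badShift_bkMove {t : ℤ} : badShift v (bkMove T k i t) i k = badShift v T i k := by
  simp [badShift, cnt_bkMove_of_le le_rfl]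

open Classical in
/-- The sign-reversing involution on fillings violating the lattice condition. -/
def badInv (m : ℕ) (v : ℕ → ℤ) (T : ℕ → ℕ → ℤ) : ℕ → ℕ → ℤ :=
  if h : ∃ p : ℕ × ℕ, IsBadPair m v T p.1 p.2 then
    bkMove T h.choose.2 h.choose.1 (badShift v T h.choose.1 h.choose.2) else T

lemma IsBadPair.badInv_eq (h : IsBadPair m v T i k) :
    badInv m v T = _root_.bkMove T k i (badShift v T i k) := by
  have hex : ∃ p : ℕ × ℕ, IsBadPair m v T p.1 p.2 := ⟨(i, k), h⟩
  obtain ⟨e1, e2⟩ := hex.choose_spec.unique h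
  rw [badInv, dif_pos hex, e1, e2]

end involution

lemma not_isGood_of_isBadPair {m i k : ℕ} {v : ℕ → ℤ} {T : ℕ → ℕ → ℤ} (h : IsBadPair m v T i k) :
    ¬ IsGood m v T := fun hg => absurd (hg i k h.lt) (not_le.2 h.viol)

lemma Asym.adj {m : ℕ} {f : (Fin m → ℤ) → ℤ} (hf : Asym f) {k : ℕ} (hk : k + 1 < m)
    (x : Fin m → ℤ) : f (x ∘ adjSwap k hk) = - f x := by
  rw [hf, adjSwap, Equiv.Perm.sign_swap]
  · simp
  · intro h; simp at h

open Classical in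
/-- Cancellation of the fillings violating the lattice condition. -/
theorem sum_asym_eq_sum_good {m ℓ : ℕ} {l u v : ℕ → ℤ} (hl : ∀ i, ℓ ≤ i → l i = 0)
    (hu : ∀ i, 0 ≤ u i) (hv : ∀ k, k + 1 < m → v (k + 1) ≤ v k) {f : (Fin m → ℤ) → ℤ}
    (hf : Asym f) :
    ∑ T ∈ gtFin m l u, f (fun k => v k - k + gtwt m ℓ T k)
      = ∑ T ∈ (gtFin m l u).filter (IsGood m v), f (fun k => v k - k + gtwt m ℓ T k) := by
  rw [← Finset.sum_filter_add_sum_filter_not (gtFin m l u) (IsGood m v)]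
  rw [add_eq_left]
  have key : ∀ T ∈ (gtFin m l u).filter (fun T => ¬ IsGood m v T),
      ∃ i k, ∃ hk : k + 1 < m, IsBadPair m v T i k ∧ IsBadPair m v (badInv m v T) i k ∧
        badInv m v T = bkMove T k i (badShift v T i k) ∧ IsGT m l u (badInv m v T) ∧
        (fun j : Fin m => v j - j + gtwt m ℓ (badInv m v T) j)
          = (fun j : Fin m => v j - j + gtwt m ℓ T j) ∘ adjSwap k hk := by
    intro T hT
    rw [Finset.mem_filter, mem_gtFin hl hu] at hT
    obtain ⟨⟨i, k⟩, hb⟩ := exists_isBadPair hT.2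
    dsimp only at hb
    obtain ⟨h1, h2, h3⟩ := hb.bounds hT.1 hv
    have e := hb.badInv_eq
    have hi := hb.lt_row hT.1 hl hu hv
    refine ⟨i, k, hb.lt, hb, e ▸ hb.bkMove hT.1 hv, e, e ▸ isGT_bkMove hT.1 hb.lt h1 h2 h3, ?_⟩
    rw [e]
    refine adjSwap_cases hb.lt _ _ ?_ ?_ ?_
    · simp only [gtwt, cnt_bkMove_left hT.1 hl hu hi, badShift]; push_cast; ring
    · simp only [gtwt, cnt_bkMove_right hT.1 hl hu hi, badShift]; push_cast; ring
    · intro j h1 h2; simp [gtwt, cnt_bkMove_of_ne h1 h2]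
  refine Finset.sum_involution (fun T _ => badInv m v T) ?_ ?_ ?_ ?_
  · intro T hT
    obtain ⟨i, k, hk, -, -, -, -, e⟩ := key T hT
    rw [e, hf.adj hk]; ring
  · intro T hT h0 heq
    obtain ⟨i, k, hk, -, -, -, -, e⟩ := key T hT
    have := hf.adj hk (fun j : Fin m => v j - j + gtwt m ℓ T j)
    rw [← e, heq] at this
    omega
  · intro T hT
    obtain ⟨i, k, hk, -, hb, -, hg, -⟩ := key T hT
    rw [Finset.mem_filter, mem_gtFin hl hu]
    exact ⟨hg, not_isGood_of_isBadPair hb⟩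
  · intro T hT
    obtain ⟨i, k, hk, hb, hb', e, hg, -⟩ := key T hT
    rw [hb'.badInv_eq, e, badShift_bkMove, bkMove_bkMove]
end

noncomputable section

/-- The coefficient of the bialternant with exponent `c` in an alternating sum of monomials. -/
def alt {m : ℕ} (c x : Fin m → ℤ) : ℤ :=
  ∑ w : Equiv.Perm (Fin m), (Equiv.Perm.sign w : ℤ) * if x ∘ w = c then 1 else 0

lemma asym_alt {m : ℕ} (c : Fin m → ℤ) : Asym (alt c) := by
  intro w x
  rw [alt, alt, Finset.mul_sum, ← Equiv.sum_comp (Equiv.mulLeft w⁻¹)]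
  refine Finset.sum_congr rfl fun v _ => ?_
  have : (x ∘ w) ∘ (w⁻¹ * v : Equiv.Perm (Fin m)) = x ∘ v := by funext j; simp
  simp only [Equiv.coe_mulLeft, this, Equiv.Perm.sign_mul, Equiv.Perm.sign_inv]
  push_cast; ring

lemma alt_comm {m : ℕ} (c x : Fin m → ℤ) : alt c x = alt x c := by
  rw [alt, alt, ← Equiv.sum_comp (Equiv.inv (Equiv.Perm (Fin m)))]
  refine Finset.sum_congr rfl fun v _ => ?_
  have : x ∘ (v⁻¹ : Equiv.Perm (Fin m)) = c ↔ c ∘ v = x := by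
    constructor
    · rintro rfl; funext j; simp
    · rintro rfl; funext j; simp
  simp only [Equiv.inv_apply, this, Equiv.Perm.sign_inv]

lemma alt_neg {m : ℕ} (c x : Fin m → ℤ) : alt (-c) (-x) = alt c x := by
  refine Finset.sum_congr rfl fun v _ => ?_
  have : (-x) ∘ v = -c ↔ x ∘ v = c := by
    constructor
    · intro h; funext j; have := congrFun h j; simpa using this
    · rintro rfl; rfl
  simp only [this]

lemma alt_add {m : ℕ} (c x : Fin m → ℤ) (a : ℤ) :
    alt (fun i => c i + a) (fun i => x i + a) = alt c x := by
  refine Finset.sum_congr rfl fun v _ => ?_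
  have : (fun i => x i + a) ∘ v = (fun i => c i + a) ↔ x ∘ v = c := by
    constructor
    · intro h; funext j; have := congrFun h j; simpa using this
    · rintro rfl; rfl
  simp only [this]

lemma alt_of_strictAnti {m : ℕ} {c x : Fin m → ℤ} (hc : StrictAnti c) (hx : StrictAnti x) :
    alt c x = if x = c then 1 else 0 := by
  rw [alt, Finset.sum_eq_single 1]
  · simp
  · intro w _ hw
    rw [if_neg, mul_zero]
    intro h
    apply hw
    have hm : StrictMono w := fun i j hij => by
      have := hc hij
      rw [← h] at this
      exact hx.lt_iff_gt.1 this
    have : ∀ i, w i = i := fun i => by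
      have := congrFun (congrArg DFunLike.coe
        (Subsingleton.elim (hm.orderIsoOfSurjective w w.surjective) (OrderIso.refl (Fin m)))) i
      simpa using this
    exact Equiv.ext this
  · simp

lemma SymFam.neg {ι : Type*} {m : ℕ} {X : Finset ι} {x : ι → Fin m → ℤ} (h : SymFam X x) :
    SymFam X (fun a => - x a) := fun w F => h w fun y => F (-y)

lemma SymFam.prod {ι κ : Type*} {m : ℕ} {X : Finset ι} {x : ι → Fin m → ℤ} {Y : Finset κ}
    {y : κ → Fin m → ℤ} (h : SymFam X x) (h' : SymFam Y y) :
    SymFam (X ×ˢ Y) (fun a => x a.1 + y a.2) := by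
  intro w F
  simp only [Finset.sum_product]
  calc ∑ a ∈ X, ∑ b ∈ Y, F ((x a + y b) ∘ w)
      = ∑ a ∈ X, ∑ b ∈ Y, F (x a ∘ w + y b ∘ w) := rfl
    _ = ∑ a ∈ X, ∑ b ∈ Y, F (x a + y b ∘ w) := h w fun z => ∑ b ∈ Y, F (z + y b ∘ w)
    _ = _ := Finset.sum_congr rfl fun a _ => h' w fun z => F (x a + z)

lemma SymFam.asym {ι : Type*} {m : ℕ} {X : Finset ι} {x : ι → Fin m → ℤ} (h : SymFam X x)
    {f : (Fin m → ℤ) → ℤ} (hf : Asym f) : Asym fun l => ∑ a ∈ X, f (l + x a) := by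
  intro w l
  calc ∑ a ∈ X, f (l ∘ w + x a) = ∑ a ∈ X, f (l ∘ w + x a ∘ w) :=
        (h w fun z => f (l ∘ w + z)).symm
    _ = ∑ a ∈ X, f ((l + x a) ∘ w) := rfl
    _ = _ := by simp only [hf w, Finset.mul_sum]

lemma SymFam.sum_alt {ι : Type*} {m : ℕ} {X : Finset ι} {x : ι → Fin m → ℤ} (h : SymFam X x)
    (b c : Fin m → ℤ) : ∑ a ∈ X, alt c (b + x a)
      = ∑ w : Equiv.Perm (Fin m), (Equiv.Perm.sign w : ℤ) *
          ∑ a ∈ X, if x a = c - b ∘ w then 1 else 0 := by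
  simp only [alt]
  rw [Finset.sum_comm]
  refine Finset.sum_congr rfl fun w _ => ?_
  rw [← Finset.mul_sum]
  congr 1
  rw [← h w (fun y => if y = c - b ∘ w then 1 else 0)]
  refine Finset.sum_congr rfl fun a _ => ?_
  have : (b + x a) ∘ w = c ↔ x a ∘ w = c - b ∘ w := by
    rw [eq_sub_iff_add_eq, add_comm]; rfl
  simp only [this]

lemma SymFam.sum_alt_swap {ι : Type*} {m : ℕ} {X : Finset ι} {x : ι → Fin m → ℤ} (h : SymFam X x)
    (b c : Fin m → ℤ) : ∑ a ∈ X, alt c (b - x a) = ∑ a ∈ X, alt b (c + x a) := by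
  have := h.neg.sum_alt b c
  simp only [← sub_eq_add_neg] at this
  rw [this, Finset.sum_congr rfl fun a _ => alt_comm b (c + x a)]
  simp only [alt, Finset.sum_comm (s := X), Finset.mul_sum]
  refine Finset.sum_congr rfl fun w _ => Finset.sum_congr rfl fun a _ => ?_
  have : -x a = c - b ∘ w ↔ b ∘ w = c + x a := by
    constructor
    · intro h; funext j; have := congrFun h j; simp at this ⊢; omega
    · intro h; funext j; have := congrFun h j; simp at this ⊢; omega
  simp only [this]

/-- Reflection of the alternating sum through the longest permutation. -/
lemma SymFam.sum_alt_rev {ι : Type*} {m : ℕ} {X : Finset ι} {x : ι → Fin m → ℤ} (h : SymFam X x)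
    (v : Fin m → ℤ) :
    ∑ a ∈ X, alt (fun i => -(i : ℤ)) (fun i => -v i.rev - i + x a i)
      = ∑ a ∈ X, alt (fun i => v i - i) (fun i => -(i : ℤ) + x a i) := by
  have h2 : ∀ c y : Fin m → ℤ, alt (c ∘ Fin.revPerm) (y ∘ Fin.revPerm) = alt c y := by
    intro c y
    rw [asym_alt, alt_comm, asym_alt, alt_comm, ← mul_assoc]
    norm_cast
    simp
  have e1 : ∀ a, alt (fun i : Fin m => -(i : ℤ)) (fun i => -v i.rev - i + x a i)
      = alt (fun i : Fin m => -(i : ℤ)) ((fun i : Fin m => v i - i) - (x a ∘ Fin.revPerm)) := by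
    intro a
    rw [alt_comm, ← alt_neg, ← h2, ← alt_add _ _ (-((m : ℤ) - 1)), alt_comm]
    congr 1
    · funext i
      have := i.isLt
      simp [Fin.val_rev]
    · funext i
      have := i.isLt
      simp [Fin.val_rev]; omega
  have h3 : SymFam X (fun a => x a ∘ Fin.revPerm) := fun w F => by
    have k1 := h Fin.revPerm (fun y => F (y ∘ w))
    have k2 := h Fin.revPerm F
    exact k1.trans ((h w F).trans k2.symm)
  simp only [e1]
  rw [h3.sum_alt_swap]
  exact h Fin.revPerm fun y => alt (fun i : Fin m => v i - i) ((fun i : Fin m => -(i : ℤ)) + y)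
end

noncomputable section

/-- Transposition of fillings: the roles of rows and letters are exchanged. -/
def gtTr (v : ℕ → ℤ) (T : ℕ → ℕ → ℤ) (k i : ℕ) : ℤ := v i + cnt T i k

lemma cnt_gtTr (v : ℕ → ℤ) (T : ℕ → ℕ → ℤ) (i k : ℕ) : cnt (gtTr v T) i k = T k i - T 0 i := by
  induction k with
  | zero => simp [cnt_zero]
  | succ k ih => rw [cnt_succ, ih]; simp only [gtTr, cnt_succ]; ring

lemma gtTr_gtTr {v w : ℕ → ℤ} {T : ℕ → ℕ → ℤ} (h : T 0 = w) : gtTr w (gtTr v T) = T := by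
  funext k i
  rw [gtTr, cnt_gtTr, h]; ring

/-- The fillings satisfying the lattice condition from `v` to `w`. -/
def goodFin (m ℓ : ℕ) (l u v w : ℕ → ℤ) : Finset (ℕ → ℕ → ℤ) :=
  haveI := Classical.decPred fun T => IsGood m v T ∧ ∀ k < m, v k + cnt T k ℓ = w k
  (gtFin m l u).filter fun T => IsGood m v T ∧ ∀ k < m, v k + cnt T k ℓ = w k

lemma zero_le_zero_fun (i : ℕ) : 0 ≤ (0 : ℕ → ℤ) i := le_rfl

section tr
variable {m ℓ : ℕ} {l u v w s d : ℕ → ℤ} {T S : ℕ → ℕ → ℤ}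

lemma mem_goodFin (hl : ∀ i, ℓ ≤ i → l i = 0) (hu : ∀ i, 0 ≤ u i) :
    T ∈ goodFin m ℓ l u v w ↔ IsGT m l u T ∧ IsGood m v T ∧ ∀ k < m, v k + cnt T k ℓ = w k := by
  simp [goodFin, mem_gtFin hl hu]

lemma isGT_gtTr (h : IsGT m l d T) (hg : IsGood m 0 T) (hl : ∀ i, ℓ ≤ i → l i = 0)
    (hd : ∀ i, 0 ≤ d i) (hs : ∀ k, m ≤ k → s k = 0) (hw : ∀ k < m, 0 + cnt T k ℓ = s k) :
    IsGT ℓ s 0 (gtTr 0 T) ∧ IsGood ℓ d (gtTr 0 T) ∧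
      ∀ i < ℓ, d i + cnt (gtTr 0 T) i m = l i := by
  have hgood : ∀ i k, cnt T (k + 1) (i + 1) ≤ cnt T k i := by
    intro i k
    by_cases hk : k + 1 < m
    · simpa using hg i k hk
    · rw [h.cnt_top (by omega)]; exact h.cnt_nonneg _ _
  refine ⟨⟨?_, ?_, ?_⟩, ?_, ?_⟩
  · funext k; simp [gtTr, cnt_zero]
  · intro i hi
    funext k
    simp only [gtTr, Pi.zero_apply, zero_add]
    by_cases hk : k < m
    · rw [h.cnt_eq hl hd k hi, ← hw k hk, zero_add]
    · rw [h.cnt_top (by omega), hs k (by omega)]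
  · intro i k
    simp only [gtTr, Pi.zero_apply, zero_add]
    exact ⟨h.cnt_mono k (Nat.le_succ i), hgood i k⟩
  · intro k i hi
    rw [cnt_gtTr, cnt_gtTr, h.zero]
    have := (h.inter k i).2
    omega
  · intro i hi
    rw [cnt_gtTr, h.zero, h.top m le_rfl]; ring

lemma isGT_gtTr_symm (h : IsGT ℓ s 0 S) (hg : IsGood ℓ d S) (hl : ∀ i, ℓ ≤ i → l i = 0)
    (hd : ∀ i, 0 ≤ d i) (hd' : ∀ i, ℓ ≤ i → d i = 0)
    (hs : ∀ k, m ≤ k → s k = 0) (hw : ∀ i < ℓ, d i + cnt S i m = l i) :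
    IsGT m l d (gtTr d S) ∧ IsGood m 0 (gtTr d S) ∧
      ∀ k < m, 0 + cnt (gtTr d S) k ℓ = s k := by
  refine ⟨⟨?_, ?_, ?_⟩, ?_, ?_⟩
  · funext k; simp [gtTr, cnt_zero]
  · intro k hk
    funext i
    simp only [gtTr]
    rw [h.cnt_eq hs zero_le_zero_fun i hk]
    by_cases hi : i < ℓ
    · exact hw i hi
    · rw [h.cnt_top (by omega), hl i (by omega), hd' i (by omega)]; rfl
  · intro k i
    simp only [gtTr]
    refine ⟨by have := h.cnt_mono i (Nat.le_succ k); simp only [Nat.succ_eq_add_one] at this; omega, ?_⟩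
    by_cases hi : i + 1 < ℓ
    · exact hg k i hi
    · rw [h.cnt_top (by omega), hd' (i + 1) (by omega)]
      have := h.cnt_nonneg i k
      have := hd i
      omega
  · intro i k hk
    rw [cnt_gtTr, cnt_gtTr, h.zero]
    have := (h.inter i k).2
    simp only [Pi.zero_apply]; omega
  · intro k hk
    rw [cnt_gtTr, h.zero, h.top ℓ le_rfl]; simp

/-- Exchanging rows and letters preserves the number of lattice fillings. -/
lemma card_goodFin_tr (hl : ∀ i, ℓ ≤ i → l i = 0) (hd : ∀ i, 0 ≤ d i) (hd' : ∀ i, ℓ ≤ i → d i = 0)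
    (hs : ∀ k, m ≤ k → s k = 0) :
    (goodFin m ℓ l d 0 s).card = (goodFin ℓ m s 0 d l).card := by
  refine Finset.card_nbij' (gtTr 0) (gtTr d) ?_ ?_ ?_ ?_
  · intro T hT
    rw [Finset.mem_coe, mem_goodFin hl hd] at hT
    rw [Finset.mem_coe, mem_goodFin hs zero_le_zero_fun]
    exact isGT_gtTr hT.1 hT.2.1 hl hd hs hT.2.2
  · intro T hT
    rw [Finset.mem_coe, mem_goodFin hs zero_le_zero_fun] at hT
    rw [Finset.mem_coe, mem_goodFin hl hd]
    exact isGT_gtTr_symm hT.1 hT.2.1 hl hd hd' hs hT.2.2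
  · intro T hT
    rw [Finset.mem_coe, mem_goodFin hl hd] at hT
    exact gtTr_gtTr hT.1.zero
  · intro T hT
    rw [Finset.mem_coe, mem_goodFin hs zero_le_zero_fun] at hT
    exact gtTr_gtTr hT.1.zero

end tr

/-- The only lattice filling of a straight shape. -/
def straightGT (s : ℕ → ℤ) (k r : ℕ) : ℤ := if r < k then s r else 0

lemma eq_straightGT {m : ℕ} {s : ℕ → ℤ} {T : ℕ → ℕ → ℤ} 
    (h : IsGT m s 0 T) (hg : IsGood m 0 T) : T = straightGT s := by
  have h1 : ∀ k r, k ≤ r → T k r = 0 := by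
    intro k
    induction k with
    | zero => intro r _; rw [h.zero]; rfl
    | succ k ih =>
      intro r hr
      obtain ⟨j, rfl⟩ : ∃ j, r = j + 1 := ⟨r - 1, by omega⟩
      have e1 := (h.inter k j).2
      have e2 := h.bot_le (k + 1) (j + 1)
      rw [ih j (by omega)] at e1
      simp only [Pi.zero_apply] at e2; omega
  have h2 : ∀ i k, i ≤ k → k < m → cnt T k i = 0 := by
    intro i
    induction i with
    | zero => intro k _ _; exact cnt_zero _ _
    | succ i ih =>
      intro k hk hkm
      obtain ⟨j, rfl⟩ : ∃ j, k = j + 1 := ⟨k - 1, by omega⟩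
      have := hg i j hkm
      rw [ih j (by omega) (by omega)] at this
      have e := h.cnt_nonneg (j + 1) (i + 1)
      simp only [Pi.zero_apply] at this; omega
  have h3 : ∀ r k, r < k → k ≤ m → T k r = s r := by
    intro r k hrk hkm
    induction hkm using Nat.decreasingInduction with
    | self => rw [h.top m le_rfl]
    | of_succ k hkm ih =>
      have e := cnt_succ T k r
      rw [h2 (r + 1) k (by omega) hkm, h2 r k (by omega) hkm] at e
      have := ih (by omega)
      omega
  funext k r
  rw [straightGT]
  split_ifs with hr
  · by_cases hk : k ≤ m
    · exact h3 r k hr hk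
    · rw [h.top k (by omega)]
  · exact h1 k r (by omega)

lemma cnt_straightGT (s : ℕ → ℤ) (k i : ℕ) :
    cnt (straightGT s) k i = if k < i then s k else 0 := by
  induction i with
  | zero => simp [cnt_zero]
  | succ i ih =>
    rw [cnt_succ, ih]; simp only [straightGT]
    rcases lt_trichotomy k i with e | e | e
    · simp [e, e.not_gt, show ¬ i < k + 1 by omega, show k < i + 1 by omega]
    · subst e; simp
    · simp [e.not_gt, e, show i < k + 1 by omega, show ¬ k < i + 1 by omega]

lemma isGT_straightGT {m : ℕ} {s : ℕ → ℤ} (hs : ∀ i, m ≤ i → s i = 0) (hs0 : ∀ i, 0 ≤ s i)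
    (ha : ∀ i, s (i + 1) ≤ s i) : IsGT m s 0 (straightGT s) ∧ IsGood m 0 (straightGT s) := by
  refine ⟨⟨?_, ?_, ?_⟩, ?_⟩
  · funext r; simp [straightGT]
  · intro k hk
    funext r
    simp only [straightGT]
    split_ifs with h
    · rfl
    · exact (hs r (by omega)).symm
  · intro k r
    have h1 := hs0 r
    have h2 := ha r
    simp only [straightGT]
    constructor <;> split_ifs <;> omega
  · intro i k hk
    have h1 := hs0 k
    have h2 := ha k
    simp only [cnt_straightGT, Pi.zero_apply]
    split_ifs <;> omega
end

noncomputable section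

/-- A tableau and a filling by shapes describe the same object. -/
def TabRel (Tab : ℕ → ℕ → ℕ) (T : ℕ → ℕ → ℤ) : Prop :=
  ∀ r i j, Tab i j = r + 1 ↔ T r i ≤ j ∧ (j : ℤ) < T (r + 1) i

lemma ncard_region {m : ℕ} {l u : ℕ → ℤ} {T : ℕ → ℕ → ℤ} {Tab : ℕ → ℕ → ℕ} (h : IsGT m l u T)
    (hu : ∀ i, 0 ≤ u i) (hr : TabRel Tab T) (i j r : ℕ) :
    (Set.ncard {p : ℕ × ℕ | (p.1 < i ∨ (p.1 = i ∧ j ≤ p.2)) ∧ Tab p.1 p.2 = r + 1} : ℤ)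
      = cnt T r i + max 0 (T (r + 1) i - max (j : ℤ) (T r i)) := by
  let F : Finset (Σ _ : ℕ, ℕ) := (Finset.range (i + 1)).sigma fun i' =>
    Finset.Ico (max (if i' < i then 0 else j) (T r i').toNat) (T (r + 1) i').toNat
  have hF : {p : ℕ × ℕ | (p.1 < i ∨ (p.1 = i ∧ j ≤ p.2)) ∧ Tab p.1 p.2 = r + 1}
      = ↑(F.map (Equiv.sigmaEquivProd ℕ ℕ).toEmbedding) := by
    ext ⟨a, b⟩
    simp only [Set.mem_ofPred_eq, hr r a b, Finset.coe_map, Set.mem_image, Finset.mem_coe, F,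
      Finset.mem_sigma, Finset.mem_range, Finset.mem_Ico]
    have h0 : ∀ k, 0 ≤ T k a := fun k => (hu a).trans (h.bot_le k a)
    have h1 := h0 r
    have h2 := h0 (r + 1)
    constructor
    · intro hp
      refine ⟨⟨a, b⟩, ⟨?_, ?_, ?_⟩, rfl⟩
      · show a < i + 1; omega
      · show max (if a < i then 0 else j) (T r a).toNat ≤ b
        split_ifs <;> omega
      · show b < (T (r + 1) a).toNat; omega
    · rintro ⟨⟨a', b'⟩, ⟨h3, h4, h5⟩, h6⟩
      cases h6
      dsimp only at h3 h4 h5 ⊢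
      split_ifs at h4 <;> omega
  rw [hF, Set.ncard_coe_finset, Finset.card_map, Finset.card_sigma, Finset.sum_range_succ]
  push_cast
  have h0 : ∀ k a, 0 ≤ T k a := fun k a => (hu a).trans (h.bot_le k a)
  congr 1
  · refine Finset.sum_congr rfl fun a ha => ?_
    have ha' := Finset.mem_range.1 ha
    have h1 := h0 r a
    have h2 := h0 (r + 1) a
    have h3 := (h.inter r a).1
    simp only [ha', if_true, Nat.card_Ico]
    omega
  · have h1 := h0 r i
    have h2 := h0 (r + 1) i
    simp only [lt_irrefl, if_false, Nat.card_Ico]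
    omega

lemma ncard_letter {m ℓ : ℕ} {l u : ℕ → ℤ} {T : ℕ → ℕ → ℤ} {Tab : ℕ → ℕ → ℕ} (h : IsGT m l u T)
    (hl : ∀ i, ℓ ≤ i → l i = 0) (hu : ∀ i, 0 ≤ u i) (hr : TabRel Tab T) (r : ℕ) :
    (Set.ncard {p : ℕ × ℕ | Tab p.1 p.2 = r + 1} : ℤ) = cnt T r ℓ := by
  have h1 := ncard_region h hu hr ℓ 0 r
  have e : {p : ℕ × ℕ | (p.1 < ℓ ∨ (p.1 = ℓ ∧ 0 ≤ p.2)) ∧ Tab p.1 p.2 = r + 1}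
      = {p : ℕ × ℕ | Tab p.1 p.2 = r + 1} := by
    ext ⟨a, b⟩
    simp only [Set.mem_ofPred_eq, and_iff_right_iff_imp, hr r a b]
    intro hp
    by_contra hc
    have := h.eq_zero hl hu (r + 1) (r := a) (by omega)
    omega
  rw [e, h.eq_zero hl hu _ le_rfl, h.eq_zero hl hu _ le_rfl] at h1
  rw [h1]; simp

/-- The chain of shapes of a tableau. -/
def ofTab (lam : ℕ → ℕ) (Tab : ℕ → ℕ → ℕ) (k i : ℕ) : ℤ :=
  ((Finset.range (lam i)).filter fun j => Tab i j ≤ k).card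

lemma mem_iff_lt_card_of_lower {A : Finset ℕ} (h : ∀ j ∈ A, ∀ i ≤ j, i ∈ A) (j : ℕ) :
    j ∈ A ↔ j < A.card := by
  constructor
  · intro hj
    have : Finset.range (j + 1) ⊆ A := fun i hi => h j hj i (by simp at hi; omega)
    have := Finset.card_le_card this
    simpa using this
  · intro hj
    by_contra hc
    have : A ⊆ Finset.range j := fun i hi => by
      rw [Finset.mem_range]
      by_contra hij
      exact hc (h i hi j (by omega))
    have := Finset.card_le_card this
    simp at this; omega

/-- The tableau of a chain of shapes. -/
def toTab (lam mu : ℕ → ℕ) (T : ℕ → ℕ → ℤ) (i j : ℕ) : ℕ :=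
  if mu i ≤ j ∧ j < lam i then sInf {k | (j : ℤ) < T k i} else 0

section bridge
variable {m ℓ : ℕ} {lam mu nu : ℕ → ℕ} {T : ℕ → ℕ → ℤ} {Tab : ℕ → ℕ → ℕ}

lemma ofTab_iff (h : IsLRTableau lam mu nu Tab) {i j k : ℕ} (hj : j < lam i) :
    Tab i j ≤ k ↔ (j : ℤ) < ofTab lam Tab k i := by
  rw [ofTab, Int.ofNat_lt, ← mem_iff_lt_card_of_lower]
  · simp [hj]
  · intro b hb a hab
    simp only [Finset.mem_filter, Finset.mem_range] at hb ⊢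
    refine ⟨by omega, ?_⟩
    by_cases ha : mu i ≤ a
    · exact (h.2.2.1 i a b ⟨ha, by omega⟩ ⟨by omega, hb.1⟩ hab).trans hb.2
    · have : Tab i a = 0 := by
        by_contra hc
        exact ha ((h.2.1 i a).1 hc).1
      omega

lemma ofTab_le (i k : ℕ) : ofTab lam Tab k i ≤ lam i := by
  rw [ofTab, Int.ofNat_le]
  exact (Finset.card_filter_le _ _).trans (by simp)

lemma ofTab_nonneg (i k : ℕ) : 0 ≤ ofTab lam Tab k i := Int.natCast_nonneg _

lemma tabRel_ofTab (h : IsLRTableau lam mu nu Tab) : TabRel Tab (ofTab lam Tab) := by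
  intro r i j
  by_cases hj : j < lam i
  · have h1 := ofTab_iff h hj (k := r)
    have h2 := ofTab_iff h hj (k := r + 1)
    omega
  · have h1 := ofTab_le (lam := lam) (Tab := Tab) i (r + 1)
    have h2 : Tab i j = 0 := by
      by_contra hc
      exact hj ((h.2.1 i j).1 hc).2
    omega

lemma ext_of_lt {a b L : ℤ} (ha : 0 ≤ a) (hb : 0 ≤ b) (ha' : a ≤ L) (hb' : b ≤ L)
    (h : ∀ j : ℕ, (j : ℤ) < L → ((j : ℤ) < a ↔ (j : ℤ) < b)) : a = b := by
  rcases lt_trichotomy a b with e | e | e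
  · have := h a.toNat (by omega); omega
  · exact e
  · have := h b.toNat (by omega); omega

lemma isGT_ofTab (h : IsLRTableau lam mu nu Tab) (hmu : Antitone mu) (hlam : Antitone lam)
    (hl : ∀ i, ℓ ≤ i → lam i = 0) (hnu : ∀ k, m ≤ k → nu k = 0) :
    IsGT m (fun i => lam i) (fun i => mu i) (ofTab lam Tab) ∧ IsGood m 0 (ofTab lam Tab) ∧
      ∀ k < m, 0 + cnt (ofTab lam Tab) k ℓ = nu k := by
  have hsub := h.1
  have hfin : {p : ℕ × ℕ | Tab p.1 p.2 ≠ 0}.Finite := by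
    refine Set.Finite.subset (Finset.finite_toSet
      ((Finset.range ℓ).biUnion fun i => (Finset.range (lam i)).image fun j => (i, j))) ?_
    rintro ⟨i, j⟩ hp
    have := ((h.2.1 i j).1 hp).2
    simp only [Finset.coe_biUnion, Set.mem_iUnion, Finset.coe_image, Set.mem_image]
    refine ⟨i, ?_, j, by simpa using this, rfl⟩
    by_contra hc
    have := hl i (by simpa using hc)
    omega
  have htop : ∀ i j, Tab i j ≤ m := by
    intro i j
    by_contra hc
    obtain ⟨r, hr⟩ : ∃ r, Tab i j = r + 1 := ⟨Tab i j - 1, by omega⟩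
    have h1 := h.2.2.2.2.1 r
    rw [hnu r (by omega), Set.ncard_eq_zero (hfin.subset fun p hp => by
      simp only [Set.mem_ofPred_eq] at hp ⊢; omega)] at h1
    have : ((i, j) : ℕ × ℕ) ∈ {p : ℕ × ℕ | Tab p.1 p.2 = r + 1} := hr
    rw [h1] at this
    exact this
  have hrel := tabRel_ofTab h
  have hGT : IsGT m (fun i => lam i) (fun i => mu i) (ofTab lam Tab) := by
    refine ⟨?_, ?_, ?_⟩
    · funext i
      refine ext_of_lt (ofTab_nonneg _ _) (by positivity) (ofTab_le _ _)
        (by exact_mod_cast hsub i) ?_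
      intro j hj
      have hj' : j < lam i := by exact_mod_cast hj
      rw [← ofTab_iff h hj', Nat.le_zero, ← not_iff_not, ← ne_eq, h.2.1]
      simp only [InSkew]; omega
    · intro k hk
      funext i
      refine ext_of_lt (ofTab_nonneg _ _) (by positivity) (ofTab_le _ _) le_rfl ?_
      intro j hj
      have hj' : j < lam i := by exact_mod_cast hj
      rw [← ofTab_iff h hj']
      have := htop i j
      omega
    · intro k i
      constructor
      · rw [ofTab, ofTab, Int.ofNat_le]
        refine Finset.card_le_card fun j => ?_
        simp only [Finset.mem_filter]
        exact fun hj => ⟨hj.1, hj.2.trans (Nat.le_succ k)⟩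
      · by_contra hc
        push Not at hc
        have h0 := ofTab_nonneg (lam := lam) (Tab := Tab) i k
        have h1 := ofTab_le (lam := lam) (Tab := Tab) (i + 1) (k + 1)
        obtain ⟨j, hj⟩ : ∃ j : ℕ, (j : ℤ) = ofTab lam Tab k i := ⟨_, Int.toNat_of_nonneg h0⟩
        have hj1 : j < lam (i + 1) := by omega
        have h2 := (ofTab_iff h hj1 (k := k + 1)).2 (by omega)
        have h3 := hsub (i + 1)
        by_cases hj0 : j < lam i
        · have h4 := (ofTab_iff h hj0 (k := k)).not.2 (by omega)
          have h5 := (h.2.1 i j).1 (by omega)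
          have h6 : InSkew lam mu (i + 1) j := ⟨(hmu (Nat.le_succ i)).trans h5.1, hj1⟩
          have := h.2.2.2.1 i (i + 1) j h5 h6 (by omega)
          omega
        · have : lam (i + 1) ≤ lam i := hlam (Nat.le_succ i)
          omega
  refine ⟨hGT, ?_, ?_⟩
  · intro i r hr
    have h1 := h.2.2.2.2.2 i (ofTab lam Tab (r + 1) i).toNat r
    rw [← Int.ofNat_le] at h1
    rw [show r + 2 = r + 1 + 1 from rfl, ncard_region hGT (fun _ => by positivity) hrel,
      ncard_region hGT (fun _ => by positivity) hrel] at h1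
    have h2 := ofTab_nonneg (lam := lam) (Tab := Tab) i (r + 1)
    have h3 := (hGT.inter r i).1
    have h4 := (hGT.inter (r + 1) i).1
    rw [cnt_succ]
    simp only [Pi.zero_apply]
    omega
  · intro k hk
    rw [← ncard_letter hGT (fun i hi => by simp [hl i hi]) (fun _ => by positivity) hrel,
      h.2.2.2.2.1 k, zero_add]

lemma toTab_le_iff (h : IsGT m (fun i => lam i) (fun i => mu i) T) {i j k : ℕ} (hj : j < lam i) :
    toTab lam mu T i j ≤ k ↔ (j : ℤ) < T k i := by
  rw [toTab]
  split_ifs with h1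
  · have hne : {k | (j : ℤ) < T k i}.Nonempty := by
      refine ⟨m, ?_⟩
      rw [Set.mem_ofPred_eq, h.top m le_rfl]
      exact Int.ofNat_lt.2 hj
    constructor
    · intro hk
      exact (Nat.sInf_mem hne).trans_le (h.mono hk i)
    · intro hk
      exact Nat.sInf_le hk
  · simp only [Nat.zero_le, true_iff]
    have : (mu i : ℤ) ≤ T k i := h.bot_le k i
    omega

lemma toTab_ne_zero_iff (h : IsGT m (fun i => lam i) (fun i => mu i) T) (i j : ℕ) :
    toTab lam mu T i j ≠ 0 ↔ InSkew lam mu i j := by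
  by_cases hj : j < lam i
  · rw [ne_eq, ← Nat.le_zero, toTab_le_iff h hj, h.zero, InSkew]
    show ¬ (j : ℤ) < mu i ↔ _
    omega
  · simp [toTab, InSkew, hj]

lemma tabRel_toTab (h : IsGT m (fun i => lam i) (fun i => mu i) T) :
    TabRel (toTab lam mu T) T := by
  intro r i j
  by_cases hj : j < lam i
  · have h1 := toTab_le_iff h hj (k := r)
    have h2 := toTab_le_iff h hj (k := r + 1)
    omega
  · have h1 : T (r + 1) i ≤ lam i := h.le_top (r + 1) i
    have h2 : toTab lam mu T i j = 0 := by simp [toTab, hj]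
    omega

lemma isLRTableau_toTab (h : IsGT m (fun i => lam i) (fun i => mu i) T) (hg : IsGood m 0 T)
    (hw : ∀ k < m, 0 + cnt T k ℓ = nu k)
    (hl : ∀ i, ℓ ≤ i → lam i = 0) (hnu : ∀ k, m ≤ k → nu k = 0) :
    IsLRTableau lam mu nu (toTab lam mu T) := by
  have hrel := tabRel_toTab h
  have hl' : ∀ i, ℓ ≤ i → (lam i : ℤ) = 0 := fun i hi => by simp [hl i hi]
  have hu' : ∀ i, (0 : ℤ) ≤ mu i := fun _ => by positivity
  refine ⟨?_, toTab_ne_zero_iff h, ?_, ?_, ?_, ?_⟩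
  · intro i
    have h1 := h.bot_le m i
    rw [h.top m le_rfl] at h1
    exact Int.ofNat_le.1 h1
  · intro i j k hj hk hjk
    rw [toTab_le_iff h hj.2]
    have := (toTab_le_iff h hk.2).1 le_rfl
    omega
  · intro i k j hi hk hik
    obtain ⟨c, hc⟩ : ∃ c, toTab lam mu T k j = c + 1 :=
      ⟨toTab lam mu T k j - 1, by have := (toTab_ne_zero_iff h k j).2 hk; omega⟩
    rw [hc, Nat.lt_succ_iff, toTab_le_iff h hi.2]
    have h1 := (toTab_le_iff h hk.2).1 hc.le
    have h2 : T (c + 1) k ≤ T (c + 1) (i + 1) := h.anti (c + 1) hik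
    have h3 := (h.inter c i).2
    omega
  · intro r
    rw [← Int.natCast_inj, ncard_letter h hl' hu' hrel]
    rcases lt_or_ge r m with hr | hr
    · rw [← hw r hr, zero_add]
    · rw [h.cnt_top hr, hnu r hr]; rfl
  · intro i j r
    rw [← Int.ofNat_le, show r + 2 = r + 1 + 1 from rfl, ncard_region h hu' hrel,
      ncard_region h hu' hrel]
    rcases lt_or_ge (r + 1) m with hr | hr
    · have h1 := hg i r hr
      have h2 := hg i r hr
      rw [cnt_succ] at h1
      have h3 := (h.inter r i).1
      have h4 := (h.inter (r + 1) i).1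
      simp only [Pi.zero_apply] at h1
      have h5 : ∀ i, cnt T (r + 1) i ≤ cnt T r i := fun i => by
        rcases i with _ | i
        · simp [cnt_zero]
        · have := hg i r hr
          simp only [Pi.zero_apply] at this
          have h6 := h.cnt_mono r (Nat.le_succ i)
          simp only [Nat.succ_eq_add_one] at h6
          omega
      have h6 := h5 i
      omega
    · rw [h.cnt_top hr, h.top (r + 1) hr, h.top (r + 1 + 1) (by omega)]
      have h3 := h.cnt_nonneg r i
      omega

theorem lrCoeff_eq_card (hmu : Antitone mu) (hlam : Antitone lam)
    (hl : ∀ i, ℓ ≤ i → lam i = 0) (hnu : ∀ k, m ≤ k → nu k = 0) :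
    lrCoeff lam mu nu
      = (goodFin m ℓ (fun i => lam i) (fun i => mu i) 0 (fun i => nu i)).card := by
  have hl' : ∀ i, ℓ ≤ i → (lam i : ℤ) = 0 := fun i hi => by simp [hl i hi]
  have hu' : ∀ i, (0 : ℤ) ≤ mu i := fun _ => by positivity
  rw [lrCoeff, ← Set.ncard_coe_finset]
  refine Set.ncard_congr (fun Tab _ => ofTab lam Tab) ?_ ?_ ?_
  · intro Tab h
    rw [Finset.mem_coe, mem_goodFin hl' hu']
    exact isGT_ofTab h hmu hlam hl hnu
  · intro A B hA hB hAB
    funext i j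
    have h1 := tabRel_ofTab hA
    have h2 := tabRel_ofTab hB
    rw [hAB] at h1
    rcases hx : A i j with _ | r
    · rcases hy : B i j with _ | r
      · rfl
      · rw [(h1 r i j).2 ((h2 r i j).1 hy)] at hx
        omega
    · exact ((h2 r i j).2 ((h1 r i j).1 hx)).symm
  · intro T hT
    rw [Finset.mem_coe, mem_goodFin hl' hu'] at hT
    have hLR := isLRTableau_toTab hT.1 hT.2.1 hT.2.2 hl hnu
    refine ⟨toTab lam mu T, hLR, ?_⟩
    funext k i
    refine ext_of_lt (ofTab_nonneg _ _) ((hu' i).trans (hT.1.bot_le k i)) (ofTab_le _ _)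
      (hT.1.le_top k i) fun j hj => ?_
    have hj' : j < lam i := by exact_mod_cast hj
    rw [← ofTab_iff hLR hj', toTab_le_iff hT.1 hj']

end bridge
end

noncomputable section

/-- Partitions with at most `N` parts. -/
structure IsPN (N : ℕ) (f : ℕ → ℕ) : Prop where
  anti : Antitone f
  supp : ∀ k, N ≤ k → f k = 0

lemma IsPN.mono {N M : ℕ} {f : ℕ → ℕ} (h : IsPN N f) (hNM : N ≤ M) : IsPN M f :=
  ⟨h.anti, fun k hk => h.supp k (hNM.trans hk)⟩

lemma finite_isPN (N B : ℕ) : {f : ℕ → ℕ | IsPN N f ∧ ∀ k, f k ≤ B}.Finite := by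
  let F : (ℕ → ℕ) → (Fin N → ℕ) := fun f k => f k
  refine Set.Finite.of_finite_image (f := F) ?_ ?_
  · refine Set.Finite.subset (Set.Finite.pi' (ι := Fin N) (t := fun _ => Set.Iic B)
      fun _ => Set.finite_Iic _) ?_
    rintro _ ⟨f, hf, rfl⟩ k
    exact hf.2 _
  · intro f hf g hg hfg
    funext k
    by_cases hk : k < N
    · exact congrFun hfg ⟨k, hk⟩
    · rw [hf.1.supp k (not_lt.1 hk), hg.1.supp k (not_lt.1 hk)]

/-- Partitions with at most `N` parts, all at most `B`. -/
def ptnFin (N B : ℕ) : Finset (ℕ → ℕ) := (finite_isPN N B).toFinset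

lemma mem_ptnFin {N B : ℕ} {f : ℕ → ℕ} : f ∈ ptnFin N B ↔ IsPN N f ∧ ∀ k, f k ≤ B := by
  simp [ptnFin]

/-- The strictly decreasing vector attached to a partition. -/
def shf (N : ℕ) (s : ℕ → ℕ) : Fin N → ℤ := fun k => (s k : ℤ) - k

lemma shf_strictAnti {N : ℕ} {s : ℕ → ℕ} (h : IsPN N s) : StrictAnti (shf N s) := by
  intro a b hab
  have := h.anti (show (a : ℕ) ≤ b from hab.le)
  have h2 : (a : ℕ) < b := hab
  simp only [shf]; omega

lemma shf_inj {N : ℕ} {s t : ℕ → ℕ} (hs : IsPN N s) (ht : IsPN N t) (h : shf N s = shf N t) :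
    s = t := by
  funext k
  by_cases hk : k < N
  · have := congrFun h ⟨k, hk⟩
    simp only [shf] at this; omega
  · rw [hs.supp k (not_lt.1 hk), ht.supp k (not_lt.1 hk)]

open Classical in
lemma alt_shf {N : ℕ} {s t : ℕ → ℕ} (hs : IsPN N s) (ht : IsPN N t) :
    alt (shf N s) (shf N t) = if s = t then 1 else 0 := by
  rw [alt_of_strictAnti (shf_strictAnti hs) (shf_strictAnti ht)]
  by_cases h : s = t
  · simp [h]
  · rw [if_neg h, if_neg fun h' => h (shf_inj ht hs h').symm]

lemma regroup {m ℓ : ℕ} {l u : ℕ → ℤ} {v : ℕ → ℕ} (hl : ∀ i, ℓ ≤ i → l i = 0)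
    (hu : ∀ i, 0 ≤ u i) (S : Finset (ℕ → ℕ)) (g : (Fin m → ℤ) → ℤ)
    (hS : ∀ s ∈ S, IsPN m s) (hg : ∀ s, IsPN m s → s ∉ S →
      (goodFin m ℓ l u (fun i => v i) (fun i => s i)).Nonempty → g (shf m s) = 0) :
    open Classical in
    ∑ T ∈ (gtFin m l u).filter (IsGood m fun i => v i), g (fun k => v k - k + gtwt m ℓ T k)
      = ∑ s ∈ S, ((goodFin m ℓ l u (fun i => v i) (fun i => s i)).card : ℤ) * g (shf m s) := by
  classical
  have e : ∀ s ∈ S, ((goodFin m ℓ l u (fun i => v i) (fun i => s i)).card : ℤ) * g (shf m s)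
      = ∑ T ∈ (gtFin m l u).filter (IsGood m fun i => v i),
          if ∀ k < m, (v k : ℤ) + cnt T k ℓ = s k then g (shf m s) else 0 := by
    intro s _
    rw [← Finset.sum_filter, Finset.filter_filter, Finset.sum_const, nsmul_eq_mul]
    congr 3
    ext T
    simp [goodFin]
  rw [Finset.sum_congr rfl e, Finset.sum_comm]
  refine Finset.sum_congr rfl fun T hT => ?_
  rw [Finset.mem_filter, mem_gtFin hl hu] at hT
  obtain ⟨hT, hgood⟩ := hT
  let t : ℕ → ℕ := fun k => if k < m then (v k + cnt T k ℓ).toNat else 0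
  have ht1 : ∀ k < m, (t k : ℤ) = v k + cnt T k ℓ := by
    intro k hk
    have := hT.cnt_nonneg k ℓ
    simp only [t, hk, if_true]; omega
  have ht : IsPN m t := by
    refine ⟨antitone_nat_of_succ_le fun k => ?_, fun k hk => by simp [t, hk.not_gt]⟩
    by_cases hk : k + 1 < m
    · have h1 := hgood ℓ k hk
      rw [hT.cnt_eq hl hu (k + 1) (Nat.le_succ ℓ)] at h1
      have h2 := ht1 (k + 1) hk
      have h3 := ht1 k (by omega)
      dsimp only at h1
      omega
    · simp [t, hk]
  have hval : (fun k : Fin m => (v k : ℤ) - k + gtwt m ℓ T k) = shf m t := by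
    funext k
    have := ht1 k k.2
    simp only [shf, gtwt]; omega
  have hiff : ∀ s ∈ S, (∀ k < m, (v k : ℤ) + cnt T k ℓ = s k) ↔ s = t := by
    intro s hs
    constructor
    · intro h
      refine shf_inj (hS s hs) ht ?_
      funext k
      have h1 := h k k.2
      have h2 := ht1 k k.2
      simp only [shf]; omega
    · rintro rfl k hk
      exact (ht1 k hk).symm
  rw [hval, Finset.sum_congr rfl fun s hs => if_congr (hiff s hs) rfl rfl,
    Finset.sum_ite_eq']
  split_ifs with h
  · rfl
  · refine hg t ht h ⟨T, ?_⟩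
    rw [mem_goodFin hl hu]
    exact ⟨hT, hgood, fun k hk => (ht1 k hk).symm⟩

lemma lrCoeff_skew {m ℓ : ℕ} {lam mu s : ℕ → ℕ} (hlam : IsPN ℓ lam) (hmu : IsPN ℓ mu)
    (hs : IsPN m s) : lrCoeff lam mu s
      = (goodFin m ℓ (fun i => lam i) (fun i => mu i) (fun _ => ((0 : ℕ) : ℤ)) (fun i => s i)).card :=
  lrCoeff_eq_card hmu.anti hlam.anti hlam.supp hs.supp

lemma lrCoeff_straight {m ℓ : ℕ} {lam mu s : ℕ → ℕ} (hlam : IsPN ℓ lam) (hmu : IsPN ℓ mu)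
    (hs : IsPN m s) : lrCoeff lam mu s
      = (goodFin ℓ m (fun i => s i) (fun _ => ((0 : ℕ) : ℤ)) (fun i => mu i) (fun i => lam i)).card := by
  rw [lrCoeff_skew hlam hmu hs]
  exact card_goodFin_tr (fun i hi => by simp [hlam.supp i hi]) (fun i => by positivity)
    (fun i hi => by simp [hmu.supp i hi]) (fun i hi => by simp [hs.supp i hi])

/-- The transfer operator of a complete set of semistandard tableaux. -/
def tabOp (N : ℕ) (s : ℕ → ℕ) (f : (Fin N → ℤ) → ℤ) (x : Fin N → ℤ) : ℤ :=
  ∑ T ∈ gtFin N (fun i => s i) (fun _ => ((0 : ℕ) : ℤ)), f (x + gtwt N N T)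

section ops
variable {N m ℓ : ℕ} {s t d lam mu nu : ℕ → ℕ} {f : (Fin N → ℤ) → ℤ}

lemma supp_cast (hs : IsPN N s) : ∀ i, N ≤ i → (s i : ℤ) = 0 := fun i hi => by simp [hs.supp i hi]

lemma asym_tabOp (hs : IsPN N s) (hf : Asym f) : Asym (tabOp N s f) :=
  (symFam_gtwt (supp_cast hs) fun _ => by positivity).asym hf

lemma tabOp_comm (s t : ℕ → ℕ) (f : (Fin N → ℤ) → ℤ) :
    tabOp N s (tabOp N t f) = tabOp N t (tabOp N s f) := by
  funext x
  simp only [tabOp]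
  rw [Finset.sum_comm]
  refine Finset.sum_congr rfl fun T _ => Finset.sum_congr rfl fun S _ => ?_
  rw [add_right_comm]

lemma tabOp_shf (hs : IsPN N s) (hd : IsPN N d) (hf : Asym f) (S : Finset (ℕ → ℕ))
    (hS : ∀ s ∈ S, IsPN N s) (hg : ∀ s, IsPN N s → s ∉ S → f (shf N s) = 0) :
    tabOp N s f (shf N d) = ∑ l ∈ S, (lrCoeff l d s : ℤ) * f (shf N l) := by
  have h1 := sum_asym_eq_sum_good (m := N) (ℓ := N) (v := fun i => (d i : ℤ)) (supp_cast hs)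
    (u := fun _ => ((0 : ℕ) : ℤ)) (fun _ => by positivity)
    (fun k _ => by exact_mod_cast hd.anti (Nat.le_succ k)) hf
  rw [regroup (supp_cast hs) (fun _ => by positivity) S f hS fun s h h' _ => hg s h h'] at h1
  refine h1.trans (Finset.sum_congr rfl fun l hl => ?_)
  rw [lrCoeff_straight (hS l hl) hd hs]

lemma skew_shf {f : (Fin m → ℤ) → ℤ} (hlam : IsPN ℓ lam) (hmu : IsPN ℓ mu) (hf : Asym f)
    (S : Finset (ℕ → ℕ)) (hS : ∀ s ∈ S, IsPN m s)
    (hg : ∀ s, IsPN m s → s ∉ S → lrCoeff lam mu s ≠ 0 → f (shf m s) = 0) :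
    ∑ T ∈ gtFin m (fun i => lam i) (fun i => mu i), f (fun k => -(k : ℤ) + gtwt m ℓ T k)
      = ∑ s ∈ S, (lrCoeff lam mu s : ℤ) * f (shf m s) := by
  have h1 := sum_asym_eq_sum_good (m := m) (ℓ := ℓ) (v := fun _ => ((0 : ℕ) : ℤ)) (supp_cast hlam)
    (u := fun i => (mu i : ℤ)) (fun _ => by positivity) (fun _ _ => le_rfl) hf
  rw [regroup (v := fun _ => 0) (supp_cast hlam) (fun _ => by positivity) S f hS fun s h h' hne => hg s h h' (by
    rw [lrCoeff_skew hlam hmu h]; exact hne.card_pos.ne')] at h1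
  simp only [Nat.cast_zero, zero_sub] at h1
  refine h1.trans (Finset.sum_congr rfl fun s hs => ?_)
  rw [lrCoeff_skew hlam hmu (hS s hs)]
  rfl

lemma lrCoeff_le (h : lrCoeff lam mu nu ≠ 0) (i : ℕ) : mu i ≤ lam i := by
  obtain ⟨T, hT⟩ := Set.nonempty_of_ncard_ne_zero h
  exact hT.1 i

lemma tabOp_alt (hs : IsPN N s) (hd : IsPN N d) (hlam : IsPN N lam) :
    tabOp N s (alt (shf N lam)) (shf N d) = lrCoeff lam d s := by
  rw [tabOp_shf hs hd (asym_alt _) {lam} (by simpa using hlam) ?_, Finset.sum_singleton,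
    alt_shf hlam hlam]
  · simp
  · intro t ht hne
    rw [alt_shf hlam ht, if_neg fun h => hne (by simp [h])]

lemma skew_alt (hlam : IsPN ℓ lam) (hmu : IsPN ℓ mu) (hs : IsPN m s) :
    ∑ T ∈ gtFin m (fun i => lam i) (fun i => mu i),
      alt (shf m s) (fun k => -(k : ℤ) + gtwt m ℓ T k) = lrCoeff lam mu s := by
  rw [skew_shf hlam hmu (asym_alt _) {s} (by simpa using hs) ?_, Finset.sum_singleton,
    alt_shf hs hs]
  · simp
  · intro t ht hne _
    rw [alt_shf hs ht, if_neg fun h => hne (by simp [h])]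

lemma tabOp_zero (hs : IsPN N s) (hf : Asym f) :
    tabOp N s f (shf N fun _ => 0) = f (shf N s) := by
  classical
  have h1 := sum_asym_eq_sum_good (m := N) (ℓ := N) (v := fun _ => ((0 : ℕ) : ℤ)) (supp_cast hs)
    (u := fun _ => ((0 : ℕ) : ℤ)) (fun _ => by positivity) (fun _ _ => le_rfl) hf
  have h2 := isGT_straightGT (supp_cast hs) (fun i => by positivity)
    (fun i => Int.ofNat_le.2 (hs.anti (Nat.le_succ i)))
  have h3 : (gtFin N (fun i => s i) (fun _ => ((0 : ℕ) : ℤ))).filter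
      (IsGood N (fun _ => ((0 : ℕ) : ℤ))) = {straightGT fun i => (s i : ℤ)} := by
    ext T
    rw [Finset.mem_filter, mem_gtFin (supp_cast hs) fun _ => by positivity, Finset.mem_singleton]
    constructor
    · rintro ⟨h4, h5⟩
      exact eq_straightGT h4 h5
    · rintro rfl
      exact h2
  rw [h3, Finset.sum_singleton] at h1
  refine h1.trans (congrArg f ?_)
  funext k
  simp only [gtwt, cnt_straightGT, shf, k.2, if_true]
  push_cast; ring

lemma lrCoeff_comm (hs : IsPN N s) (hd : IsPN N d) (hlam : IsPN N lam) :
    lrCoeff lam s d = lrCoeff lam d s := by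
  have h1 := tabOp_alt hs hd hlam
  have h2 := tabOp_alt hd hs hlam
  rw [← tabOp_zero hd (asym_tabOp hs (asym_alt _))] at h1
  rw [← tabOp_zero hs (asym_tabOp hd (asym_alt _)), tabOp_comm] at h2
  exact_mod_cast h2.symm.trans h1

lemma tabOp_tabOp {B : ℕ} (hs : IsPN N s) (ht : IsPN N t) (hd : IsPN N d) (hlam : IsPN N lam)
    (hB : ∀ k, lam k ≤ B) :
    tabOp N s (tabOp N t (alt (shf N lam))) (shf N d)
      = ∑ g ∈ ptnFin N B, (lrCoeff g d s : ℤ) * lrCoeff lam g t := by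
  rw [tabOp_shf hs hd (asym_tabOp ht (asym_alt _)) (ptnFin N B) fun g hg => (mem_ptnFin.1 hg).1]
  · refine Finset.sum_congr rfl fun g hg => ?_
    rw [tabOp_alt ht (mem_ptnFin.1 hg).1 hlam]
  · intro g hg hgB
    rw [tabOp_alt ht hg hlam]
    by_contra hne
    exact hgB (mem_ptnFin.2 ⟨hg, fun k => (lrCoeff_le (by exact_mod_cast hne) k).trans (hB k)⟩)

theorem lrCoeff_assoc {B : ℕ} (hmu : IsPN N mu) (hnu : IsPN N nu) (hd : IsPN N d)
    (hlam : IsPN N lam) (hB : ∀ k, lam k ≤ B) :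
    ∑ g ∈ ptnFin N B, lrCoeff g mu nu * lrCoeff lam g d
      = ∑ s ∈ ptnFin N B, lrCoeff s d nu * lrCoeff lam mu s := by
  have h1 := tabOp_tabOp hnu hd hmu hlam hB
  have h2 := tabOp_tabOp hnu hmu hd hlam hB
  rw [← tabOp_zero hmu (asym_tabOp hnu (asym_tabOp hd (asym_alt _)))] at h1
  rw [← tabOp_zero hd (asym_tabOp hnu (asym_tabOp hmu (asym_alt _)))] at h2
  rw [tabOp_comm d nu, tabOp_comm d mu, tabOp_comm nu mu] at h2
  have h3 := h1.symm.trans h2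
  have h4 : ∀ s ∈ ptnFin N B, lrCoeff s d nu * lrCoeff lam mu s
      = lrCoeff s d nu * lrCoeff lam s mu := fun s hs => by
    rw [lrCoeff_comm hmu (mem_ptnFin.1 hs).1 hlam]
  rw [Finset.sum_congr rfl h4]
  exact_mod_cast h3

end ops
end

noncomputable section

lemma strictAnti_of_letters {m : ℕ} {v : ℕ → ℤ} (hv : ∀ k, k + 1 < m → v (k + 1) ≤ v k) :
    StrictAnti fun k : Fin m => v k - k := by
  rcases m with _ | m
  · intro a; exact a.elim0
  · refine Fin.strictAnti_iff_succ_lt.2 fun i => ?_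
    have := hv i (by omega)
    simp only [Fin.val_succ, Fin.val_castSucc]
    push_cast; omega

lemma card_goodFin_alt {m ℓ : ℕ} {l u v w : ℕ → ℤ} (hl : ∀ i, ℓ ≤ i → l i = 0)
    (hu : ∀ i, 0 ≤ u i) (hv : ∀ k, k + 1 < m → v (k + 1) ≤ v k)
    (hw : ∀ k, k + 1 < m → w (k + 1) ≤ w k) :
    ((goodFin m ℓ l u v w).card : ℤ)
      = ∑ T ∈ gtFin m l u, alt (fun k : Fin m => w k - k) (fun k => v k - k + gtwt m ℓ T k) := by
  classical
  rw [sum_asym_eq_sum_good hl hu hv (asym_alt _)]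
  have : goodFin m ℓ l u v w = ((gtFin m l u).filter (IsGood m v)).filter
      fun T => ∀ k < m, v k + cnt T k ℓ = w k := by
    ext T; simp [goodFin, and_assoc]
  rw [this, Finset.card_filter, Nat.cast_sum]
  refine Finset.sum_congr rfl fun T hT => ?_
  rw [Finset.mem_filter, mem_gtFin hl hu] at hT
  have h1 : StrictAnti fun k : Fin m => v k - k + gtwt m ℓ T k := by
    have := strictAnti_of_letters (m := m) (v := fun k => v k + cnt T k ℓ) fun k hk => by
      have h1 := hT.2 ℓ k hk
      rw [hT.1.cnt_eq hl hu (k + 1) (Nat.le_succ ℓ)] at h1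
      exact h1
    convert this using 2
    simp only [gtwt]; ring
  rw [alt_of_strictAnti (strictAnti_of_letters hw) h1]
  push_cast
  refine if_congr ?_ rfl rfl
  constructor
  · intro h
    funext k
    have := h k k.2
    simp only [gtwt]; omega
  · intro h k hk
    have := congrFun h ⟨k, hk⟩
    simp only [gtwt] at this; omega

section partI
variable {m ℓ : ℕ} {lam mu nu gam s : ℕ → ℕ}

lemma sum_alt_ratio (hlam : IsPN ℓ lam) (hgam : IsPN ℓ gam) (hnu : IsPN m nu) :
    (goodFin m ℓ (fun i => lam i) (fun i => gam i) (fun k => -(nu (m - 1 - k) : ℤ))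
      (fun _ => 0)).card = lrCoeff lam gam nu := by
  rw [← Int.natCast_inj, card_goodFin_alt (supp_cast hlam) (fun _ => by positivity) ?_
    (fun _ _ => le_rfl), ← skew_alt hlam hgam hnu]
  · have := (symFam_gtwt (m := m) (supp_cast hlam) (u := fun i => (gam i : ℤ))
      fun _ => by positivity).sum_alt_rev fun i => (nu i : ℤ)
    simp only [zero_sub, Fin.val_rev] at this ⊢
    refine Eq.trans ?_ this
    refine Finset.sum_congr rfl fun T _ => ?_
    congr 1
    funext i
    rw [show m - 1 - (i : ℕ) = m - (i + 1) by omega]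
  · intro k hk
    have := hnu.anti (show m - 1 - (k + 1) ≤ m - 1 - k by omega)
    omega

lemma card_goodFin_partition {B : ℕ} (hgam : IsPN ℓ gam) (hmu : IsPN ℓ mu) (hnu : IsPN m nu)
    (hs : IsPN m s) (hB : ∀ k, s k ≤ B) :
    (goodFin m ℓ (fun i => gam i) (fun i => mu i) (fun i => nu i) (fun i => s i)).card
      = ∑ d ∈ ptnFin m B, lrCoeff gam mu d * lrCoeff s d nu := by
  rw [← Int.natCast_inj, card_goodFin_alt (supp_cast hgam) (fun _ => by positivity)
    (fun k _ => by exact_mod_cast hnu.anti (Nat.le_succ k))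
    (fun k _ => by exact_mod_cast hs.anti (Nat.le_succ k))]
  have hsym := symFam_gtwt (m := m) (supp_cast hgam) (u := fun i => (mu i : ℤ))
      fun _ => by positivity
  have h1 := tabOp_zero hnu (hsym.asym (asym_alt (shf m s)))
  refine h1.symm.trans ?_
  have h2 := skew_shf hgam hmu (asym_tabOp hnu (asym_alt (shf m s))) (ptnFin m B)
    (fun t ht => (mem_ptnFin.1 ht).1) ?_
  · rw [tabOp, Finset.sum_comm]
    push_cast
    have h3 : ∀ d ∈ ptnFin m B, (lrCoeff gam mu d : ℤ) * lrCoeff s d nu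
        = lrCoeff gam mu d * tabOp m nu (alt (shf m s)) (shf m d) := fun d hd => by
      rw [tabOp_alt hnu (mem_ptnFin.1 hd).1 hs]
    rw [Finset.sum_congr rfl h3, ← h2]
    refine Finset.sum_congr rfl fun T _ => Finset.sum_congr rfl fun R _ => ?_
    congr 1
    funext k
    simp only [Pi.add_apply, shf]
    push_cast; ring
  · intro t ht htB _
    rw [tabOp_alt hnu ht hs]
    by_contra hne
    exact htB (mem_ptnFin.2 ⟨ht, fun k => (lrCoeff_le (by exact_mod_cast hne) k).trans (hB k)⟩)

/-- The filling of a skew shape obtained by putting one filling on top of another. -/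
def glueGT (p : ℕ) (T S : ℕ → ℕ → ℤ) (k : ℕ) : ℕ → ℤ := if k ≤ p then T k else S (k - p)

lemma cnt_congr {T S : ℕ → ℕ → ℤ} {k j : ℕ} (h1 : T k = S j) (h2 : T (k + 1) = S (j + 1)) (i : ℕ) :
    cnt T k i = cnt S j i := by simp only [cnt, h1, h2]

lemma cnt_glue_low {p : ℕ} {T S : ℕ → ℕ → ℤ} {k : ℕ} (hk : k < p) (i : ℕ) :
    cnt (glueGT p T S) k i = cnt T k i :=
  cnt_congr (by simp [glueGT, hk.le]) (by simp [glueGT, Nat.succ_le_of_lt hk]) i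

lemma cnt_glue_high {p : ℕ} {T S : ℕ → ℕ → ℤ} (h : T p = S 0) (k i : ℕ) :
    cnt (glueGT p T S) (p + k) i = cnt S k i := by
  refine cnt_congr ?_ ?_ i
  · rcases k with _ | k
    · simp [glueGT, h]
    · simp [glueGT]
  · simp [glueGT, add_assoc]

/-- The weight of the letters `k < m` determined by a pair of partitions. -/
def kap (m : ℕ) (np nm : ℕ → ℕ) (k : ℕ) : ℤ := np k - nm (m - 1 - k)

lemma isGT_glue {p r : ℕ} {l g u : ℕ → ℤ} {T S : ℕ → ℕ → ℤ} (hT : IsGT p g u T)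
    (hS : IsGT r l g S) : IsGT (p + r) l u (glueGT p T S) := by
  refine ⟨by simp [glueGT, hT.zero], ?_, ?_⟩
  · intro k hk
    rw [glueGT]
    split_ifs with h
    · obtain rfl : k = p := by omega
      obtain rfl : r = 0 := by omega
      rw [hT.top _ le_rfl, ← hS.zero, hS.top 0 le_rfl]
    · exact hS.top _ (by omega)
  · intro k
    rcases lt_trichotomy k p with h | rfl | h
    · simpa [glueGT, h.le, Nat.succ_le_of_lt h] using hT.inter k
    · have := hS.inter 0
      rw [hS.zero, ← hT.top k le_rfl] at this
      simpa [glueGT] using this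
    · have := hS.inter (k - p)
      rw [show k - p + 1 = k + 1 - p by omega] at this
      simpa [glueGT, h.not_ge, show ¬ k + 1 ≤ p by omega] using this

lemma glueGT_self {p : ℕ} (T : ℕ → ℕ → ℤ) :
    glueGT p (fun k => T (min k p)) (fun k => T (p + k)) = T := by
  funext k
  rw [glueGT]
  split_ifs with h
  · simp [h]
  · rw [show p + (k - p) = k by omega]

lemma IsGT.take {p m : ℕ} {l u : ℕ → ℤ} {T : ℕ → ℕ → ℤ} (h : IsGT m l u T) :
    IsGT p (T p) u fun k => T (min k p) := by
  refine ⟨by simp [h.zero], fun k hk => by simp [hk], fun k => ?_⟩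
  rcases lt_or_ge k p with hk | hk
  · simpa [hk.le, Nat.succ_le_of_lt hk] using h.inter k
  · simp only [min_eq_right hk, min_eq_right (hk.trans (Nat.le_succ k))]
    exact fun r => ⟨le_rfl, h.anti p (Nat.le_succ r)⟩

lemma IsGT.drop {p m : ℕ} {l u : ℕ → ℤ} {T : ℕ → ℕ → ℤ} (h : IsGT (p + m) l u T) :
    IsGT m l (T p) fun k => T (p + k) :=
  ⟨rfl, fun k hk => h.top _ (by omega), fun k => h.inter (p + k)⟩

lemma card_goodFin_split {p q r B : ℕ} {np nm : ℕ → ℕ} (hlam : IsPN q lam) (hqℓ : q ≤ ℓ)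
    (hnp : IsPN p np) (hnm : IsPN q nm) (hs : IsPN p s) (hq : q ≤ r)
    (hB : ∀ k, lam k ≤ B) :
    (goodFin (p + r) ℓ (fun i => lam i) (fun i => mu i) (kap (p + r) np nm) (fun i => s i)).card
      = ∑ g ∈ ptnFin q B,
        (goodFin p ℓ (fun i => g i) (fun i => mu i) (fun i => np i) (fun i => s i)).card *
        (goodFin r ℓ (fun i => lam i) (fun i => g i) (fun k => -(nm (r - 1 - k) : ℤ))
          (fun _ => 0)).card := by
  classical
  have hl := supp_cast (hlam.mono hqℓ)
  have hl' := supp_cast hlam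
  have hu : ∀ i, (0 : ℤ) ≤ mu i := fun _ => by positivity
  have kap_low : ∀ k < p, kap (p + r) np nm k = np k := fun k hk => by
    simp [kap, hnm.supp (p + r - 1 - k) (by omega)]
  have kap_high : ∀ k, kap (p + r) np nm (p + k) = -(nm (r - 1 - k) : ℤ) := fun k => by
    rw [kap, hnp.supp (p + k) (by omega), show p + r - 1 - (p + k) = r - 1 - k by omega]
    simp
  rw [Finset.card_eq_sum_card_fiberwise (f := fun S i => (S p i).toNat) (t := ptnFin q B)]
  · refine Finset.sum_congr rfl fun g hg => ?_
    obtain ⟨hg, hgB⟩ := mem_ptnFin.1 hg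
    have hgl := supp_cast (hg.mono hqℓ)
    rw [← Finset.card_product]
    refine Finset.card_nbij' (fun S => (fun k => S (min k p), fun k => S (p + k)))
      (fun X => glueGT p X.1 X.2) ?_ ?_ ?_ ?_
    · intro S hS
      rw [Finset.mem_coe, Finset.mem_filter, mem_goodFin hl hu] at hS
      obtain ⟨⟨h1, h2, h3⟩, h4⟩ := hS
      have h5 : S p = fun i => (g i : ℤ) := by
        funext i
        rw [← congrFun h4 i, Int.toNat_of_nonneg ((hu i).trans (h1.bot_le p i))]
      have c1 : ∀ k < p, ∀ i, cnt (fun k => S (min k p)) k i = cnt S k i := fun k hk i =>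
        cnt_congr (by simp [hk.le]) (by simp [Nat.succ_le_of_lt hk]) i
      have c2 : ∀ k i, cnt (fun k => S (p + k)) k i = cnt S (p + k) i := fun k i =>
        cnt_congr rfl rfl i
      rw [Finset.mem_coe, Finset.mem_product, mem_goodFin hgl hu,
        mem_goodFin hl fun _ => by positivity, ← h5]
      refine ⟨⟨h1.take, ?_, ?_⟩, h1.drop, ?_, ?_⟩
      · intro i k hk
        have := h2 i k (by omega)
        rw [c1 _ hk, c1 k (by omega)]
        rwa [kap_low _ hk, kap_low k (by omega)] at this
      · intro k hk
        have := h3 k (by omega)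
        rw [c1 k hk]
        rwa [kap_low k hk] at this
      · intro i k hk
        have := h2 i (p + k) (by omega)
        rw [c2, c2]
        rwa [add_assoc, kap_high, kap_high] at this
      · intro k hk
        have := h3 (p + k) (by omega)
        rw [c2]
        rw [kap_high, hs.supp (p + k) (by omega)] at this
        exact_mod_cast this
    · rintro ⟨T, S⟩ hX
      rw [Finset.mem_coe, Finset.mem_product, mem_goodFin hgl hu,
        mem_goodFin hl fun _ => by positivity] at hX
      dsimp only at hX
      obtain ⟨⟨h1, h2, h3⟩, h4, h5, h6⟩ := hX
      have hTS : T p = S 0 := by rw [h1.top p le_rfl, h4.zero]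
      rw [Finset.mem_coe, Finset.mem_filter, mem_goodFin hl hu]
      refine ⟨⟨isGT_glue h1 h4, ?_, ?_⟩, ?_⟩
      · intro i k hk
        rcases lt_trichotomy (k + 1) p with h | h | h
        · rw [cnt_glue_low h, cnt_glue_low (by omega), kap_low _ h, kap_low k (by omega)]
          exact h2 i k h
        · have e1 := cnt_glue_high hTS 0 (i + 1)
          have e2 := kap_high 0
          have e3 := h6 0 (by omega)
          have e4 := h4.cnt_mono 0 (le_max_left (i + 1) ℓ)
          rw [h4.cnt_eq hl (fun _ => by positivity) 0 (le_max_right (i + 1) ℓ)] at e4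
          have e5 := h1.cnt_nonneg k i
          rw [add_zero] at e1 e2
          dsimp only at e3 ⊢
          rw [h, e1, e2, cnt_glue_low (by omega), kap_low k (by omega)]
          have : (0 : ℤ) ≤ np k := by positivity
          omega
        · obtain ⟨j, rfl⟩ : ∃ j, k = p + j := ⟨k - p, by omega⟩
          rw [add_assoc, cnt_glue_high hTS, cnt_glue_high hTS, kap_high, kap_high]
          exact h5 i j (by omega)
      · intro k hk
        rcases lt_or_ge k p with h | h
        · rw [cnt_glue_low h, kap_low k h]
          exact h3 k h
        · obtain ⟨j, rfl⟩ : ∃ j, k = p + j := ⟨k - p, by omega⟩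
          rw [cnt_glue_high hTS, kap_high, hs.supp (p + j) (by omega)]
          exact_mod_cast h6 j (by omega)
      · funext i
        simp [glueGT, h1.top p le_rfl]
    · intro S _
      exact glueGT_self S
    · rintro ⟨T, S⟩ hX
      rw [Finset.mem_coe, Finset.mem_product, mem_goodFin hgl hu,
        mem_goodFin hl fun _ => by positivity] at hX
      dsimp only at hX
      obtain ⟨⟨h1, -, -⟩, h4, -, -⟩ := hX
      refine Prod.ext ?_ ?_
      · funext k
        show glueGT p T S (min k p) = T k
        rw [glueGT, if_pos (min_le_right _ _)]
        rcases le_total k p with h | h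
        · rw [min_eq_left h]
        · rw [min_eq_right h, h1.top p le_rfl, h1.top k h]
      · funext k
        show glueGT p T S (p + k) = S k
        rw [glueGT]
        split_ifs with h
        · obtain rfl : k = 0 := by omega
          rw [add_zero, h1.top p le_rfl, h4.zero]
        · rw [show p + k - p = k by omega]
  · intro S hS
    rw [Finset.mem_coe, mem_goodFin hl hu] at hS
    have h1 := hS.1
    have h2 : ∀ i, 0 ≤ S p i := fun i => (hu i).trans (h1.bot_le p i)
    rw [Finset.mem_coe, mem_ptnFin]
    refine ⟨⟨fun i j hij => ?_, fun i hi => ?_⟩, fun i => ?_⟩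
    · have := h1.anti p hij
      dsimp only; omega
    · have := h1.eq_zero hl' hu p hi
      dsimp only; omega
    · have : S p i ≤ lam i := h1.le_top p i
      have := hB i
      dsimp only; omega

end partI
end

noncomputable section

section
variable {p q r m ℓ B : ℕ} {lp mp np lm mm nm s : ℕ → ℕ}

lemma kap_anti (hnp : IsPN p np) (hnm : IsPN q nm) (k : ℕ) :
    kap m np nm (k + 1) ≤ kap m np nm k := by
  have h1 := hnp.anti (Nat.le_succ k)
  have h2 := hnm.anti (show m - 1 - (k + 1) ≤ m - 1 - k by omega)
  simp only [kap]
  simp only [Nat.succ_eq_add_one] at h1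
  omega

lemma sum_ptnFin_extend {N M : ℕ} (hNM : N ≤ M) (F : (ℕ → ℕ) → ℕ)
    (hF : ∀ s, IsPN M s → F s ≠ 0 → IsPN N s) :
    ∑ s ∈ ptnFin N B, F s = ∑ s ∈ ptnFin M B, F s := by
  refine Finset.sum_subset (fun s hs => ?_) fun s hs hs' => ?_
  · rw [mem_ptnFin] at hs ⊢
    exact ⟨hs.1.mono hNM, hs.2⟩
  · rw [mem_ptnFin] at hs hs'
    by_contra h
    exact hs' ⟨hF s hs.1 h, hs.2⟩

lemma IsPN.of_le {N M : ℕ} {s t : ℕ → ℕ} (hs : IsPN M s) (ht : IsPN N t) (h : ∀ i, s i ≤ t i) :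
    IsPN N s := ⟨hs.anti, fun k hk => Nat.le_zero.1 ((h k).trans (ht.supp k hk).le)⟩

lemma sum_alt_pair (hlp : IsPN p lp) (hmp : IsPN p mp) (hnp : IsPN p np) (hlm : IsPN q lm)
    (hmm : IsPN q mm) (hnm : IsPN q nm) (hpℓ : p ≤ ℓ) (hqℓ : q ≤ ℓ) (hq : q ≤ r)
    (hBp : ∀ k, lp k ≤ B) (hBm : ∀ k, lm k ≤ B) :
    ∑ T ∈ gtFin (p + r) (fun i => lp i) (fun i => mp i),
      ∑ S ∈ gtFin (p + r) (fun i => lm i) (fun i => mm i),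
        alt (fun k : Fin (p + r) => kap (p + r) np nm k - k)
          (fun k => -(k : ℤ) + gtwt (p + r) ℓ T k - gtwt (p + r) ℓ S k)
      = ∑ s ∈ ptnFin p B, (lrCoeff lp mp s : ℤ) * ∑ g ∈ ptnFin q B,
          (∑ d ∈ ptnFin p B, (lrCoeff g mm d : ℤ) * lrCoeff s d np) * lrCoeff lm g nm := by
  have hsymS := symFam_gtwt (m := p + r) (ℓ := ℓ) (supp_cast (hlm.mono hqℓ))
    (u := fun i => (mm i : ℤ)) fun _ => by positivity
  have hF := hsymS.neg.asym (asym_alt fun k : Fin (p + r) => kap (p + r) np nm k - k)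
  refine (skew_shf (hlp.mono hpℓ) (hmp.mono hpℓ) hF (ptnFin p B) ?_ ?_).trans ?_
  · exact fun s hs => (mem_ptnFin.1 hs).1.mono (by omega)
  · intro s hs hsB hne
    rw [lrCoeff_comm (hmp.mono (Nat.le_add_right p r)) hs (hlp.mono (Nat.le_add_right p r))] at hne
    have hle := lrCoeff_le hne
    exact absurd (mem_ptnFin.2 ⟨hs.of_le hlp hle, fun k => (hle k).trans (hBp k)⟩) hsB
  · refine Finset.sum_congr rfl fun s hs => ?_
    obtain ⟨hs, hsB⟩ := mem_ptnFin.1 hs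
    congr 1
    have h1 := hsymS.sum_alt_swap (shf (p + r) s) (fun k => kap (p + r) np nm k - k)
    simp only [← sub_eq_add_neg]
    refine h1.trans ?_
    have h2 := card_goodFin_alt (m := p + r) (ℓ := ℓ) (supp_cast (hlm.mono hqℓ))
      (u := fun i => (mm i : ℤ)) (fun _ => by positivity) (v := kap (p + r) np nm)
      (w := fun k => (s k : ℤ)) (fun k _ => kap_anti hnp hnm k)
      (fun k _ => by exact_mod_cast hs.anti (Nat.le_succ k))
    refine h2.symm.trans ?_
    rw [card_goodFin_split hlm hqℓ hnp hnm hs hq hBm]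
    push_cast
    refine Finset.sum_congr rfl fun g hg => ?_
    obtain ⟨hg, hgB⟩ := mem_ptnFin.1 hg
    rw [sum_alt_ratio (hlm.mono hqℓ) (hg.mono hqℓ) (hnm.mono hq),
      card_goodFin_partition (hg.mono hqℓ) (hmm.mono hqℓ) hnp hs hsB]
    push_cast
    rfl

lemma sum_lrCoeff_comm {N : ℕ} {lam mu nu d : ℕ → ℕ} (hmu : IsPN N mu) (hnu : IsPN N nu)
    (hd : IsPN N d) (hlam : IsPN N lam) (hB : ∀ k, lam k ≤ B) :
    ∑ g ∈ ptnFin N B, lrCoeff g mu d * lrCoeff lam g nu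
      = ∑ g ∈ ptnFin N B, lrCoeff g mu nu * lrCoeff lam g d := by
  have h1 := tabOp_tabOp hd hnu hmu hlam hB
  rw [tabOp_comm, tabOp_tabOp hnu hd hmu hlam hB] at h1
  exact_mod_cast h1.symm

theorem sum_alt_pair_eq (hlp : IsPN p lp) (hmp : IsPN p mp) (hnp : IsPN p np) (hlm : IsPN q lm)
    (hmm : IsPN q mm) (hnm : IsPN q nm) (hpℓ : p ≤ ℓ) (hqℓ : q ≤ ℓ) (hpq : p + q ≤ m)
    (hBp : ∀ k, lp k ≤ B) (hBm : ∀ k, lm k ≤ B) :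
    ∑ T ∈ gtFin m (fun i => lp i) (fun i => mp i),
      ∑ S ∈ gtFin m (fun i => lm i) (fun i => mm i),
        alt (fun k : Fin m => kap m np nm k - k)
          (fun k => -(k : ℤ) + gtwt m ℓ T k - gtwt m ℓ S k)
      = ∑ gp ∈ ptnFin (p + q) B, ∑ gm ∈ ptnFin (p + q) B, ∑ d ∈ ptnFin (p + q) B,
          ((lrCoeff gp mp np * lrCoeff gm mm nm * lrCoeff lp gp d * lrCoeff lm gm d : ℕ) : ℤ) := by
  obtain ⟨r, rfl⟩ : ∃ r, m = p + r := ⟨m - p, by omega⟩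
  rw [sum_alt_pair hlp hmp hnp hlm hmm hnm hpℓ hqℓ (by omega) hBp hBm]
  norm_cast
  have lp' := hlp.mono (Nat.le_add_right p q)
  have mp' := hmp.mono (Nat.le_add_right p q)
  have np' := hnp.mono (Nat.le_add_right p q)
  have lm' := hlm.mono (Nat.le_add_left q p)
  have mm' := hmm.mono (Nat.le_add_left q p)
  have nm' := hnm.mono (Nat.le_add_left q p)
  rw [sum_ptnFin_extend (Nat.le_add_right p q)]
  swap
  · intro s hs hne
    have h1 := left_ne_zero_of_mul hne
    rw [lrCoeff_comm mp' hs lp'] at h1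
    exact hs.of_le hlp (lrCoeff_le h1)
  have e1 : ∀ s ∈ ptnFin (p + q) B, lrCoeff lp mp s * ∑ g ∈ ptnFin q B,
        (∑ d ∈ ptnFin p B, lrCoeff g mm d * lrCoeff s d np) * lrCoeff lm g nm
      = ∑ d ∈ ptnFin (p + q) B, (lrCoeff s d np * lrCoeff lp mp s) *
        ∑ g ∈ ptnFin (p + q) B, lrCoeff g mm d * lrCoeff lm g nm := by
    intro s hs
    obtain ⟨hs, hsB⟩ := mem_ptnFin.1 hs
    by_cases h0 : lrCoeff lp mp s = 0
    · simp [h0]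
    have hs' : IsPN p s := by
      rw [lrCoeff_comm mp' hs lp'] at h0
      exact hs.of_le hlp (lrCoeff_le h0)
    rw [sum_ptnFin_extend (Nat.le_add_left q p) (F := fun g =>
      (∑ d ∈ ptnFin p B, lrCoeff g mm d * lrCoeff s d np) * lrCoeff lm g nm)]
    swap
    · intro g hg hne
      exact hg.of_le hlm (lrCoeff_le (right_ne_zero_of_mul hne))
    have e2 : ∀ g ∈ ptnFin (p + q) B, (∑ d ∈ ptnFin p B, lrCoeff g mm d * lrCoeff s d np) *
        lrCoeff lm g nm = (∑ d ∈ ptnFin (p + q) B, lrCoeff g mm d * lrCoeff s d np) *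
        lrCoeff lm g nm := by
      intro g _
      rw [sum_ptnFin_extend (Nat.le_add_right p q)]
      intro d hd hne
      exact hd.of_le hs' (lrCoeff_le (right_ne_zero_of_mul hne))
    rw [Finset.sum_congr rfl e2]
    simp only [Finset.sum_mul, Finset.mul_sum]
    rw [Finset.sum_comm]
    refine Finset.sum_congr rfl fun d _ => Finset.sum_congr rfl fun g _ => ?_
    ring
  rw [Finset.sum_congr rfl e1, Finset.sum_comm]
  have e3 : ∀ d ∈ ptnFin (p + q) B, ∑ s ∈ ptnFin (p + q) B, (lrCoeff s d np * lrCoeff lp mp s) *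
        ∑ g ∈ ptnFin (p + q) B, lrCoeff g mm d * lrCoeff lm g nm
      = (∑ gp ∈ ptnFin (p + q) B, lrCoeff gp mp np * lrCoeff lp gp d) *
        ∑ gm ∈ ptnFin (p + q) B, lrCoeff gm mm nm * lrCoeff lm gm d := by
    intro d hd
    have hd := (mem_ptnFin.1 hd).1
    rw [← Finset.sum_mul, lrCoeff_assoc mp' np' hd lp' hBp, sum_lrCoeff_comm mm' nm' hd lm' hBm]
  rw [Finset.sum_congr rfl e3]
  simp only [Finset.sum_mul, Finset.mul_sum]
  rw [show (∑ gp ∈ ptnFin (p + q) B, ∑ gm ∈ ptnFin (p + q) B, ∑ d ∈ ptnFin (p + q) B,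
      lrCoeff gp mp np * lrCoeff gm mm nm * lrCoeff lp gp d * lrCoeff lm gm d)
      = ∑ d ∈ ptnFin (p + q) B, ∑ gp ∈ ptnFin (p + q) B, ∑ gm ∈ ptnFin (p + q) B,
      lrCoeff gp mp np * lrCoeff gm mm nm * lrCoeff lp gp d * lrCoeff lm gm d from ?_]
  · refine Finset.sum_congr rfl fun d _ => ?_
    rw [Finset.sum_comm]
    refine Finset.sum_congr rfl fun gp _ => Finset.sum_congr rfl fun gm _ => ?_
    ring
  · rw [Finset.sum_comm]
    rw [Finset.sum_congr rfl fun gm _ => Finset.sum_comm, Finset.sum_comm]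
    exact Finset.sum_congr rfl fun d _ => Finset.sum_comm

lemma finsum_ptn (F : (ℕ → ℕ) → ℕ) (S : Finset (ℕ → ℕ)) (hS : ∀ s ∈ S, IsPartition s)
    (hF : ∀ s, IsPartition s → F s ≠ 0 → s ∈ S) : ∑ᶠ s : Ptn, F s.1 = ∑ s ∈ S, F s := by
  have h1 : ∑ᶠ s : Ptn, F s.1 = ∑ᶠ (s : ℕ → ℕ) (_ : IsPartition s), F s :=
    finsum_subtype_eq_finsum_cond IsPartition
  rw [h1]
  refine finsum_mem_eq_sum_of_inter_support_eq (s := {s | IsPartition s}) F ?_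
  ext s
  simp only [Set.mem_inter_iff, Set.mem_ofPred_eq, Function.mem_support, Finset.mem_coe]
  exact ⟨fun h => ⟨hF s h.1 h.2, h.2⟩, fun h => ⟨hS s h.1, h.2⟩⟩

lemma plen_supp {f : ℕ → ℕ} (hf : IsPartition f) (h : plen f ≤ p) : IsPN p f := by
  refine ⟨fun i j hij => hf.1 hij, fun k hk => ?_⟩
  have h1 : f (plen f) = 0 := Nat.sInf_mem (s := {k | f k = 0}) hf.2
  exact Nat.le_zero.1 ((hf.1 (h.trans hk)).trans h1.le)

theorem finsum_lrCoeff (hlp : IsPN p lp) (hlm : IsPN q lm) (mp np mm nm : ℕ → ℕ)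
    (hBp : ∀ k, lp k ≤ B) (hBm : ∀ k, lm k ≤ B) :
    ∑ᶠ (gp : Ptn) (gm : Ptn) (d : Ptn), lrCoeff gp.1 mp np * lrCoeff gm.1 mm nm *
          lrCoeff lp gp.1 d.1 * lrCoeff lm gm.1 d.1
      = ∑ gp ∈ ptnFin (p + q) B, ∑ gm ∈ ptnFin (p + q) B, ∑ d ∈ ptnFin (p + q) B,
          lrCoeff gp mp np * lrCoeff gm mm nm * lrCoeff lp gp d * lrCoeff lm gm d := by
  have hS : ∀ s ∈ ptnFin (p + q) B, IsPartition s := fun s hs =>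
    ⟨(mem_ptnFin.1 hs).1.anti, _, (mem_ptnFin.1 hs).1.supp _ le_rfl⟩
  have lp' := hlp.mono (Nat.le_add_right p q)
  have lm' := hlm.mono (Nat.le_add_left q p)
  have hle : ∀ {s l : ℕ → ℕ}, IsPartition s → IsPN (p + q) l → (∀ k, l k ≤ B) →
      (∀ k, s k ≤ l k) → s ∈ ptnFin (p + q) B := by
    intro s l hs hl hB hsl
    have h1 : IsPN (p + q) s :=
      ⟨fun i j hij => hs.1 hij, fun k hk => Nat.le_zero.1 ((hsl k).trans (hl.supp k hk).le)⟩
    exact mem_ptnFin.2 ⟨h1, fun k => (hsl k).trans (hB k)⟩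
  have hd : ∀ gp ∈ ptnFin (p + q) B, ∀ gm, ∑ᶠ (d : Ptn), lrCoeff gp mp np * lrCoeff gm mm nm *
          lrCoeff lp gp d.1 * lrCoeff lm gm d.1 = ∑ d ∈ ptnFin (p + q) B,
          lrCoeff gp mp np * lrCoeff gm mm nm * lrCoeff lp gp d * lrCoeff lm gm d := by
    intro gp hgp gm
    refine finsum_ptn (fun d => lrCoeff gp mp np * lrCoeff gm mm nm *
          lrCoeff lp gp d * lrCoeff lm gm d) _ hS fun d hd hne => ?_
    have h1 := right_ne_zero_of_mul (left_ne_zero_of_mul hne)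
    obtain ⟨N, hN⟩ := hd.2
    have hdN : IsPN (max N (p + q)) d :=
      ⟨fun i j hij => hd.1 hij, fun k hk =>
        Nat.le_zero.1 ((hd.1 ((le_max_left _ _).trans hk)).trans hN.le)⟩
    rw [lrCoeff_comm ((mem_ptnFin.1 hgp).1.mono (le_max_right N _)) hdN
      (lp'.mono (le_max_right N _))] at h1
    exact hle hd lp' hBp (lrCoeff_le h1)
  have hgm : ∀ gp ∈ ptnFin (p + q) B, ∑ᶠ (gm : Ptn) (d : Ptn),
        lrCoeff gp mp np * lrCoeff gm.1 mm nm * lrCoeff lp gp d.1 * lrCoeff lm gm.1 d.1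
      = ∑ gm ∈ ptnFin (p + q) B, ∑ d ∈ ptnFin (p + q) B,
          lrCoeff gp mp np * lrCoeff gm mm nm * lrCoeff lp gp d * lrCoeff lm gm d := by
    intro gp hgp
    simp only [hd gp hgp]
    refine finsum_ptn (fun gm => ∑ d ∈ ptnFin (p + q) B,
      lrCoeff gp mp np * lrCoeff gm mm nm * lrCoeff lp gp d * lrCoeff lm gm d) _ hS
      fun gm hgm hne => ?_
    obtain ⟨d, _, hd⟩ := Finset.exists_ne_zero_of_sum_ne_zero hne
    exact hle hgm lm' hBm (lrCoeff_le (right_ne_zero_of_mul hd))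
  have h0 : ∀ gp : Ptn, gp.1 ∉ ptnFin (p + q) B → ∀ gm d : Ptn,
      lrCoeff gp.1 mp np * lrCoeff gm.1 mm nm * lrCoeff lp gp.1 d.1 * lrCoeff lm gm.1 d.1 = 0 := by
    intro gp hgp gm d
    by_contra hne
    have h1 := right_ne_zero_of_mul (left_ne_zero_of_mul hne)
    exact hgp (hle gp.2 lp' hBp (lrCoeff_le h1))
  let F : (ℕ → ℕ) → ℕ := fun gp => ∑ᶠ (gm : Ptn) (d : Ptn),
        lrCoeff gp mp np * lrCoeff gm.1 mm nm * lrCoeff lp gp d.1 * lrCoeff lm gm.1 d.1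
  rw [show (∑ᶠ (gp : Ptn) (gm : Ptn) (d : Ptn), lrCoeff gp.1 mp np * lrCoeff gm.1 mm nm *
          lrCoeff lp gp.1 d.1 * lrCoeff lm gm.1 d.1) = ∑ᶠ gp : Ptn, F gp.1 from rfl,
    finsum_ptn F (ptnFin (p + q) B) hS]
  · exact Finset.sum_congr rfl hgm
  · intro gp hgp hne
    by_contra hc
    refine hne ?_
    simp only [F, h0 ⟨gp, hgp⟩ hc, finsum_zero]

end
end

noncomputable section

section LaurentAlgebra
variable {n : ℕ}

/-- Laurent polynomials in `n` variables. -/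
abbrev LPoly (n : ℕ) := AddMonoidAlgebra ℂ (Fin n → ℤ)

/-- The Euler derivation `x_i ∂/∂x_i`. -/
def eulerD (i : Fin n) : LPoly n →ₗ[ℂ] LPoly n where
  toFun χ := .ofCoeff (Finsupp.onFinset χ.coeff.support (fun μ => (μ i : ℂ) * χ.coeff μ)
    (fun μ h => Finsupp.mem_support_iff.2 (right_ne_zero_of_mul h)))
  map_add' x y := by
    ext μ
    simp [mul_add]
  map_smul' c x := by
    ext μ
    simp
    ring

@[simp] lemma eulerD_coeff (i : Fin n) (χ : LPoly n) (μ : Fin n → ℤ) :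
    (eulerD i χ).coeff μ = (μ i : ℂ) * χ.coeff μ := rfl

lemma eulerD_single (i : Fin n) (μ : Fin n → ℤ) (r : ℂ) :
    eulerD i (AddMonoidAlgebra.single μ r) = AddMonoidAlgebra.single μ ((μ i : ℂ) * r) := by
  classical
  ext η
  simp only [eulerD_coeff, AddMonoidAlgebra.coeff_single, Finsupp.single_apply]
  split_ifs with h
  · rw [h]
  · simp

lemma eulerD_mul (i : Fin n) (a b : LPoly n) :
    eulerD i (a * b) = a * eulerD i b + b * eulerD i a := by
  induction a using AddMonoidAlgebra.induction_linear with
  | zero => simp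
  | add f g hf hg => simp only [add_mul, map_add, hf, hg, mul_add]; ring
  | single μ r =>
    induction b using AddMonoidAlgebra.induction_linear with
    | zero => simp
    | add f g hf hg => simp only [add_mul, map_add, hf, hg, mul_add]; ring
    | single ν s =>
      simp only [AddMonoidAlgebra.single_mul_single, eulerD_single, Pi.add_apply]
      rw [add_comm ν μ, ← AddMonoidAlgebra.single_add]
      congr 1
      push_cast
      ring

/-- The Laurent monomial `x_a⁻¹`. -/
def yv (a : Fin n) : LPoly n := AddMonoidAlgebra.single (-Pi.single a 1) 1

lemma eulerD_yv (i a : Fin n) : eulerD i (yv a) = if i = a then -yv a else 0 := by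
  rw [yv, eulerD_single]
  split_ifs with h
  · subst h
    rw [← AddMonoidAlgebra.single_neg]
    simp
  · simp [h]

/-- The Weyl denominator. -/
def wDenom (n : ℕ) : LPoly n := (Matrix.vandermonde (yv (n := n))).det

lemma wDenom_eq_prod : wDenom n = ∏ i : Fin n, ∏ j ∈ Finset.Ioi i, (yv j - yv i) :=
  Matrix.det_vandermonde _

lemma yv_pow (a : Fin n) (k : ℕ) :
    yv a ^ k = AddMonoidAlgebra.single (-Pi.single a (k : ℤ)) 1 := by
  rw [yv, AddMonoidAlgebra.single_pow, one_pow]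
  congr 1
  ext j
  by_cases h : j = a
  · subst h; simp
  · simp [h]

lemma prod_single {ι : Type*} (s : Finset ι) (f : ι → Fin n → ℤ) :
    ∏ i ∈ s, (AddMonoidAlgebra.single (f i) 1 : LPoly n)
      = AddMonoidAlgebra.single (∑ i ∈ s, f i) 1 := by
  classical
  induction s using Finset.induction_on with
  | empty => simp [AddMonoidAlgebra.one_def]
  | insert a s ha ih =>
    rw [Finset.prod_insert ha, Finset.sum_insert ha, ih, AddMonoidAlgebra.single_mul_single,
      one_mul]

lemma wDenom_eq_sum : wDenom n = ∑ w : Equiv.Perm (Fin n),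
    AddMonoidAlgebra.single (fun i => -((w i : ℕ) : ℤ)) ((Equiv.Perm.sign w : ℤ) : ℂ) := by
  rw [wDenom, Matrix.det_apply, ← Equiv.sum_comp (Equiv.inv (Equiv.Perm (Fin n)))]
  refine Finset.sum_congr rfl fun w _ => ?_
  simp only [Matrix.vandermonde_apply, yv_pow, Equiv.inv_apply, Equiv.Perm.sign_inv]
  rw [prod_single, Units.smul_def, ← Int.cast_smul_eq_zsmul ℂ, AddMonoidAlgebra.smul_single]
  congr 1
  · ext j
    rw [Finset.sum_apply, Finset.sum_eq_single (w j)]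
    · simp
    · intro b _ hb
      have : j ≠ w.symm b := fun h => hb (by simp [h])
      simpa using Pi.single_eq_of_ne this _
    · simp
  · simp

lemma coeff_single_mul (η κ : Fin n → ℤ) (r : ℂ) (χ : LPoly n) :
    (AddMonoidAlgebra.single η r * χ).coeff κ = r * χ.coeff (κ - η) := by
  exact AddMonoidAlgebra.coeff_single_mul_eq_mul_coeff _
    fun _ _ => ⟨fun h => by rw [← h]; abel, fun h => by rw [h]; abel⟩

lemma wDenom_mul_coeff (χ : LPoly n) (κ : Fin n → ℤ) : (wDenom n * χ).coeff κ
    = ∑ w : Equiv.Perm (Fin n), ((Equiv.Perm.sign w : ℤ) : ℂ) *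
        χ.coeff (fun i => κ i + ((w i : ℕ) : ℤ)) := by
  rw [wDenom_eq_sum, Finset.sum_mul]
  rw [show ((∑ w : Equiv.Perm (Fin n), AddMonoidAlgebra.single (fun i => -((w i : ℕ) : ℤ))
    ((Equiv.Perm.sign w : ℤ) : ℂ) * χ).coeff κ) = ∑ w : Equiv.Perm (Fin n),
    (AddMonoidAlgebra.single (fun i => -((w i : ℕ) : ℤ))
    ((Equiv.Perm.sign w : ℤ) : ℂ) * χ).coeff κ by simp]
  refine Finset.sum_congr rfl fun w _ => ?_
  rw [coeff_single_mul]
  congr 3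
  ext i
  simp

lemma eulerD_sq_wDenom : ∑ i : Fin n, eulerD i (eulerD i (wDenom n))
    = (∑ i : Fin n, ((i : ℕ) : ℂ) ^ 2) • wDenom n := by
  simp only [wDenom_eq_sum, map_sum, eulerD_single, Finset.smul_sum, AddMonoidAlgebra.smul_single]
  rw [Finset.sum_comm]
  refine Finset.sum_congr rfl fun w _ => ?_
  rw [← Equiv.sum_comp w (fun i : Fin n => ((i : ℕ) : ℂ) ^ 2)]
  ext η
  simp only [AddMonoidAlgebra.coeff_sum, Finsupp.coe_finsetSum, Finset.sum_apply,
    AddMonoidAlgebra.coeff_single, Finsupp.single_apply]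
  split_ifs
  · rw [smul_eq_mul, Finset.sum_mul]
    refine Finset.sum_congr rfl fun i _ => ?_
    push_cast
    ring
  · simp

lemma derivation_prod {R ι : Type*} [CommRing R] (Γ : R → R) (h1 : Γ 1 = 0)
    (hΓ : ∀ a b, Γ (a * b) = a * Γ b + b * Γ a) (s : Finset ι) (p t : ι → R)
    (hp : ∀ i ∈ s, Γ (p i) = p i * t i) :
    Γ (∏ i ∈ s, p i) = (∏ i ∈ s, p i) * ∑ i ∈ s, t i := by
  classical
  induction s using Finset.induction_on with
  | empty => simp [h1]
  | insert a s ha ih =>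
    rw [Finset.prod_insert ha, Finset.sum_insert ha, hΓ,
      ih fun i hi => hp i (Finset.mem_insert_of_mem hi), hp a (Finset.mem_insert_self a s)]
    ring

lemma eulerD_one (i : Fin n) : eulerD i 1 = 0 := by
  rw [AddMonoidAlgebra.one_def, eulerD_single]
  simp

theorem wDenom_laplace (χ χ' : LPoly n) (T : Fin n → Fin n → LPoly n)
    (hT : ∀ a b, a < b → (yv b - yv a) * T a b = yv a * (eulerD a χ - eulerD b χ))
    (hχ : χ' = ∑ i, eulerD i (eulerD i χ) - ∑ i : Fin n, (2 * (i : ℕ) : ℂ) • eulerD i χ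
      + (2 : ℂ) • ∑ a, ∑ b ∈ Finset.Ioi a, T a b) :
    ∑ i, eulerD i (eulerD i (wDenom n * χ))
      = wDenom n * χ' + (∑ i : Fin n, ((i : ℕ) : ℂ) ^ 2) • (wDenom n * χ) := by
  let Γ : LPoly n → LPoly n := fun x => ∑ i, eulerD i x * eulerD i χ
  have hΓmul : ∀ a b, Γ (a * b) = a * Γ b + b * Γ a := by
    intro a b
    simp only [Γ, eulerD_mul, Finset.mul_sum, ← Finset.sum_add_distrib]
    exact Finset.sum_congr rfl fun i _ => by ring
  have hΓ1 : Γ 1 = 0 := by simp [Γ, eulerD_one]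
  have hΓy : ∀ a, Γ (yv a) = -(yv a * eulerD a χ) := by
    intro a
    simp only [Γ, eulerD_yv]
    rw [Finset.sum_eq_single a] <;> simp +contextual
  have hΓsub : ∀ a b, Γ (a - b) = Γ a - Γ b := by
    intro a b
    simp [Γ, sub_mul]
  have key : Γ (wDenom n) = wDenom n * ∑ a, ∑ b ∈ Finset.Ioi a, (T a b - eulerD b χ) := by
    rw [wDenom_eq_prod]
    refine derivation_prod Γ hΓ1 hΓmul _ _ _ fun a _ => ?_
    refine derivation_prod Γ hΓ1 hΓmul _ _ _ fun b hb => ?_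
    rw [hΓsub, hΓy, hΓy, mul_sub, hT a b (Finset.mem_Ioi.1 hb)]
    ring
  have hsum : ∑ a : Fin n, ∑ b ∈ Finset.Ioi a, eulerD b χ
      = ∑ b : Fin n, ((b : ℕ) : ℂ) • eulerD b χ := by
    rw [Finset.sum_comm' (t' := Finset.univ) (s' := fun b => Finset.Iio b) (by simp)]
    refine Finset.sum_congr rfl fun b _ => ?_
    rw [Finset.sum_const, Fin.card_Iio, Nat.cast_smul_eq_nsmul]
  have e1 : ∀ i, eulerD i (eulerD i (wDenom n * χ)) = wDenom n * eulerD i (eulerD i χ)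
      + 2 * (eulerD i (wDenom n) * eulerD i χ) + χ * eulerD i (eulerD i (wDenom n)) := by
    intro i
    simp only [eulerD_mul, map_add]
    ring
  simp only [e1, Finset.sum_add_distrib, ← Finset.mul_sum]
  change _ + 2 * Γ (wDenom n) + _ = _
  have h3 : ∑ i : Fin n, (2 * (i : ℕ) : ℂ) • eulerD i χ
      = 2 * ∑ i : Fin n, ((i : ℕ) : ℂ) • eulerD i χ := by
    rw [Finset.mul_sum]
    exact Finset.sum_congr rfl fun i _ => by rw [mul_smul, two_smul, two_mul]
  have h2 : ∀ x : LPoly n, (2 : ℂ) • x = 2 * x := fun x => by rw [two_smul, two_mul]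
  rw [eulerD_sq_wDenom, key, hχ, h3]
  simp only [Finset.sum_sub_distrib, hsum, h2, mul_sub, mul_add,
    mul_smul_comm]
  rw [mul_comm χ]
  ring

end LaurentAlgebra
end

noncomputable section

section GLOperators
variable {n : ℕ} {V : Type*} [AddCommGroup V] [Module ℂ V]

/-- The commutation relations of the matrix units of `𝔤𝔩_n`. -/
def GLRel (E : Fin n → Fin n → Module.End ℂ V) : Prop :=
  ∀ i j k l, E i j * E k l - E k l * E i j
    = (if j = k then E i l else 0) - (if l = i then E k j else 0)

/-- Simultaneous eigenspaces of the `E i i`. -/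
def wtSp (E : Fin n → Fin n → Module.End ℂ V) (μ : Fin n → ℤ) : Submodule ℂ V :=
  ⨅ i, LinearMap.ker (E i i - (μ i : ℂ) • (1 : Module.End ℂ V))

/-- Highest weight vectors of weight `μ`. -/
def hwSp (E : Fin n → Fin n → Module.End ℂ V) (μ : Fin n → ℤ) : Submodule ℂ V :=
  wtSp E μ ⊓ ⨅ i, ⨅ j, ⨅ _ : i < j, LinearMap.ker (E i j)

variable {E : Fin n → Fin n → Module.End ℂ V} {μ : Fin n → ℤ}

lemma mem_wtSp {v : V} : v ∈ wtSp E μ ↔ ∀ i, E i i v = (μ i : ℂ) • v := by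
  simp [wtSp, sub_eq_zero]

lemma mem_hwSp {v : V} : v ∈ hwSp E μ ↔
    (∀ i, E i i v = (μ i : ℂ) • v) ∧ ∀ i j, i < j → E i j v = 0 := by
  simp [hwSp, mem_wtSp]

lemma GLRel.raise (hE : GLRel E) {a b : Fin n} {v : V} (hv : v ∈ wtSp E μ) :
    E a b v ∈ wtSp E (μ + Pi.single a 1 - Pi.single b 1) := by
  rw [mem_wtSp] at hv ⊢
  intro i
  have h := congrArg (fun f => f v) (hE i i a b)
  simp only [LinearMap.sub_apply, Module.End.mul_apply, hv i, map_smul] at h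
  rw [sub_eq_iff_eq_add] at h
  rw [h]
  by_cases h1 : i = a <;> by_cases h2 : b = i
  · subst h1; subst h2; simp
  · subst h1
    simp [h2, Ne.symm h2, add_smul]
    abel
  · subst h2
    simp [h1, sub_smul]
    abel
  · simp [h1, h2, Ne.symm h2]

/-- The quadratic Casimir operator, up to a multiple of the trace. -/
def casimir (E : Fin n → Fin n → Module.End ℂ V) : Module.End ℂ V :=
  ∑ i, E i i * E i i - ∑ i : Fin n, (2 * (i : ℕ) : ℂ) • E i i
    + (2 : ℂ) • ∑ a, ∑ b ∈ Finset.Ioi a, E b a * E a b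

lemma casimir_eq (hE : GLRel E) : casimir E
    = ∑ i, ∑ j, E i j * E j i - ((n : ℂ) - 1) • ∑ i, E i i := by
  have h1 : ∀ i j, E i j * E j i = E j i * E i j + (E i i - E j j) := by
    intro i j
    have := hE i j j i
    simp only [if_true] at this
    rw [← this]
    abel
  have h2 : ∑ i, ∑ j, E i j * E j i = ∑ i, E i i * E i i + ∑ a, ∑ b ∈ Finset.Ioi a, E b a * E a b
      + ∑ a, ∑ b ∈ Finset.Ioi a, E a b * E b a := by
    have h3 : ∀ i : Fin n, ∑ j, E i j * E j i = E i i * E i i + ∑ j ∈ Finset.Iio i, E i j * E j i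
        + ∑ j ∈ Finset.Ioi i, E i j * E j i := by
      intro i
      have : (Finset.univ : Finset (Fin n)) = ({i} ∪ Finset.Iio i) ∪ Finset.Ioi i := by
        ext j
        simp only [Finset.mem_univ, Finset.mem_union, Finset.mem_singleton, Finset.mem_Iio,
          Finset.mem_Ioi, true_iff]
        rcases lt_trichotomy j i with h | h | h <;> simp [h]
      rw [this, Finset.sum_union, Finset.sum_union, Finset.sum_singleton]
      · simp
      · rw [Finset.disjoint_left]
        intro j hj
        simp only [Finset.mem_union, Finset.mem_singleton, Finset.mem_Iio] at hj
        simp only [Finset.mem_Ioi, not_lt]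
        rcases hj with rfl | h
        · exact le_rfl
        · exact h.le
    simp only [h3, Finset.sum_add_distrib]
    congr 2
    exact Finset.sum_comm' (by simp)
  have h4 : ∑ a : Fin n, ∑ b ∈ Finset.Ioi a, E a b * E b a
      = ∑ a : Fin n, ∑ b ∈ Finset.Ioi a, E b a * E a b
        + ∑ a : Fin n, ((n : ℂ) - 1 - 2 * (a : ℕ)) • E a a := by
    have h5 : ∑ a : Fin n, ∑ b ∈ Finset.Ioi a, E b b = ∑ b : Fin n, ((b : ℕ) : ℂ) • E b b := by
      rw [Finset.sum_comm' (t' := Finset.univ) (s' := fun b => Finset.Iio b) (by simp)]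
      refine Finset.sum_congr rfl fun b _ => ?_
      rw [Finset.sum_const, Fin.card_Iio, Nat.cast_smul_eq_nsmul]
    have h6 : ∀ a : Fin n, ∑ b ∈ Finset.Ioi a, E a a = ((n : ℂ) - 1 - (a : ℕ)) • E a a := by
      intro a
      rw [Finset.sum_const, Fin.card_Ioi, ← Nat.cast_smul_eq_nsmul ℂ, Nat.sub_sub,
        Nat.cast_sub (by omega)]
      push_cast
      ring_nf
    rw [Finset.sum_congr rfl fun a _ => Finset.sum_congr rfl fun b _ => h1 a b]
    simp only [Finset.sum_add_distrib, Finset.sum_sub_distrib, h5, h6]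
    rw [← Finset.sum_sub_distrib]
    congr 1
    refine Finset.sum_congr rfl fun a _ => ?_
    rw [← sub_smul]
    ring_nf
  rw [h2, h4, casimir, two_smul, Finset.smul_sum]
  simp only [sub_smul, Finset.sum_sub_distrib]
  abel

lemma casimir_comm (hE : GLRel E) (k l : Fin n) : Commute (casimir E) (E k l) := by
  have hd : Commute (∑ i, E i i) (E k l) := by
    rw [Commute, SemiconjBy, ← sub_eq_zero, Finset.sum_mul, Finset.mul_sum,
      ← Finset.sum_sub_distrib, Finset.sum_congr rfl fun i _ => hE i i k l]
    simp
  rw [casimir_eq hE]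
  refine Commute.sub_left ?_ (hd.smul_left _)
  rw [Commute, SemiconjBy, ← sub_eq_zero, Finset.sum_mul, Finset.mul_sum,
      ← Finset.sum_sub_distrib]
  have h1 : ∀ i j, E i j * E j i * E k l - E k l * (E i j * E j i)
      = E i j * ((if i = k then E j l else 0) - (if l = j then E k i else 0))
        + ((if j = k then E i l else 0) - (if l = i then E k j else 0)) * E j i := by
    intro i j
    rw [← hE, ← hE]
    noncomm_ring
  have h2 : ∀ i, (∑ j, E i j * E j i) * E k l - E k l * ∑ j, E i j * E j i
      = ∑ j, (E i j * ((if i = k then E j l else 0) - (if l = j then E k i else 0))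
        + ((if j = k then E i l else 0) - (if l = i then E k j else 0)) * E j i) := by
    intro i
    rw [Finset.sum_mul, Finset.mul_sum, ← Finset.sum_sub_distrib]
    exact Finset.sum_congr rfl fun j _ => h1 i j
  simp only [h2, mul_sub, sub_mul, Finset.sum_add_distrib, Finset.sum_sub_distrib, mul_ite,
    mul_zero, ite_mul, zero_mul]
  simp

/-- The value of `casimir` on highest weight vectors. -/
def casVal (μ : Fin n → ℤ) : ℤ := ∑ i, (μ i ^ 2 - 2 * (i : ℕ) * μ i)

lemma casimir_hw {v : V} (hv : v ∈ hwSp E μ) : casimir E v = (casVal μ : ℂ) • v := by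
  rw [mem_hwSp] at hv
  have h1 : ∀ a : Fin n, ∑ b ∈ Finset.Ioi a, (E b a) ((E a b) v) = 0 := fun a =>
    Finset.sum_eq_zero fun b hb => by rw [hv.2 a b (Finset.mem_Ioi.1 hb), map_zero]
  simp only [casimir, LinearMap.add_apply, LinearMap.sub_apply, LinearMap.sum_apply,
    LinearMap.smul_apply, Module.End.mul_apply, hv.1, map_smul, h1, Finset.sum_const_zero,
    smul_zero, add_zero, casVal]
  push_cast
  rw [← Finset.sum_sub_distrib, Finset.sum_smul]
  refine Finset.sum_congr rfl fun i _ => ?_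
  rw [sub_smul, pow_two, mul_smul, mul_smul, mul_smul, mul_smul]

end GLOperators
end

noncomputable section

section WeightTrace
variable {n : ℕ} {V : Type*} [AddCommGroup V] [Module ℂ V]

lemma exists_isProj (S : Submodule ℂ V) : ∃ P : Module.End ℂ V, LinearMap.IsProj S P := by
  obtain ⟨f, hf⟩ := S.subtype.exists_leftInverse_of_injective S.ker_subtype
  refine ⟨S.subtype ∘ₗ f, ⟨fun x => (f x).2, fun x hx => ?_⟩⟩
  have := congrArg (fun g => g ⟨x, hx⟩) hf
  simpa using congrArg Subtype.val this

/-- A projection onto the weight space of weight `μ`. -/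
def wtProj (E : Fin n → Fin n → Module.End ℂ V) (μ : Fin n → ℤ) : Module.End ℂ V :=
  (exists_isProj (wtSp E μ)).choose

lemma wtProj_isProj (E : Fin n → Fin n → Module.End ℂ V) (μ : Fin n → ℤ) :
    LinearMap.IsProj (wtSp E μ) (wtProj E μ) := (exists_isProj (wtSp E μ)).choose_spec

variable {E : Fin n → Fin n → Module.End ℂ V} {μ : Fin n → ℤ}

/-- The trace of `Q` on the weight space of weight `μ`. -/
def wtTr (E : Fin n → Fin n → Module.End ℂ V) (Q : Module.End ℂ V) (μ : Fin n → ℤ) : ℂ :=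
  LinearMap.trace ℂ V (Q * wtProj E μ)

lemma wtSp_finite [FiniteDimensional ℂ V] (E : Fin n → Fin n → Module.End ℂ V) :
    {μ | wtSp E μ ≠ ⊥}.Finite := by
  have h : ∀ i, {c : ℤ | (E i i).HasEigenvalue (c : ℂ)}.Finite := fun i =>
    Set.Finite.preimage (f := fun c : ℤ => (c : ℂ)) (fun a _ b _ h => Int.cast_injective h)
      (Module.End.finite_hasEigenvalue (E i i))
  refine (Set.Finite.pi' h).subset fun μ hμ i => ?_
  obtain ⟨v, hv, hv0⟩ := Submodule.exists_mem_ne_zero_of_ne_bot hμ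
  exact Module.End.hasEigenvalue_of_hasEigenvector
    ⟨Module.End.mem_eigenspace_iff.2 (mem_wtSp.1 hv i), hv0⟩

lemma wtProj_eq_zero (h : wtSp E μ = ⊥) : wtProj E μ = 0 := by
  ext v
  have := (wtProj_isProj E μ).map_mem v
  rw [h] at this
  simpa using this

/-- The generating function of the traces of `Q` on weight spaces. -/
def wtGen [FiniteDimensional ℂ V] (E : Fin n → Fin n → Module.End ℂ V) (Q : Module.End ℂ V) :
    LPoly n :=
  .ofCoeff (Finsupp.onFinset (wtSp_finite E).toFinset (wtTr E Q) fun μ h => by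
    rw [Set.Finite.mem_toFinset]
    intro h0
    exact h (by rw [wtTr, wtProj_eq_zero h0, mul_zero, map_zero]))

@[simp] lemma wtGen_coeff [FiniteDimensional ℂ V] (Q : Module.End ℂ V) :
    (wtGen E Q).coeff μ = wtTr E Q μ := rfl

lemma proj_mul {S : Submodule ℂ V} {P A : Module.End ℂ V} (hP : LinearMap.IsProj S P)
    (hA : ∀ v, A v ∈ S) : P * A = A := by
  ext v
  exact hP.map_id _ (hA v)

lemma mul_mem_wtSp {Q : Module.End ℂ V} (hQ : ∀ i j, Commute Q (E i j)) {v : V}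
    (hv : v ∈ wtSp E μ) : Q v ∈ wtSp E μ := by
  rw [mem_wtSp] at hv ⊢
  intro i
  have := congrArg (fun f => f v) (hQ i i).eq
  simp only [Module.End.mul_apply] at this
  rw [← this, hv, map_smul]

lemma diag_mul_wtProj (i : Fin n) : E i i * wtProj E μ = (μ i : ℂ) • wtProj E μ := by
  ext v
  exact mem_wtSp.1 ((wtProj_isProj E μ).map_mem v) i

/-- Cyclicity of the trace, moving a root operator through the trace on a weight space. -/
lemma wtTr_cycle (hE : GLRel E) {Q : Module.End ℂ V} (hQ : ∀ i j, Commute Q (E i j))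
    {a b : Fin n} {η : Fin n → ℤ} (h : η = μ + Pi.single a 1 - Pi.single b 1) :
    wtTr E (E b a * E a b * Q) μ = wtTr E (E a b * E b a * Q) η := by
  have h1 : wtProj E η * (E a b * Q * wtProj E μ) = E a b * Q * wtProj E μ := by
    refine proj_mul (wtProj_isProj E η) fun v => ?_
    rw [h]
    exact hE.raise (mul_mem_wtSp hQ ((wtProj_isProj E μ).map_mem v))
  have h2 : wtProj E μ * (E b a * wtProj E η) = E b a * wtProj E η := by
    refine proj_mul (wtProj_isProj E μ) fun v => ?_
    have : μ = η + Pi.single b 1 - Pi.single a 1 := by rw [h]; abel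
    rw [this]
    exact hE.raise ((wtProj_isProj E _).map_mem v)
  rw [wtTr, wtTr]
  calc _ = LinearMap.trace ℂ V (E b a * (wtProj E η * (E a b * Q * wtProj E μ))) := by
        rw [h1]; simp only [mul_assoc]
    _ = LinearMap.trace ℂ V ((E a b * Q * wtProj E μ) * (E b a * wtProj E η)) := by
        rw [← mul_assoc, LinearMap.trace_mul_comm]
    _ = _ := by
        rw [mul_assoc, h2, mul_assoc, mul_assoc, mul_assoc, ← mul_assoc Q, (hQ b a).eq, mul_assoc]

lemma wtTr_add (Q R : Module.End ℂ V) : wtTr E (Q + R) μ = wtTr E Q μ + wtTr E R μ := by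
  simp [wtTr, add_mul]

lemma wtTr_sub (Q R : Module.End ℂ V) : wtTr E (Q - R) μ = wtTr E Q μ - wtTr E R μ := by
  simp [wtTr, sub_mul]

lemma wtTr_smul (c : ℂ) (Q : Module.End ℂ V) : wtTr E (c • Q) μ = c * wtTr E Q μ := by
  simp [wtTr]

lemma wtTr_sum {ι : Type*} (s : Finset ι) (Q : ι → Module.End ℂ V) :
    wtTr E (∑ i ∈ s, Q i) μ = ∑ i ∈ s, wtTr E (Q i) μ := by
  simp [wtTr, Finset.sum_mul]

lemma wtTr_diag {Q : Module.End ℂ V} (hQ : ∀ i j, Commute Q (E i j)) (i : Fin n) :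
    wtTr E (E i i * Q) μ = μ i * wtTr E Q μ := by
  rw [wtTr, ← (hQ i i).eq, mul_assoc, diag_mul_wtProj, mul_smul_comm, map_smul, smul_eq_mul, wtTr]

lemma wtTr_step (hE : GLRel E) {Q : Module.End ℂ V} (hQ : ∀ i j, Commute Q (E i j))
    {a b : Fin n} {η : Fin n → ℤ} (h : η = μ + Pi.single a 1 - Pi.single b 1) :
    wtTr E (E b a * E a b * Q) μ - wtTr E (E b a * E a b * Q) η
      = (η a - η b) * wtTr E Q η := by
  have h1 : E a b * E b a = E b a * E a b + (E a a - E b b) := by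
    have := hE a b b a
    simp only [if_true] at this
    rw [← this]
    abel
  rw [wtTr_cycle hE hQ h, h1, add_mul, wtTr_add, sub_mul, wtTr_sub, wtTr_diag hQ, wtTr_diag hQ]
  ring

lemma yv_mul_coeff (a : Fin n) (χ : LPoly n) (κ : Fin n → ℤ) :
    (yv a * χ).coeff κ = χ.coeff (κ + Pi.single a 1) := by
  rw [yv, coeff_single_mul, one_mul, sub_neg_eq_add]

lemma wtGen_laplace [FiniteDimensional ℂ V] (hE : GLRel E) {Q : Module.End ℂ V}
    (hQ : ∀ i j, Commute Q (E i j)) :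
    ∑ i, eulerD i (eulerD i (wDenom n * wtGen E Q))
      = wDenom n * wtGen E (casimir E * Q)
        + (∑ i : Fin n, ((i : ℕ) : ℂ) ^ 2) • (wDenom n * wtGen E Q) := by
  refine wDenom_laplace _ _ (fun a b => wtGen E (E b a * E a b * Q)) ?_ ?_
  · intro a b hab
    ext κ
    simp only [sub_mul, mul_sub, AddMonoidAlgebra.coeff_sub, Finsupp.sub_apply, yv_mul_coeff,
      wtGen_coeff, eulerD_coeff]
    rw [wtTr_step hE hQ (a := a) (b := b) (η := κ + Pi.single a 1)]
    · ring
    · abel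
  · ext κ
    simp only [AddMonoidAlgebra.coeff_sub, AddMonoidAlgebra.coeff_add, AddMonoidAlgebra.coeff_sum,
      AddMonoidAlgebra.coeff_smul, Finsupp.sub_apply, Finsupp.add_apply, Finsupp.coe_finsetSum,
      Finset.sum_apply, Finsupp.smul_apply, wtGen_coeff, eulerD_coeff, smul_eq_mul]
    rw [casimir, add_mul, sub_mul, wtTr_add, wtTr_sub, Finset.sum_mul, Finset.sum_mul, smul_mul_assoc,
      wtTr_smul, wtTr_sum, wtTr_sum, Finset.sum_mul, wtTr_sum]
    congr 1
    · congr 1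
      · refine Finset.sum_congr rfl fun i _ => ?_
        rw [mul_assoc, ← (hQ i i).eq, ← mul_assoc, wtTr, mul_assoc, diag_mul_wtProj, mul_smul_comm,
          map_smul, smul_eq_mul, ← wtTr, wtTr_diag hQ]
      · refine Finset.sum_congr rfl fun i _ => ?_
        rw [smul_mul_assoc, wtTr_smul, wtTr_diag hQ]
    · congr 1
      refine Finset.sum_congr rfl fun a _ => ?_
      rw [Finset.sum_mul, wtTr_sum]

/-- The alternating sum of traces on weight spaces. -/
def altTr (E : Fin n → Fin n → Module.End ℂ V) (Q : Module.End ℂ V) (κ : Fin n → ℤ) : ℂ :=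
  ∑ w : Equiv.Perm (Fin n), ((Equiv.Perm.sign w : ℤ) : ℂ) *
    wtTr E Q (fun i => κ i + ((w i : ℕ) : ℤ))

lemma altTr_casimir_mul [FiniteDimensional ℂ V] (hE : GLRel E) {Q : Module.End ℂ V}
    (hQ : ∀ i j, Commute Q (E i j)) (μ : Fin n → ℤ) :
    altTr E (casimir E * Q) (fun i => μ i - (i : ℕ))
      = casVal μ * altTr E Q (fun i => μ i - (i : ℕ)) := by
  have h := congrArg (fun χ => χ.coeff (fun i => μ i - (i : ℕ))) (wtGen_laplace hE hQ)
  simp only [AddMonoidAlgebra.coeff_add, AddMonoidAlgebra.coeff_sum,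
      AddMonoidAlgebra.coeff_smul, Finsupp.add_apply, Finsupp.coe_finsetSum,
      Finset.sum_apply, Finsupp.smul_apply, eulerD_coeff, smul_eq_mul, wDenom_mul_coeff,
      wtGen_coeff] at h
  change ∑ i, _ * (_ * altTr E Q (fun i => μ i - (i : ℕ)))
    = altTr E (casimir E * Q) (fun i => μ i - (i : ℕ))
      + _ * altTr E Q (fun i => μ i - (i : ℕ)) at h
  rw [← sub_eq_iff_eq_add] at h
  rw [← h, Finset.sum_mul, ← Finset.sum_sub_distrib, casVal]
  push_cast
  rw [Finset.sum_mul]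
  refine Finset.sum_congr rfl fun i _ => ?_
  ring

lemma altTr_aeval_casimir [FiniteDimensional ℂ V] (hE : GLRel E) (p : Polynomial ℂ)
    (μ : Fin n → ℤ) :
    altTr E (Polynomial.aeval (casimir E) p) (fun i => μ i - (i : ℕ))
      = p.eval (casVal μ : ℂ) * altTr E 1 (fun i => μ i - (i : ℕ)) := by
  have hadd : ∀ Q R κ, altTr E (Q + R) κ = altTr E Q κ + altTr E R κ := by
    intro Q R κ
    simp [altTr, wtTr_add, mul_add, Finset.sum_add_distrib]
  have hsmul : ∀ (c : ℂ) Q κ, altTr E (c • Q) κ = c * altTr E Q κ := by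
    intro c Q κ
    simp only [altTr, wtTr_smul, Finset.mul_sum]
    exact Finset.sum_congr rfl fun w _ => by ring
  induction p using Polynomial.induction_on' with
  | add p q hp hq => rw [map_add, hadd, hp, hq, Polynomial.eval_add, add_mul]
  | monomial k c =>
    rw [Polynomial.aeval_monomial, ← Algebra.smul_def, hsmul, Polynomial.eval_monomial, mul_assoc]
    congr 1
    induction k with
    | zero => simp
    | succ k ih =>
      rw [pow_succ', altTr_casimir_mul hE fun i j => (casimir_comm hE i j).pow_left k, ih]
      ring

end WeightTrace
end

noncomputable section

section HighestWeightCount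
variable {n : ℕ} {V : Type*} [AddCommGroup V] [Module ℂ V]
  {E : Fin n → Fin n → Module.End ℂ V} {μ : Fin n → ℤ}

/-- A dominance relation on weights, tested against antitone functions. -/
def DomWt (μ η : Fin n → ℤ) : Prop :=
  ∀ ν : Fin n → ℤ, Antitone ν → 0 ≤ ∑ i, (η i - μ i) * ν i

lemma DomWt.refl (μ : Fin n → ℤ) : DomWt μ μ := fun ν _ => by simp

lemma sum_root_mul (η ν : Fin n → ℤ) (μ : Fin n → ℤ) (a b : Fin n) :
    ∑ i, ((η + Pi.single a 1 - Pi.single b 1 : Fin n → ℤ) i - μ i) * ν i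
      = ∑ i, (η i - μ i) * ν i + (ν a - ν b) := by
  have : ∀ i, ((η + Pi.single a 1 - Pi.single b 1 : Fin n → ℤ) i - μ i) * ν i
      = (η i - μ i) * ν i + ((if i = a then ν i else 0) - (if i = b then ν i else 0)) := by
    intro i
    simp only [Pi.sub_apply, Pi.add_apply, Pi.single_apply]
    split_ifs <;> ring
  simp only [this, Finset.sum_add_distrib, Finset.sum_sub_distrib]
  simp

lemma DomWt.raise {η : Fin n → ℤ} (h : DomWt μ η) {a b : Fin n} (hab : a < b) :
    DomWt μ (η + Pi.single a 1 - Pi.single b 1) := by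
  intro ν hν
  rw [sum_root_mul]
  have := h ν hν
  have := hν hab.le
  linarith

lemma domWt_perm (μ : Fin n → ℤ) (w : Equiv.Perm (Fin n)) :
    DomWt μ (fun i => μ i - (i : ℕ) + ((w i : ℕ) : ℤ)) := by
  intro ν hν
  have h : Antivary (fun i : Fin n => ((i : ℕ) : ℤ)) ν := by
    intro i j hij
    by_contra hc
    push Not at hc
    have : i < j := by
      rw [Fin.lt_def]
      exact_mod_cast hc
    exact absurd (hν this.le) (not_le.2 hij)
  have h2 := h.sum_mul_le_sum_comp_perm_mul (σ := w)
  have : ∀ i : Fin n, (μ i - (i : ℕ) + ((w i : ℕ) : ℤ) - μ i) * ν i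
      = ((w i : ℕ) : ℤ) * ν i - ((i : ℕ) : ℤ) * ν i := fun i => by ring
  simp only [this, Finset.sum_sub_distrib]
  linarith

lemma casVal_lt (hμ : Antitone μ) {η : Fin n → ℤ} (h : DomWt μ η) (hne : η ≠ μ) :
    casVal μ < casVal η := by
  have h1 : casVal η - casVal μ = ∑ i, (η i - μ i) ^ 2
      + 2 * ∑ i, (η i - μ i) * (μ i - ((i : ℕ) : ℤ)) := by
    rw [casVal, casVal, Finset.mul_sum, ← Finset.sum_add_distrib, ← Finset.sum_sub_distrib]
    exact Finset.sum_congr rfl fun i _ => by ring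
  have h2 := h (fun i => μ i - ((i : ℕ) : ℤ)) (fun i j hij => by
    have := hμ hij
    have : ((i : ℕ) : ℤ) ≤ (j : ℕ) := by exact_mod_cast hij
    dsimp only
    linarith)
  have h3 : 0 < ∑ i, (η i - μ i) ^ 2 := by
    obtain ⟨i, hi⟩ := Function.ne_iff.1 hne
    exact Finset.sum_pos' (fun i _ => sq_nonneg _)
      ⟨i, Finset.mem_univ i, by have := sub_ne_zero.2 hi; positivity⟩
  linarith

lemma aeval_casimir_comm (hE : GLRel E) (p : Polynomial ℂ) (i j : Fin n) :
    Commute (Polynomial.aeval (casimir E) p) (E i j) :=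
  Polynomial.induction_on' (motive := fun p => Commute (Polynomial.aeval (casimir E) p) (E i j)) p
    (fun p q hp hq => by rw [map_add]; exact hp.add_left hq)
    (fun k c => by
      rw [Polynomial.aeval_monomial, ← Algebra.smul_def]
      exact ((casimir_comm hE i j).pow_left k).smul_left c)

lemma aeval_apply_eigen (A : Module.End ℂ V) (c : ℂ) {v : V} (hv : A v = c • v)
    (p : Polynomial ℂ) : Polynomial.aeval A p v = p.eval c • v := by
  by_cases h0 : v = 0
  · simp [h0]
  · exact Module.End.aeval_apply_of_hasEigenvector
      ⟨Module.End.mem_eigenspace_iff.2 hv, h0⟩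

/-- Generalized eigenvectors of the Casimir operator have no weights strictly dominating `μ`. -/
lemma casimir_ker_wtSp [FiniteDimensional ℂ V] (hE : GLRel E) (hμ : Antitone μ) (r : ℕ)
    {η : Fin n → ℤ} (hη : DomWt μ η) (hne : η ≠ μ) {v : V} (hv : v ∈ wtSp E η)
    (hr : Polynomial.aeval (casimir E) ((Polynomial.X - Polynomial.C (casVal μ : ℂ)) ^ r) v = 0) :
    v = 0 := by
  set R := Polynomial.aeval (casimir E) ((Polynomial.X - Polynomial.C (casVal μ : ℂ)) ^ r) with hR
  let S : Set (Fin n → ℤ) := {η | DomWt μ η ∧ η ≠ μ ∧ ∃ v ∈ wtSp E η, R v = 0 ∧ v ≠ 0}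
  have hS : S.Finite := (wtSp_finite E).subset fun η ⟨_, _, v, hv, _, h0⟩ hb => by
    rw [hb] at hv
    exact h0 hv
  let ht : (Fin n → ℤ) → ℤ := fun η => ∑ i, (η i - μ i) * (-((i : ℕ) : ℤ))
  have hanti : Antitone fun i : Fin n => -((i : ℕ) : ℤ) := fun i j hij => by
    have : ((i : ℕ) : ℤ) ≤ (j : ℕ) := by exact_mod_cast hij
    dsimp only
    linarith
  by_contra h0
  obtain ⟨θ, hθ, hmax⟩ := Set.exists_max_image S ht hS ⟨η, hη, hne, v, hv, hr, h0⟩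
  obtain ⟨hθ1, hθ2, u, hu, hRu, hu0⟩ := hθ
  have hkill : ∀ a b, a < b → E a b u = 0 := by
    intro a b hab
    by_contra hc
    have hlt : ht θ < ht (θ + Pi.single a 1 - Pi.single b 1) := by
      have h1 := sum_root_mul θ (fun i : Fin n => -((i : ℕ) : ℤ)) μ a b
      have h2 : ((a : ℕ) : ℤ) < (b : ℕ) := by exact_mod_cast hab
      change _ < ∑ i, _
      rw [h1]
      change ∑ i, _ < _
      linarith
    refine absurd hlt (not_lt.2 (hmax _ ⟨hθ1.raise hab, ?_, _, hE.raise hu, ?_, hc⟩))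
    · intro he
      rw [he] at hlt
      have h3 : ht μ = 0 := by simp [ht]
      have := hθ1 _ hanti
      change 0 ≤ ht θ at this
      linarith
    · have := congrArg (fun f => f u) (aeval_casimir_comm hE
        ((Polynomial.X - Polynomial.C (casVal μ : ℂ)) ^ r) a b).eq
      simp only [Module.End.mul_apply] at this
      rw [← hR] at this
      rw [this, hRu, map_zero]
  have hhw : u ∈ hwSp E θ := mem_hwSp.2 ⟨mem_wtSp.1 hu, hkill⟩
  rw [hR, aeval_apply_eigen _ _ (casimir_hw hhw)] at hRu
  have h1 := (smul_eq_zero.1 hRu).resolve_right hu0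
  simp only [Polynomial.eval_pow, Polynomial.eval_sub, Polynomial.eval_X, Polynomial.eval_C] at h1
  have h2 := sub_eq_zero.1 (eq_zero_of_pow_eq_zero h1)
  exact (casVal_lt hμ hθ1 hθ2).ne' (by exact_mod_cast h2)

/-- The number of highest weight vectors is an alternating sum of weight multiplicities. -/
theorem finrank_hwSp [FiniteDimensional ℂ V] (hE : GLRel E) (hμ : Antitone μ) :
    (Module.finrank ℂ (hwSp E μ) : ℤ) = ∑ w : Equiv.Perm (Fin n), (Equiv.Perm.sign w : ℤ) *
      Module.finrank ℂ (wtSp E (fun i => μ i - (i : ℕ) + ((w i : ℕ) : ℤ))) := by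
  set c : ℂ := (casVal μ : ℂ) with hc
  have hm0 : (Polynomial.X - Polynomial.C c) * minpoly ℂ (casimir E) ≠ 0 :=
    mul_ne_zero (Polynomial.X_sub_C_ne_zero c) (minpoly.ne_zero (Algebra.IsIntegral.isIntegral _))
  obtain ⟨q, hq, hqc⟩ := Polynomial.exists_eq_pow_rootMultiplicity_mul_and_not_dvd _ hm0 c
  have hr0 : 0 < ((Polynomial.X - Polynomial.C c) * minpoly ℂ (casimir E)).rootMultiplicity c := by
    rw [Polynomial.rootMultiplicity_pos hm0]
    simp
  set r := ((Polynomial.X - Polynomial.C c) * minpoly ℂ (casimir E)).rootMultiplicity c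
  rw [Polynomial.dvd_iff_isRoot, Polynomial.IsRoot.def] at hqc
  let p : Polynomial ℂ := Polynomial.C (q.eval c)⁻¹ * q
  have hpc : p.eval c = 1 := by simp [p, hqc]
  set R := Polynomial.aeval (casimir E) ((Polynomial.X - Polynomial.C c) ^ r) with hR
  set Q := Polynomial.aeval (casimir E) p with hQ
  have hRQ : R * Q = 0 := by
    rw [hR, hQ, ← map_mul, mul_left_comm, ← hq]
    simp
  have hRQv : ∀ v, R (Q v) = 0 := fun v => by rw [← Module.End.mul_apply, hRQ]; rfl
  have hQcomm := aeval_casimir_comm hE p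
  have hdom : ∀ η, DomWt μ η → η ≠ μ → wtTr E Q η = 0 := by
    intro η hη hne
    have : Q * wtProj E η = 0 := by
      ext v
      exact casimir_ker_wtSp hE hμ r hη hne (mul_mem_wtSp hQcomm ((wtProj_isProj E η).map_mem v))
        (hRQv _)
    rw [wtTr, this, map_zero]
  have hproj : LinearMap.IsProj (hwSp E μ) (Q * wtProj E μ) := by
    constructor
    · intro v
      have hv := mul_mem_wtSp hQcomm ((wtProj_isProj E μ).map_mem v)
      refine mem_hwSp.2 ⟨mem_wtSp.1 hv, fun a b hab => ?_⟩
      refine casimir_ker_wtSp hE hμ r ((DomWt.refl μ).raise hab) ?_ (hE.raise hv) ?_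
      · intro he
        have := congrFun he a
        simp [hab.ne] at this
      · have := congrArg (fun f => f ((Q * wtProj E μ) v)) (aeval_casimir_comm hE
          ((Polynomial.X - Polynomial.C c) ^ r) a b).eq
        simp only [Module.End.mul_apply] at this
        simp only [Module.End.mul_apply]
        rw [this, ← hR, hRQv, map_zero]
    · intro v hv
      have h1 : wtProj E μ v = v := (wtProj_isProj E μ).map_id v (mem_wtSp.2 (mem_hwSp.1 hv).1)
      rw [Module.End.mul_apply, h1, hQ, aeval_apply_eigen _ _ (casimir_hw hv), hpc, one_smul]
  have h1 : ∀ η, wtTr E 1 η = Module.finrank ℂ (wtSp E η) := fun η => by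
    rw [wtTr, one_mul, (wtProj_isProj E η).trace]
  have h2 := altTr_aeval_casimir hE p μ
  rw [hpc, one_mul] at h2
  simp only [altTr, h1] at h2
  rw [Finset.sum_eq_single 1] at h2
  · have h3 : (fun i : Fin n => μ i - (i : ℕ) + (((1 : Equiv.Perm (Fin n)) i : ℕ) : ℤ)) = μ := by
      ext i
      simp
    rw [h3, wtTr, ← hQ, hproj.trace] at h2
    simp only [Equiv.Perm.sign_one, Units.val_one, Int.cast_one, one_mul] at h2
    exact_mod_cast h2
  · intro w _ hw
    rw [hdom _ (domWt_perm μ w), mul_zero]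
    intro he
    refine hw (Equiv.ext fun i => Fin.ext ?_)
    have := congrFun he i
    simp only [Equiv.Perm.coe_one, id_eq]
    omega
  · simp

end HighestWeightCount
end

noncomputable section

section Density
variable {Γ : Type*} [Group Γ] {V : Type*} [AddCommGroup V] [Module ℂ V]

/-- Every finite set can be translated into `Ω`. -/
def IsTransDense (Ω : Set Γ) : Prop := ∀ s : Finset Γ, ∃ y, ∀ g ∈ s, g * y ∈ Ω

/-- A matrix coefficient vanishing on `Ω` vanishes identically. -/
lemma IsTransDense.eq_zero [FiniteDimensional ℂ V] {Ω : Set Γ} (hΩ : IsTransDense Ω)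
    (ρ : Representation ℂ Γ V) (ζ : V →ₗ[ℂ] ℂ) (x : V) (h : ∀ g ∈ Ω, ζ (ρ g x) = 0) (g : Γ) :
    ζ (ρ g x) = 0 := by
  classical
  obtain ⟨s', hs', hs⟩ := (Submodule.fg_span_iff_fg_span_finset_subset (R := ℂ)
    (Set.range (ρ : Γ → Module.End ℂ V))).1 (IsNoetherian.noetherian _)
  have hch : ∀ a ∈ s', ∃ g, ρ g = a := fun a ha => hs' ha
  choose! r hr using hch
  obtain ⟨y, hy⟩ := hΩ (s'.image r)
  have key : ∀ a ∈ Submodule.span ℂ (Set.range (ρ : Γ → Module.End ℂ V)), ζ (a (ρ y x)) = 0 := by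
    intro a ha
    rw [hs] at ha
    induction ha using Submodule.span_induction with
    | mem a ha =>
      have := h _ (hy _ (Finset.mem_image_of_mem r ha))
      rw [map_mul, hr a ha] at this
      exact this
    | zero => simp
    | add a b _ _ ha hb => simp [ha, hb]
    | smul c a _ ha => simp [ha]
  have := key (ρ (g * y⁻¹)) (Submodule.subset_span ⟨_, rfl⟩)
  rwa [← Module.End.mul_apply, ← map_mul, inv_mul_cancel_right] at this

lemma IsTransDense.prod {Γ' : Type*} [Group Γ'] {Ω : Set Γ} {Ω' : Set Γ'} (h : IsTransDense Ω)
    (h' : IsTransDense Ω') : IsTransDense (Ω ×ˢ Ω') := by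
  classical
  intro s
  obtain ⟨y, hy⟩ := h (s.image Prod.fst)
  obtain ⟨y', hy'⟩ := h' (s.image Prod.snd)
  exact ⟨(y, y'), fun g hg => ⟨hy _ (Finset.mem_image_of_mem _ hg),
    hy' _ (Finset.mem_image_of_mem _ hg)⟩⟩

/-- The span of an orbit. -/
def orbSpan (ρ : Representation ℂ Γ V) (v : V) : Submodule ℂ V :=
  Submodule.span ℂ (Set.range fun g => ρ g v)

lemma orbSpan_subrep (ρ : Representation ℂ Γ V) (v : V) : IsSubrep ρ (orbSpan ρ v) := by
  intro g x hx
  induction hx using Submodule.span_induction with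
  | mem a ha =>
    obtain ⟨h, rfl⟩ := ha
    refine Submodule.subset_span ⟨g * h, ?_⟩
    simp
  | zero => simp
  | add a b _ _ ha hb => rw [map_add]; exact add_mem ha hb
  | smul c a _ ha => rw [map_smul]; exact Submodule.smul_mem _ _ ha

lemma mem_orbSpan (ρ : Representation ℂ Γ V) (v : V) (g : Γ) : ρ g v ∈ orbSpan ρ v :=
  Submodule.subset_span ⟨g, rfl⟩

lemma mem_orbSpan_self (ρ : Representation ℂ Γ V) (v : V) : v ∈ orbSpan ρ v := by
  simpa using mem_orbSpan ρ v 1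

lemma IsIrreducibleRep.orbSpan_eq_top {ρ : Representation ℂ Γ V} (h : IsIrreducibleRep ρ) {v : V}
    (hv : v ≠ 0) : orbSpan ρ v = ⊤ :=
  (h.2 _ (orbSpan_subrep ρ v)).resolve_left fun h0 => hv (by
    simpa [h0] using mem_orbSpan_self ρ v)

/-- Matching matrix coefficients give an equivariant map. -/
lemma exists_equivariant {W : Type*} [AddCommGroup W] [Module ℂ W] (ρ : Representation ℂ Γ V)
    (σ : Representation ℂ Γ W) {v : V} {w : W} (ξ : V →ₗ[ℂ] ℂ) (η : W →ₗ[ℂ] ℂ)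
    (hv : orbSpan ρ v = ⊤) (h : ∀ g, ξ (ρ g v) = η (σ g w))
    (hη : ∀ y ∈ orbSpan σ w, (∀ g, η (σ g y) = 0) → y = 0) :
    ∃ f ∈ equivariantMaps ρ σ, f v = w := by
  set a := Finsupp.linearCombination ℂ (fun g => ρ g v) with ha
  set b := Finsupp.linearCombination ℂ (fun g => σ g w) with hb
  have hsurj : Function.Surjective a := by
    rw [← LinearMap.range_eq_top, ha, Finsupp.range_linearCombination]
    exact hv
  have h1 : ∀ g x, ξ (ρ g (a x)) = η (σ g (b x)) := by
    intro g x
    induction x using Finsupp.induction_linear with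
    | zero => simp
    | add x y hx hy => simp [hx, hy]
    | single k c =>
      have := h (g * k)
      simp only [map_mul, Module.End.mul_apply] at this
      simp [ha, hb, this]
  have h2 : LinearMap.ker a ≤ LinearMap.ker b := by
    intro x hx
    rw [LinearMap.mem_ker] at hx ⊢
    refine hη _ ?_ fun g => ?_
    · rw [orbSpan, ← Finsupp.range_linearCombination]
      exact ⟨x, rfl⟩
    · rw [← h1, hx]
      simp
  obtain ⟨f, hf⟩ : ∃ f : V →ₗ[ℂ] W, ∀ x, f (a x) = b x := by
    refine ⟨(LinearMap.ker a).liftQ b h2 ∘ₗ (a.quotKerEquivOfSurjective hsurj).symm.toLinearMap,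
      fun x => ?_⟩
    have : (a.quotKerEquivOfSurjective hsurj).symm (a x) = Submodule.Quotient.mk x := by
      rw [LinearEquiv.symm_apply_eq]
      rfl
    simp [this]
  have hg : ∀ g, f (ρ g v) = σ g w := fun g => by
    simpa [ha, hb] using hf (Finsupp.single g 1)
  refine ⟨f, fun g => ?_, by simpa using hg 1⟩
  refine LinearMap.ext_on_range (v := fun k => ρ k v) hv fun k => ?_
  have := hg (g * k)
  simp only [map_mul, Module.End.mul_apply] at this
  simp [this, hg]

end Density
end

noncomputable section

section BigCell
variable {N : ℕ}

/-- Elements with an `LDU` decomposition. -/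
def bigCell (N : ℕ) : Set (GL (Fin N) ℂ) :=
  {g | ∃ l b : GL (Fin N) ℂ, IsUpperUni (l : Matrix (Fin N) (Fin N) ℂ)ᵀ ∧
    (b : Matrix (Fin N) (Fin N) ℂ).BlockTriangular id ∧ l * g = b}

lemma blockTriangular_diag_ne_zero {b : GL (Fin N) ℂ}
    (hb : (b : Matrix (Fin N) (Fin N) ℂ).BlockTriangular id) (i : Fin N) :
    (b : Matrix (Fin N) (Fin N) ℂ) i i ≠ 0 := by
  have h1 : (b : Matrix (Fin N) (Fin N) ℂ).det ≠ 0 :=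
    ((Matrix.isUnit_iff_isUnit_det _).1 b.isUnit).ne_zero
  rw [det_of_isUpperTriangular hb] at h1
  exact Finset.prod_ne_zero_iff.1 h1 i (Finset.mem_univ i)

lemma mem_bigCell_of_minors {g : GL (Fin N) ℂ}
    (hg : ∀ i : Fin N, (Matrix.of fun r j : {r : Fin N // r < i} =>
      (g : Matrix (Fin N) (Fin N) ℂ) r j).det ≠ 0) : g ∈ bigCell N := by
  have h1 : ∀ i : Fin N, ∃ c : {r : Fin N // r < i} → ℂ, ∀ j : {r : Fin N // r < i},
      ∑ r, c r * (g : Matrix (Fin N) (Fin N) ℂ) r j = - (g : Matrix (Fin N) (Fin N) ℂ) i j := by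
    intro i
    set M := Matrix.of fun r j : {r : Fin N // r < i} => (g : Matrix (Fin N) (Fin N) ℂ) r j
    refine ⟨(fun j : {r : Fin N // r < i} => - (g : Matrix (Fin N) (Fin N) ℂ) i j) ᵥ* M⁻¹,
      fun j => ?_⟩
    have := Matrix.vecMul_vecMul (fun j : {r : Fin N // r < i} =>
      - (g : Matrix (Fin N) (Fin N) ℂ) i j) M⁻¹ M
    rw [Matrix.nonsing_inv_mul _ (hg i).isUnit, Matrix.vecMul_one] at this
    exact congrFun this j
  choose c hc using h1
  set l : Matrix (Fin N) (Fin N) ℂ := Matrix.of fun i r =>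
    if h : r < i then c i ⟨r, h⟩ else if r = i then 1 else 0 with hl
  have hlu : IsUpperUni lᵀ := by
    refine ⟨fun i => by simp [hl], fun i j hij => ?_⟩
    have h1 : ¬ i < j := not_lt.2 (le_of_lt hij)
    have h2 : i ≠ j := fun h => by subst h; exact lt_irrefl _ hij
    simp [hl, h1, h2]
  have hdet : l.det = 1 := by
    rw [← det_transpose, det_of_isUpperTriangular (M := lᵀ) fun i j hij => hlu.2 i j hij]
    exact Finset.prod_eq_one fun i _ => hlu.1 i
  set L : GL (Fin N) ℂ := GeneralLinearGroup.mkOfDetNeZero l (by rw [hdet]; exact one_ne_zero)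
    with hL
  refine ⟨L, L * g, hlu, fun i j hij => ?_, rfl⟩
  have hij' : j < i := hij
  change (l * (g : Matrix (Fin N) (Fin N) ℂ)) i j = 0
  rw [Matrix.mul_apply]
  have h3 : ∀ r, l i r * (g : Matrix (Fin N) (Fin N) ℂ) r j
      = (if h : r < i then c i ⟨r, h⟩ * (g : Matrix (Fin N) (Fin N) ℂ) r j else 0)
        + if r = i then (g : Matrix (Fin N) (Fin N) ℂ) i j else 0 := by
    intro r
    simp only [hl, Matrix.of_apply]
    by_cases h : r < i
    · simp [h, h.ne]
    · by_cases h' : r = i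
      · simp [h']
      · simp [h, h']
  simp only [h3, Finset.sum_add_distrib, Finset.sum_ite_eq', Finset.mem_univ, if_true]
  have h4 := hc i ⟨j, hij'⟩
  have h5 : ∑ r : Fin N, (if h : r < i then c i ⟨r, h⟩ * (g : Matrix (Fin N) (Fin N) ℂ) r j else 0)
      = ∑ r : {r : Fin N // r < i}, c i r * (g : Matrix (Fin N) (Fin N) ℂ) r j := by
    rw [Finset.sum_dite, Finset.sum_const_zero, add_zero]
    refine Finset.sum_bij (fun r _ => ⟨r.1, (Finset.mem_filter.1 r.2).2⟩) (by simp) ?_ ?_ ?_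
    · intro a _ b _ h
      exact Subtype.ext (by simpa using h)
    · intro b _
      exact ⟨⟨b.1, by simpa using b.2⟩, by simp, rfl⟩
    · intro a _
      rfl
  rw [h5, h4]
  simp

lemma isTransDense_bigCell : IsTransDense (bigCell N) := by
  classical
  intro s
  set P : GL (Fin N) ℂ → Fin N → MvPolynomial (Fin N × Fin N) ℂ := fun g i =>
    (Matrix.of fun r j : {r : Fin N // r < i} => ∑ k, MvPolynomial.C
      ((g : Matrix (Fin N) (Fin N) ℂ) r k) * MvPolynomial.X (k, (j : Fin N))).det with hP
  set D : MvPolynomial (Fin N × Fin N) ℂ :=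
    (Matrix.of fun r j : Fin N => MvPolynomial.X (r, j)).det with hD
  have hev : ∀ (y : Fin N × Fin N → ℂ) g i, MvPolynomial.eval y (P g i)
      = (Matrix.of fun r j : {r : Fin N // r < i} =>
        ((g : Matrix (Fin N) (Fin N) ℂ) * Matrix.of fun a b => y (a, b)) r j).det := by
    intro y g i
    rw [hP, RingHom.map_det]
    congr 1
    ext r j
    simp [Matrix.mul_apply]
  have hevD : ∀ (y : Fin N × Fin N → ℂ), MvPolynomial.eval y D
      = (Matrix.of fun a b => y (a, b)).det := by
    intro y
    rw [hD, RingHom.map_det]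
    congr 1
    ext r j
    simp
  have hP0 : ∀ g i, P g i ≠ 0 := by
    intro g i h0
    have := hev (fun ab => ((g⁻¹ : GL (Fin N) ℂ) : Matrix (Fin N) (Fin N) ℂ) ab.1 ab.2) g i
    rw [h0, map_zero] at this
    have h2 : (Matrix.of fun a b => ((g⁻¹ : GL (Fin N) ℂ) : Matrix (Fin N) (Fin N) ℂ) a b)
        = ((g⁻¹ : GL (Fin N) ℂ) : Matrix (Fin N) (Fin N) ℂ) := rfl
    rw [h2, ← Units.val_mul, mul_inv_cancel, Units.val_one] at this
    have h3 : (Matrix.of fun r j : {r : Fin N // r < i} =>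
        (1 : Matrix (Fin N) (Fin N) ℂ) r j) = 1 := by
      ext a b
      simp [Matrix.one_apply, Subtype.ext_iff]
    rw [h3, det_one] at this
    exact zero_ne_one this
  have hD0 : D ≠ 0 := by
    intro h0
    have := hevD (fun ab => (1 : Matrix (Fin N) (Fin N) ℂ) ab.1 ab.2)
    rw [h0, map_zero] at this
    have h2 : (Matrix.of fun a b => (1 : Matrix (Fin N) (Fin N) ℂ) a b) = 1 := rfl
    rw [h2, det_one] at this
    exact zero_ne_one this
  have hQ : D * ∏ g ∈ s, ∏ i, P g i ≠ 0 := mul_ne_zero hD0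
    (Finset.prod_ne_zero_iff.2 fun g _ => Finset.prod_ne_zero_iff.2 fun i _ => hP0 g i)
  obtain ⟨y, hy⟩ : ∃ y, MvPolynomial.eval y (D * ∏ g ∈ s, ∏ i, P g i) ≠ 0 := by
    by_contra! h
    exact hQ (MvPolynomial.funext fun y => by rw [h, map_zero])
  rw [map_mul, map_prod] at hy
  refine ⟨GeneralLinearGroup.mkOfDetNeZero (Matrix.of fun a b => y (a, b))
    (by rw [← hevD]; exact left_ne_zero_of_mul hy), fun g hg => mem_bigCell_of_minors fun i => ?_⟩
  have h1 := Finset.prod_ne_zero_iff.1 (right_ne_zero_of_mul hy) g hg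
  rw [map_prod] at h1
  have h2 := Finset.prod_ne_zero_iff.1 h1 i (Finset.mem_univ i)
  rw [hev] at h2
  exact h2

variable {V : Type*} [AddCommGroup V] [Module ℂ V]

/-- Vectors fixed by the upper unipotent matrices on which the torus acts by `a`. -/
def IsHWVec (ρ : Representation ℂ (GL (Fin N) ℂ) V) (a : Fin N → ℤ) (v : V) : Prop :=
  (∀ g : GL (Fin N) ℂ, IsUpperUni (g : Matrix (Fin N) (Fin N) ℂ) → ρ g v = v) ∧
  (∀ (g : GL (Fin N) ℂ) (d : Fin N → ℂ),
      (g : Matrix (Fin N) (Fin N) ℂ) = Matrix.diagonal d → ρ g v = (∏ i, d i ^ (a i)) • v)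

lemma IsHWVec.borel {ρ : Representation ℂ (GL (Fin N) ℂ) V} {a : Fin N → ℤ} {v : V}
    (h : IsHWVec ρ a v) {b : GL (Fin N) ℂ}
    (hb : (b : Matrix (Fin N) (Fin N) ℂ).BlockTriangular id) :
    ρ b v = (∏ i, (b : Matrix (Fin N) (Fin N) ℂ) i i ^ (a i)) • v := by
  set d := fun i => (b : Matrix (Fin N) (Fin N) ℂ) i i with hd
  have hd0 : ∀ i, d i ≠ 0 := blockTriangular_diag_ne_zero hb
  set t : GL (Fin N) ℂ := GeneralLinearGroup.mkOfDetNeZero (Matrix.diagonal d) (by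
    rw [det_diagonal]; exact Finset.prod_ne_zero_iff.2 fun i _ => hd0 i) with ht
  have htv : (t : Matrix (Fin N) (Fin N) ℂ) = Matrix.diagonal d := rfl
  have hti : ((t⁻¹ : GL (Fin N) ℂ) : Matrix (Fin N) (Fin N) ℂ)
      = Matrix.diagonal fun i => (d i)⁻¹ := by
    have h1 : (t : Matrix (Fin N) (Fin N) ℂ) * (Matrix.diagonal fun i => (d i)⁻¹) = 1 := by
      rw [htv, diagonal_mul_diagonal, ← diagonal_one]
      congr 1
      ext i
      exact mul_inv_cancel₀ (hd0 i)
    calc ((t⁻¹ : GL (Fin N) ℂ) : Matrix (Fin N) (Fin N) ℂ)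
        = ((t⁻¹ : GL (Fin N) ℂ) : Matrix (Fin N) (Fin N) ℂ)
          * ((t : Matrix (Fin N) (Fin N) ℂ) * (Matrix.diagonal fun i => (d i)⁻¹)) := by
            rw [h1, mul_one]
      _ = _ := by
        rw [← mul_assoc, ← Units.val_mul, inv_mul_cancel, Units.val_one, one_mul]
  have hu : IsUpperUni ((t⁻¹ * b : GL (Fin N) ℂ) : Matrix (Fin N) (Fin N) ℂ) := by
    rw [Units.val_mul, hti]
    refine ⟨fun i => ?_, fun i j hij => ?_⟩
    · rw [diagonal_mul]
      exact inv_mul_cancel₀ (hd0 i)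
    · rw [diagonal_mul, hb (show id j < id i from hij), mul_zero]
  have h2 : b = t * (t⁻¹ * b) := by simp
  rw [h2, map_mul, Module.End.mul_apply, h.1 _ hu, h.2 t d htv, ← h2]

end BigCell
end

noncomputable section

section UnipotentFixed
variable {V : Type*} [AddCommGroup V] [Module ℂ V] [FiniteDimensional ℂ V]

/-- An invertible operator conjugate to all its positive powers is unipotent. -/
lemma eigenvalue_eq_one {T : Module.End ℂ V} (hT : IsUnit T)
    (h : ∀ m : ℕ, 0 < m → ∃ P Q : Module.End ℂ V, Q * P = 1 ∧ P * Q = 1 ∧ P * T * Q = T ^ m)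
    {z : ℂ} (hz : z ∈ spectrum ℂ T) : z = 1 := by
  have hsp : ∀ m : ℕ, 0 < m → spectrum ℂ (T ^ m) = spectrum ℂ T := by
    intro m hm
    obtain ⟨P, Q, h1, h2, h3⟩ := h m hm
    rw [← h3]
    exact spectrum.units_conjugate (a := T) (u := ⟨P, Q, h2, h1⟩)
  have hpow : ∀ m : ℕ, 0 < m → ∀ x ∈ spectrum ℂ T, x ^ m ∈ spectrum ℂ T := by
    intro m hm x hx
    rw [← hsp m hm]
    exact spectrum.pow_mem_pow T m hx
  have hfin : (spectrum ℂ T).Finite := Module.End.finite_spectrum T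
  have hroot : ∀ x ∈ spectrum ℂ T, ∃ k : ℕ, 0 < k ∧ x ^ k = 1 := by
    intro x hx
    have hx0 : x ≠ 0 := by
      rintro rfl
      exact spectrum.zero_notMem ℂ hT hx
    obtain ⟨a, -, b, -, hab, he⟩ := Set.infinite_univ.exists_ne_map_eq_of_mapsTo
      (f := fun k : ℕ => x ^ (k + 1)) (t := spectrum ℂ T) (fun k _ => hpow _ k.succ_pos x hx) hfin
    wlog hlt : a < b generalizing a b
    · exact this b a hab.symm he.symm (lt_of_le_of_ne (not_lt.1 hlt) hab.symm)
    refine ⟨b - a, Nat.sub_pos_of_lt hlt, ?_⟩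
    have h1 : x ^ (b + 1) = x ^ (a + 1) * x ^ (b - a) := by
      rw [← pow_add]
      congr 1
      omega
    have h2 : x ^ (a + 1) = x ^ (b + 1) := he
    rw [h1] at h2
    exact (mul_right_eq_self₀.1 h2.symm).resolve_right (pow_ne_zero _ hx0)
  have hall : ∃ K : ℕ, 0 < K ∧ ∀ x ∈ spectrum ℂ T, x ^ K = 1 := by
    choose! k hk using hroot
    refine ⟨∏ x ∈ hfin.toFinset, k x, Finset.prod_pos fun x hx => (hk x (by simpa using hx)).1,
      fun x hx => ?_⟩
    obtain ⟨c, hc⟩ := Finset.dvd_prod_of_mem k (hfin.mem_toFinset.2 hx)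
    rw [hc, pow_mul, (hk x hx).2, one_pow]
  obtain ⟨K, hK, h1⟩ := hall
  rw [← hsp K hK, spectrum.map_pow_of_pos T hK] at hz
  obtain ⟨x, hx, rfl⟩ := hz
  exact h1 x hx

/-- Commuting operators without eigenvalues other than `1` have a common fixed vector. -/
lemma exists_common_fixed {ι : Type*} (T : ι → Module.End ℂ V)
    (hc : ∀ i j, T i * T j = T j * T i) (h1 : ∀ i, ∀ z ∈ spectrum ℂ (T i), z = 1)
    {F : Submodule ℂ V} (hF : F ≠ ⊥) (hst : ∀ i, ∀ x ∈ F, T i x ∈ F) :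
    ∃ x ∈ F, x ≠ 0 ∧ ∀ i, T i x = x := by
  classical
  have hex : ∃ d, ∃ F' : Submodule ℂ V, F' ≤ F ∧ F' ≠ ⊥ ∧ (∀ i, ∀ x ∈ F', T i x ∈ F') ∧
    Module.finrank ℂ F' = d := ⟨_, F, le_rfl, hF, hst, rfl⟩
  obtain ⟨F', hle, hne, hst', hd⟩ := Nat.find_spec hex
  have hmin : ∀ F'' : Submodule ℂ V, F'' ≤ F' → F'' ≠ ⊥ → (∀ i, ∀ x ∈ F'', T i x ∈ F'') →
      F'' = F' := by
    intro F'' h2 h3 h4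
    refine Submodule.eq_of_le_of_finrank_le h2 ?_
    rw [hd]
    exact Nat.find_min' hex ⟨F'', h2.trans hle, h3, h4, rfl⟩
  have hfix : ∀ i, ∀ x ∈ F', T i x = x := by
    intro i
    have : Nontrivial F' := Submodule.nontrivial_iff_ne_bot.2 hne
    obtain ⟨z, hz⟩ := Module.End.exists_eigenvalue ((T i).restrict (hst' i))
    obtain ⟨y, hy⟩ := hz.exists_hasEigenvector
    have hy1 : T i (y : V) = z • (y : V) := by
      simpa using congrArg Subtype.val hy.apply_eq_smul
    have hy0 : (y : V) ≠ 0 := fun h => hy.2 (Subtype.ext h)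
    have hz1 : z = 1 := h1 i z (Module.End.hasEigenvalue_of_hasEigenvector
      (Module.End.hasEigenvector_iff.2 ⟨Module.End.mem_eigenspace_iff.2 hy1, hy0⟩)).mem_spectrum
    have := hmin (F' ⊓ LinearMap.ker (T i - 1)) inf_le_left ?_ ?_
    · intro x hx
      rw [← this] at hx
      have := hx.2
      rwa [SetLike.mem_coe, LinearMap.mem_ker, LinearMap.sub_apply, sub_eq_zero] at this
    · intro h
      apply hy0
      rw [← Submodule.mem_bot ℂ, ← h]
      refine ⟨y.2, ?_⟩
      rw [SetLike.mem_coe, LinearMap.mem_ker, LinearMap.sub_apply, hy1, hz1]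
      simp
    · rintro j x ⟨hx, hx'⟩
      refine ⟨hst' j x hx, ?_⟩
      rw [SetLike.mem_coe, LinearMap.mem_ker, LinearMap.sub_apply, sub_eq_zero] at hx' ⊢
      have := congrArg (fun f => f x) (hc i j)
      simp only [Module.End.mul_apply] at this
      rw [this, hx']
      rfl
  obtain ⟨x, hx, hx0⟩ := (Submodule.ne_bot_iff _).1 hne
  exact ⟨x, hle hx, hx0, fun i => hfix i x hx⟩

end UnipotentFixed
end

noncomputable section

section LowerFixed
variable {N : ℕ}

/-- Lower unipotent matrices which agree with the identity from column `c` on. -/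
def LowCol (c : ℕ) (l : Matrix (Fin N) (Fin N) ℂ) : Prop :=
  (∀ i, l i i = 1) ∧ (∀ i j : Fin N, i < j → l i j = 0) ∧
    ∀ i j : Fin N, c ≤ (j : ℕ) → i ≠ j → l i j = 0

/-- The strictly lower triangular matrix supported in column `c` with entries from `s`. -/
def colMat (c : Fin N) (s : Fin N → ℂ) : Matrix (Fin N) (Fin N) ℂ :=
  Matrix.of fun i j => if j = c ∧ c < i then s i else 0

lemma mul_colMat {c : Fin N} {h : Matrix (Fin N) (Fin N) ℂ} (h1 : ∀ i, h i i = 1)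
    (h2 : ∀ i j : Fin N, c < j → i ≠ j → h i j = 0) (s : Fin N → ℂ) :
    h * colMat c s = colMat c s := by
  ext i j
  rw [Matrix.mul_apply, Finset.sum_eq_single i]
  · rw [h1, one_mul]
  · intro k _ hk
    by_cases hc : c < k
    · rw [h2 i k hc hk.symm, zero_mul]
    · simp [colMat, hc]
  · simp

lemma colMat_mul_colMat (c : Fin N) (s t : Fin N → ℂ) : colMat c s * colMat c t = 0 := by
  ext i j
  rw [Matrix.mul_apply]
  refine Finset.sum_eq_zero fun k _ => ?_
  by_cases hk : k = c
  · subst hk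
    simp [colMat]
  · simp [colMat, hk]

lemma colMat_mul (c : Fin N) (s : Fin N → ℂ) (h : Matrix (Fin N) (Fin N) ℂ) (i j : Fin N) :
    (colMat c s * h) i j = if c < i then s i * h c j else 0 := by
  rw [Matrix.mul_apply, Finset.sum_eq_single c]
  · by_cases hi : c < i <;> simp [colMat, hi]
  · intro k _ hk
    simp [colMat, hk]
  · simp

lemma colMat_add (c : Fin N) (s t : Fin N → ℂ) : colMat c (s + t) = colMat c s + colMat c t := by
  ext i j
  by_cases h : j = c ∧ c < i <;> simp [colMat, h]

lemma colMat_zero (c : Fin N) : colMat c 0 = 0 := by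
  ext i j
  simp [colMat]

lemma one_add_colMat_mul (c : Fin N) (s t : Fin N → ℂ) :
    (1 + colMat c s) * (1 + colMat c t) = 1 + colMat c (s + t) := by
  rw [colMat_add, add_mul, mul_add, mul_add, colMat_mul_colMat]
  simp only [one_mul, mul_one, add_zero]
  abel

/-- The group element `1 + colMat c s`. -/
def colElt (c : Fin N) (s : Fin N → ℂ) : GL (Fin N) ℂ where
  val := 1 + colMat c s
  inv := 1 + colMat c (-s)
  val_inv := by rw [one_add_colMat_mul, add_neg_cancel, colMat_zero, add_zero]
  inv_val := by rw [one_add_colMat_mul, neg_add_cancel, colMat_zero, add_zero]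

lemma colElt_mul (c : Fin N) (s t : Fin N → ℂ) :
    colElt c s * colElt c t = colElt c (s + t) := Units.ext (one_add_colMat_mul c s t)

lemma colElt_pow (c : Fin N) (s : Fin N → ℂ) (m : ℕ) :
    colElt c s ^ m = colElt c (fun i => (m : ℂ) * s i) := by
  induction m with
  | zero =>
    refine Units.ext ?_
    have : (fun i => ((0 : ℕ) : ℂ) * s i) = 0 := by ext; simp
    rw [this]
    simp [colElt, colMat_zero]
  | succ m ih =>
    rw [pow_succ, ih, colElt_mul]
    congr 1
    ext i
    simp
    ring

variable {V : Type*} [AddCommGroup V] [Module ℂ V] [FiniteDimensional ℂ V]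

lemma colElt_eigenvalue (ρ : Representation ℂ (GL (Fin N) ℂ) V) (c : Fin N) (s : Fin N → ℂ)
    {z : ℂ} (hz : z ∈ spectrum ℂ (ρ (colElt c s))) : z = 1 := by
  refine eigenvalue_eq_one ((Group.isUnit _).map ρ) (fun m hm => ?_) hz
  have hm0 : (m : ℂ) ≠ 0 := Nat.cast_ne_zero.2 hm.ne'
  set D : GL (Fin N) ℂ := GeneralLinearGroup.mkOfDetNeZero
    (Matrix.diagonal fun i => if c < i then (m : ℂ) else 1) (by
      rw [det_diagonal]
      refine Finset.prod_ne_zero_iff.2 fun i _ => ?_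
      split_ifs
      exacts [hm0, one_ne_zero]) with hD
  have hDv : (D : Matrix (Fin N) (Fin N) ℂ)
      = Matrix.diagonal fun i => if c < i then (m : ℂ) else 1 := rfl
  have key : D * colElt c s = colElt c s ^ m * D := by
    refine Units.ext ?_
    rw [colElt_pow, Units.val_mul, Units.val_mul, hDv]
    change _ * (1 + colMat c s) = (1 + colMat c _) * _
    rw [mul_add, add_mul, mul_one, one_mul]
    congr 1
    ext i j
    rw [Matrix.diagonal_mul, Matrix.mul_diagonal]
    by_cases h : j = c ∧ c < i
    · simp [colMat, h]
    · simp [colMat, h]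
  refine ⟨ρ D, ρ D⁻¹, ?_, ?_, ?_⟩
  · rw [← map_mul, inv_mul_cancel, map_one]
  · rw [← map_mul, mul_inv_cancel, map_one]
  · rw [← map_mul, ← map_mul, key, mul_inv_cancel_right, map_pow]

/-- The vectors fixed by the matrices in `LowCol c`. -/
def lowFix (ρ : Representation ℂ (GL (Fin N) ℂ) V) (c : ℕ) : Submodule ℂ V :=
  ⨅ l : {l : GL (Fin N) ℂ // LowCol c (l : Matrix (Fin N) (Fin N) ℂ)}, LinearMap.ker (ρ l - 1)

lemma mem_lowFix {ρ : Representation ℂ (GL (Fin N) ℂ) V} {c : ℕ} {x : V} : x ∈ lowFix ρ c ↔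
    ∀ l : GL (Fin N) ℂ, LowCol c (l : Matrix (Fin N) (Fin N) ℂ) → ρ l x = x := by
  simp [lowFix, sub_eq_zero]

lemma lowFix_ne_bot [Nontrivial V] (ρ : Representation ℂ (GL (Fin N) ℂ) V) (c : ℕ) (hc : c ≤ N) :
    lowFix ρ c ≠ ⊥ := by
  induction c with
  | zero =>
    obtain ⟨x, hx⟩ := exists_ne (0 : V)
    refine (Submodule.ne_bot_iff _).2 ⟨x, mem_lowFix.2 fun l hl => ?_, hx⟩
    have : l = 1 := by
      refine Units.ext (Matrix.ext fun i j => ?_)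
      rw [Units.val_one]
      by_cases h : i = j
      · subst h
        rw [hl.1, one_apply_eq]
      · rw [hl.2.2 i j (Nat.zero_le _) h, one_apply_ne h]
    rw [this, map_one]
    rfl
  | succ c ih =>
    set C : Fin N := ⟨c, hc⟩ with hC
    obtain ⟨x, hx, hx0, hfix⟩ := exists_common_fixed (fun s => ρ (colElt C s))
      (fun s t => by rw [← map_mul, ← map_mul, colElt_mul, colElt_mul, add_comm])
      (fun s z hz => colElt_eigenvalue ρ C s hz) (ih (by omega)) (by
        intro s x hx
        rw [mem_lowFix] at hx ⊢
        intro h hh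
        have h1 : h * colElt C s = colElt C s * (colElt C (-s) * h * colElt C s) := by
          rw [← mul_assoc, ← mul_assoc, colElt_mul, add_neg_cancel]
          have : colElt C 0 = 1 := Units.ext (by simp [colElt, colMat_zero])
          rw [this, one_mul]
        rw [← Module.End.mul_apply, ← map_mul, h1, map_mul, Module.End.mul_apply, hx]
        have h2 : ((colElt C (-s) * h * colElt C s : GL (Fin N) ℂ) : Matrix (Fin N) (Fin N) ℂ)
            = h + colMat C s - colMat C s * h := by
          rw [Units.val_mul, Units.val_mul]
          change (1 + colMat C (-s)) * (h : Matrix (Fin N) (Fin N) ℂ) * (1 + colMat C s) = _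
          have h3 : colMat C (-s) = - colMat C s := by
            rw [eq_neg_iff_add_eq_zero, ← colMat_add, neg_add_cancel, colMat_zero]
          rw [mul_assoc, mul_add, mul_one, mul_colMat hh.1
            (fun i j hij => hh.2.2 i j (le_of_lt hij)), add_mul, one_mul, h3, neg_mul, mul_add,
            colMat_mul_colMat, add_zero]
          abel
        rw [h2]
        have hlow : ∀ i j : Fin N, i < j → C < i → (h : Matrix (Fin N) (Fin N) ℂ) C j = 0 :=
          fun i j hij hi => hh.2.1 C j (hi.trans hij)
        refine ⟨fun i => ?_, fun i j hij => ?_, fun i j hj hij => ?_⟩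
        · simp only [Matrix.sub_apply, Matrix.add_apply, colMat_mul, hh.1]
          by_cases hi : C < i
          · simp [hi, hh.2.1 C i hi, colMat, hi.ne']
          · simp [hi, colMat]
        · simp only [Matrix.sub_apply, Matrix.add_apply, colMat_mul, hh.2.1 i j hij]
          by_cases hi : C < i
          · simp [hi, hlow i j hij hi, colMat, (hi.trans hij).ne']
          · simp [hi, colMat]
        · simp only [Matrix.sub_apply, Matrix.add_apply, colMat_mul, hh.2.2 i j hj hij]
          by_cases hi : C < i
          · by_cases hjc : j = C
            · subst hjc
              simp [hi, colMat, hh.1]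
            · simp [hi, hh.2.2 C j hj (Ne.symm hjc), colMat, hjc]
          · simp [hi, colMat])
    refine (Submodule.ne_bot_iff _).2 ⟨x, mem_lowFix.2 fun l hl => ?_, hx0⟩
    set s : Fin N → ℂ := fun i => (l : Matrix (Fin N) (Fin N) ℂ) i C with hs
    have h1 : l = colElt C s * (colElt C (-s) * l) := by
      rw [← mul_assoc, colElt_mul, add_neg_cancel]
      have : colElt C 0 = 1 := Units.ext (by simp [colElt, colMat_zero])
      rw [this, one_mul]
    rw [h1, map_mul, Module.End.mul_apply, mem_lowFix.1 hx, hfix]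
    have h2 : ((colElt C (-s) * l : GL (Fin N) ℂ) : Matrix (Fin N) (Fin N) ℂ)
        = l + colMat C (-s) * l := by
      rw [Units.val_mul]
      change (1 + colMat C (-s)) * (l : Matrix (Fin N) (Fin N) ℂ) = _
      rw [add_mul, one_mul]
    rw [h2]
    refine ⟨fun i => ?_, fun i j hij => ?_, fun i j hj hij => ?_⟩
    · simp only [Matrix.add_apply, colMat_mul, hl.1]
      by_cases hi : C < i
      · simp [hl.2.1 C i hi]
      · simp [hi]
    · simp only [Matrix.add_apply, colMat_mul, hl.2.1 i j hij]
      by_cases hi : C < i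
      · simp [hl.2.1 C j (hi.trans hij)]
      · simp [hi]
    · simp only [Matrix.add_apply, colMat_mul]
      by_cases hjc : j = C
      · subst hjc
        by_cases hi : C < i
        · simp [hi, hl.1, hs]
        · have : i < C := lt_of_le_of_ne (not_lt.1 hi) hij
          simp [hi, hl.2.1 i C this]
      · have hCj : C < j := lt_of_le_of_ne hj (Ne.symm hjc)
        simp [hl.2.2 i j hCj hij, hl.2.1 C j hCj]

/-- There is a nonzero functional fixed by the lower unipotent matrices. -/
lemma exists_lower_fixed_functional [Nontrivial V] (ρ : Representation ℂ (GL (Fin N) ℂ) V) :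
    ∃ ξ : V →ₗ[ℂ] ℂ, ξ ≠ 0 ∧ ∀ l : GL (Fin N) ℂ,
      IsUpperUni (l : Matrix (Fin N) (Fin N) ℂ)ᵀ → ∀ x, ξ (ρ l x) = ξ x := by
  have hD : Nontrivial (Module.Dual ℂ V) := inferInstance
  obtain ⟨ξ, hξ, h0⟩ := (Submodule.ne_bot_iff _).1 (lowFix_ne_bot (V := Module.Dual ℂ V)
    (Representation.dual ρ) N le_rfl)
  refine ⟨ξ, h0, fun l hl x => ?_⟩
  have h1 := mem_lowFix.1 hξ l ⟨fun i => hl.1 i, fun i j hij => hl.2 j i hij, fun i j hj =>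
    absurd j.2 (not_lt.2 hj)⟩
  have h2 := LinearMap.congr_fun h1 (ρ l x)
  rw [Representation.dual_apply] at h2
  simp only [Module.Dual.transpose_apply, LinearMap.comp_apply] at h2
  rw [← h2, ← Module.End.mul_apply, ← map_mul, inv_mul_cancel, map_one]
  rfl

end LowerFixed
end

noncomputable section

section StarReps
variable {Γ : Type*} [Group Γ] [StarMul Γ] {V W : Type*} [AddCommGroup V] [Module ℂ V]
  [AddCommGroup W] [Module ℂ W]

/-- The elements which a lower element moves into the Borel. -/
def cellOf (Lo Bo : Set Γ) : Set Γ := {g | ∃ l ∈ Lo, l * g ∈ Bo}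

/-- Anisotropic sesquilinear forms for which `σ (star g)` is adjoint to `σ g`. -/
def IsStarForm (σ : Representation ℂ Γ W) (B : W →ₗ⋆[ℂ] W →ₗ[ℂ] ℂ) : Prop :=
  (∀ x, B x x = 0 → x = 0) ∧ ∀ g x y, B (σ g x) y = B x (σ (star g) y)

lemma IsStarForm.eq_zero {σ : Representation ℂ Γ W} {B : W →ₗ⋆[ℂ] W →ₗ[ℂ] ℂ}
    (hB : IsStarForm σ B) {u y : W} (hy : y ∈ orbSpan σ u) (h : ∀ g, B u (σ g y) = 0) : y = 0 := by
  have key : ∀ z ∈ orbSpan σ u, B z y = 0 := by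
    intro z hz
    induction hz using Submodule.span_induction with
    | mem a ha =>
      obtain ⟨g, rfl⟩ := ha
      change B (σ g u) y = 0
      rw [hB.2, h]
    | zero => simp
    | add a b _ _ ha hb => simp [ha, hb]
    | smul c a _ ha => simp [ha]
  exact hB.1 y (key y hy)

/-- A lower fixed functional on a representation generated by a Borel eigenvector does not vanish
at that vector. -/
lemma lower_fixed_ne_zero [FiniteDimensional ℂ V] {Lo Bo : Set Γ} {χ : Γ → ℂ}
    (hd : IsTransDense (cellOf Lo Bo)) {ρ : Representation ℂ Γ V} {v : V}
    (hv : ∀ b ∈ Bo, ρ b v = χ b • v) (htop : orbSpan ρ v = ⊤) {ξ : V →ₗ[ℂ] ℂ} (h0 : ξ ≠ 0)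
    (hξ : ∀ l ∈ Lo, ∀ x, ξ (ρ l x) = ξ x) : ξ v ≠ 0 := by
  intro hz
  refine h0 (LinearMap.ext_on_range (v := fun k => ρ k v) htop fun g => ?_)
  refine (hd.eq_zero ρ ξ v ?_ g).trans (by simp)
  rintro g ⟨l, hl, hb⟩
  rw [← hξ l hl, ← Module.End.mul_apply, ← map_mul, hv _ hb, map_smul, hz, smul_zero]

lemma star_lower_form {Lo Bo : Set Γ} {χ : Γ → ℂ}
    (hstar : ∀ l ∈ Lo, star l ∈ Bo ∧ χ (star l) = 1) {σ : Representation ℂ Γ W}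
    {B : W →ₗ⋆[ℂ] W →ₗ[ℂ] ℂ} (hB : IsStarForm σ B) {w : W} (hw : ∀ b ∈ Bo, σ b w = χ b • w)
    {l : Γ} (hl : l ∈ Lo) (x : W) : B w (σ l x) = B w x := by
  have := hB.2 (star l) w x
  rw [star_star] at this
  rw [← this, hw _ (hstar l hl).1, (hstar l hl).2, one_smul]

lemma exists_equivariant_star [FiniteDimensional ℂ V] [FiniteDimensional ℂ W]
    {Lo Bo : Set Γ} {χ : Γ → ℂ} (hd : IsTransDense (cellOf Lo Bo))
    (hstar : ∀ l ∈ Lo, star l ∈ Bo ∧ χ (star l) = 1) {ρ : Representation ℂ Γ V} {v : V}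
    (hv : ∀ b ∈ Bo, ρ b v = χ b • v) (htop : orbSpan ρ v = ⊤) {ξ : V →ₗ[ℂ] ℂ} (hξv : ξ v ≠ 0)
    (hξ : ∀ l ∈ Lo, ∀ x, ξ (ρ l x) = ξ x) {σ : Representation ℂ Γ W}
    {B : W →ₗ⋆[ℂ] W →ₗ[ℂ] ℂ} (hB : IsStarForm σ B) {w : W} (hw : ∀ b ∈ Bo, σ b w = χ b • w) :
    ∃ f ∈ equivariantMaps ρ σ, f v = w := by
  by_cases hw0 : w = 0
  · exact ⟨0, Submodule.zero_mem _, by simp [hw0]⟩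
  have hww : B w w ≠ 0 := fun h => hw0 (hB.1 w h)
  refine exists_equivariant ρ σ ((ξ v)⁻¹ • ξ) ((B w w)⁻¹ • B w) htop (fun g => ?_)
    fun y hy h => hB.eq_zero hy fun g => ?_
  · have := hd.eq_zero (ρ.prod σ) (((ξ v)⁻¹ • ξ) ∘ₗ LinearMap.fst ℂ V W
      - ((B w w)⁻¹ • B w) ∘ₗ LinearMap.snd ℂ V W) (v, w) ?_ g
    · rw [← sub_eq_zero]
      exact this
    · rintro g ⟨l, hl, hb⟩
      have h1 : ξ (ρ g v) = χ (l * g) * ξ v := by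
        rw [← hξ l hl, ← Module.End.mul_apply, ← map_mul, hv _ hb, map_smul, smul_eq_mul]
      have h2 : B w (σ g w) = χ (l * g) * B w w := by
        rw [← star_lower_form hstar hB hw hl, ← Module.End.mul_apply, ← map_mul, hw _ hb,
          map_smul, smul_eq_mul]
      change (ξ v)⁻¹ * ξ (ρ g v) - (B w w)⁻¹ * B w (σ g w) = 0
      rw [h1, h2]
      field_simp
      simp
  · have := h g
    simpa [hww] using this

/-- The space of Borel eigenvectors with character `χ`. -/
def eigSp (σ : Representation ℂ Γ W) (Bo : Set Γ) (χ : Γ → ℂ) : Submodule ℂ W :=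
  ⨅ b : Bo, LinearMap.ker (σ b - χ b • 1)

lemma mem_eigSp {σ : Representation ℂ Γ W} {Bo : Set Γ} {χ : Γ → ℂ} {w : W} :
    w ∈ eigSp σ Bo χ ↔ ∀ b ∈ Bo, σ b w = χ b • w := by
  simp [eigSp, sub_eq_zero]

/-- Multiplicities are dimensions of spaces of Borel eigenvectors. -/
lemma repMult_eq_finrank_eigSp [FiniteDimensional ℂ V] [FiniteDimensional ℂ W]
    {Lo Bo : Set Γ} {χ : Γ → ℂ} (hd : IsTransDense (cellOf Lo Bo))
    (hstar : ∀ l ∈ Lo, star l ∈ Bo ∧ χ (star l) = 1) {ρ : Representation ℂ Γ V} {v : V}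
    (hv : ∀ b ∈ Bo, ρ b v = χ b • v) (htop : orbSpan ρ v = ⊤) {ξ : V →ₗ[ℂ] ℂ} (hξv : ξ v ≠ 0)
    (hξ : ∀ l ∈ Lo, ∀ x, ξ (ρ l x) = ξ x) {σ : Representation ℂ Γ W}
    {B : W →ₗ⋆[ℂ] W →ₗ[ℂ] ℂ} (hB : IsStarForm σ B) :
    repMult σ ρ = Module.finrank ℂ (eigSp σ Bo χ) := by
  set ev : equivariantMaps ρ σ →ₗ[ℂ] eigSp σ Bo χ :=
    { toFun := fun f => ⟨f.1 v, mem_eigSp.2 fun b hb => by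
        have := LinearMap.congr_fun (f.2 b) v
        simp only [LinearMap.comp_apply] at this
        rw [← this, hv b hb, map_smul]⟩
      map_add' := fun f g => rfl
      map_smul' := fun c f => rfl } with hev
  refine LinearEquiv.finrank_eq (LinearEquiv.ofBijective ev ⟨?_, ?_⟩)
  · refine (injective_iff_map_eq_zero ev).2 fun f hf => ?_
    have h0 : f.1 v = 0 := congrArg Subtype.val hf
    refine Subtype.ext (LinearMap.ext_on_range (v := fun k => ρ k v) htop fun g => ?_)
    have := LinearMap.congr_fun (f.2 g) v
    simp only [LinearMap.comp_apply] at this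
    rw [this, h0]
    simp
  · rintro ⟨w, hw⟩
    obtain ⟨f, hf, hfv⟩ := exists_equivariant_star hd hstar hv htop hξv hξ hB (mem_eigSp.1 hw)
    exact ⟨⟨f, hf⟩, Subtype.ext hfv⟩

end StarReps
end

noncomputable section

section GLStar
variable {N : ℕ}

/-- The lower unipotent group. -/
def loSet (N : ℕ) : Set (GL (Fin N) ℂ) := {l | IsUpperUni (l : Matrix (Fin N) (Fin N) ℂ)ᵀ}

/-- The upper triangular group. -/
def boSet (N : ℕ) : Set (GL (Fin N) ℂ) :=
  {b | (b : Matrix (Fin N) (Fin N) ℂ).BlockTriangular id}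

/-- The character of weight `a` of the upper triangular group. -/
def chi (a : Fin N → ℤ) (g : GL (Fin N) ℂ) : ℂ :=
  ∏ i, (g : Matrix (Fin N) (Fin N) ℂ) i i ^ a i

lemma isTransDense_cellOf : IsTransDense (cellOf (loSet N) (boSet N)) := by
  intro s
  obtain ⟨y, hy⟩ := isTransDense_bigCell s
  refine ⟨y, fun g hg => ?_⟩
  obtain ⟨l, b, hl, hb, he⟩ := hy g hg
  exact ⟨l, hl, by rw [he]; exact hb⟩

lemma star_loSet {l : GL (Fin N) ℂ} (hl : l ∈ loSet N) (a : Fin N → ℤ) :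
    star l ∈ boSet N ∧ chi a (star l) = 1 := by
  have h1 : ((star l : GL (Fin N) ℂ) : Matrix (Fin N) (Fin N) ℂ)
      = (l : Matrix (Fin N) (Fin N) ℂ)ᴴ := rfl
  refine ⟨fun i j hij => ?_, Finset.prod_eq_one fun i _ => ?_⟩
  · have := hl.2 i j hij
    rw [transpose_apply] at this
    rw [h1, conjTranspose_apply, this, star_zero]
  · have := hl.1 i
    rw [transpose_apply] at this
    rw [h1, conjTranspose_apply, this, star_one, _root_.one_zpow]

variable {V : Type*} [AddCommGroup V] [Module ℂ V]

lemma mem_eigSp_chi {ρ : Representation ℂ (GL (Fin N) ℂ) V} {a : Fin N → ℤ} {v : V} :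
    v ∈ eigSp ρ (boSet N) (chi a) ↔ IsHWVec ρ a v := by
  refine ⟨fun h => ⟨fun g hg => ?_, fun g d hg => ?_⟩, fun h => mem_eigSp.2 fun b hb => h.borel hb⟩
  · rw [mem_eigSp.1 h g fun i j hij => hg.2 i j hij, chi, Finset.prod_eq_one, one_smul]
    intro i _
    rw [hg.1, _root_.one_zpow]
  · rw [mem_eigSp.1 h g (by
      change (g : Matrix (Fin N) (Fin N) ℂ).BlockTriangular id
      rw [hg]; exact blockTriangular_diagonal d), chi, hg]
    simp

lemma IsGLHW.exists_data {a : Fin N → ℤ} {ρ : Representation ℂ (GL (Fin N) ℂ) V}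
    (h : IsGLHW N a ρ) : ∃ (v : V) (ξ : V →ₗ[ℂ] ℂ), (∀ b ∈ boSet N, ρ b v = chi a b • v) ∧
      orbSpan ρ v = ⊤ ∧ ξ v ≠ 0 ∧ ∀ l ∈ loSet N, ∀ x, ξ (ρ l x) = ξ x := by
  obtain ⟨hirr, hfd, v, hv0, hv⟩ := h
  have := hirr.1
  obtain ⟨ξ, hξ0, hξ⟩ := exists_lower_fixed_functional ρ
  have hv' : ∀ b ∈ boSet N, ρ b v = chi a b • v := mem_eigSp.1 (mem_eigSp_chi.2 hv)
  have htop := hirr.orbSpan_eq_top hv0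
  exact ⟨v, ξ, hv', htop, lower_fixed_ne_zero isTransDense_cellOf hv' htop hξ0 hξ, hξ⟩

/-- A highest weight vector orthogonal to a generating highest weight vector vanishes. -/
lemma IsStarForm.hw_eq_zero [FiniteDimensional ℂ V] {σ : Representation ℂ (GL (Fin N) ℂ) V}
    {B : V →ₗ⋆[ℂ] V →ₗ[ℂ] ℂ} (hB : IsStarForm σ B) {a b : Fin N → ℤ} {w y : V}
    (hw : IsHWVec σ a w) (htop : y ∈ orbSpan σ w) (hy : IsHWVec σ b y)
    (h : a = b → B y w = 0) : y = 0 := by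
  have h0 : B y w = 0 := by
    by_cases hab : a = b
    · exact h hab
    obtain ⟨i, hi⟩ := Function.ne_iff.1 hab
    set d : Fin N → ℂ := fun j => if j = i then 2 else 1 with hd
    set t : GL (Fin N) ℂ := GeneralLinearGroup.mkOfDetNeZero (Matrix.diagonal d) (by
      rw [det_diagonal]
      refine Finset.prod_ne_zero_iff.2 fun j _ => ?_
      simp only [hd]
      split_ifs <;> norm_num) with ht
    have hst : star t = t := by
      refine Units.ext ?_
      change (Matrix.diagonal d)ᴴ = Matrix.diagonal d
      rw [diagonal_conjTranspose]
      congr 1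
      ext j
      simp only [hd, Pi.star_apply]
      split_ifs <;> simp
    have h1 := hB.2 t y w
    have hp : ∀ c : Fin N → ℤ, ∏ j, d j ^ c j = (2 : ℂ) ^ c i := by
      intro c
      rw [Finset.prod_eq_single i]
      · simp [hd]
      · intro j _ hj
        simp [hd, hj]
      · simp
    rw [hst, hy.2 t d rfl, hw.2 t d rfl, hp, hp] at h1
    simp only [map_smulₛₗ, LinearMap.smul_apply, map_zpow₀, map_ofNat, smul_eq_mul
      ] at h1
    by_contra h2
    have h3 := mul_right_cancel₀ h2 h1
    have h4 : ((2 : ℝ) : ℂ) ^ b i = ((2 : ℝ) : ℂ) ^ a i := by simpa using h3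
    rw [← Complex.ofReal_zpow, ← Complex.ofReal_zpow] at h4
    exact hi (zpow_right_injective₀ (by norm_num) (by norm_num) (Complex.ofReal_injective h4)).symm
  have hy' := mem_eigSp.1 (mem_eigSp_chi.2 hy)
  have hw' := mem_eigSp.1 (mem_eigSp_chi.2 hw)
  have h1 : ∀ g, B y (σ g w) = 0 := by
    refine isTransDense_cellOf.eq_zero σ (B y) w ?_
    rintro g ⟨l, hl, hb⟩
    rw [← star_lower_form (fun l hl => star_loSet hl b) hB hy' hl, ← Module.End.mul_apply,
      ← map_mul, hw' _ hb, map_smul, h0, smul_zero]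
  refine hB.1 y ?_
  have : ∀ z ∈ orbSpan σ w, B y z = 0 := by
    intro z hz
    induction hz using Submodule.span_induction with
    | mem a ha =>
      obtain ⟨g, rfl⟩ := ha
      exact h1 g
    | zero => simp
    | add a b _ _ ha hb => simp [ha, hb]
    | smul c a _ ha => simp [ha]
  exact this y htop

variable {n m : ℕ}

lemma isTransDense_cellOf_prod :
    IsTransDense (cellOf (loSet n ×ˢ loSet m) (boSet n ×ˢ boSet m)) := by
  intro s
  obtain ⟨y, hy⟩ := (isTransDense_cellOf (N := n)).prod (isTransDense_cellOf (N := m)) s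
  refine ⟨y, fun g hg => ?_⟩
  obtain ⟨⟨l, hl, h⟩, ⟨l', hl', h'⟩⟩ := hy g hg
  exact ⟨(l, l'), ⟨hl, hl'⟩, ⟨h, h'⟩⟩

/-- The weight `(a, b)` character of `GL_n × GL_m`. -/
def chiProd (a : Fin n → ℤ) (b : Fin m → ℤ) (g : GL (Fin n) ℂ × GL (Fin m) ℂ) : ℂ :=
  chi a g.1 * chi b g.2

/-- The multiplicity of an irreducible representation of `GL_n × GL_m` in a representation with a
star form. -/
lemma repMult_tprod_eq {Vm Vn : Type*} [AddCommGroup Vm] [Module ℂ Vm] [AddCommGroup Vn]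
    [Module ℂ Vn] {a : Fin n → ℤ} {b : Fin m → ℤ} {ρm : Representation ℂ (GL (Fin n) ℂ) Vm}
    {ρn : Representation ℂ (GL (Fin m) ℂ) Vn} (hm : IsGLHW n a ρm) (hn : IsGLHW m b ρn)
    [FiniteDimensional ℂ V] {σ : Representation ℂ (GL (Fin n) ℂ × GL (Fin m) ℂ) V}
    {B : V →ₗ⋆[ℂ] V →ₗ[ℂ] ℂ} (hB : IsStarForm σ B) :
    repMult σ (Representation.tprod
          (ρm.comp (MonoidHom.fst (GL (Fin n) ℂ) (GL (Fin m) ℂ)))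
          (ρn.comp (MonoidHom.snd (GL (Fin n) ℂ) (GL (Fin m) ℂ))))
      = Module.finrank ℂ (eigSp σ (boSet n ×ˢ boSet m) (chiProd a b)) := by
  obtain ⟨v, ξ, hv, htop, hξv, hξ⟩ := hm.exists_data
  obtain ⟨v', ξ', hv', htop', hξv', hξ'⟩ := hn.exists_data
  have := hm.2.1
  have := hn.2.1
  refine repMult_eq_finrank_eigSp (V := Vm ⊗[ℂ] Vn) isTransDense_cellOf_prod
    (fun l hl => ⟨⟨(star_loSet hl.1 a).1, (star_loSet hl.2 b).1⟩, ?_⟩)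
    (v := v ⊗ₜ[ℂ] v') ?_ ?_ (ξ := LinearMap.mul' ℂ ℂ ∘ₗ TensorProduct.map ξ ξ') ?_ ?_ hB
  · change chi a (star l.1) * chi b (star l.2) = 1
    rw [(star_loSet hl.1 a).2, (star_loSet hl.2 b).2, one_mul]
  · intro g hg
    simp only [Representation.tprod_apply, TensorProduct.map_tmul, MonoidHom.comp_apply,
      MonoidHom.coe_fst, MonoidHom.coe_snd]
    rw [hv _ hg.1, hv' _ hg.2, TensorProduct.smul_tmul_smul]
    rfl
  · rw [eq_top_iff, ← TensorProduct.span_tmul_eq_top, Submodule.span_le]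
    rintro _ ⟨x, y, rfl⟩
    have hx : x ∈ orbSpan ρm v := by rw [htop]; trivial
    have hy : y ∈ orbSpan ρn v' := by rw [htop']; trivial
    induction hx using Submodule.span_induction with
    | mem x hx =>
      obtain ⟨g, rfl⟩ := hx
      induction hy using Submodule.span_induction with
      | mem y hy =>
        obtain ⟨h, rfl⟩ := hy
        exact Submodule.subset_span ⟨(g, h), by simp⟩
      | zero => simp
      | add c d _ _ hc hd => simpa [TensorProduct.tmul_add] using add_mem hc hd
      | smul c d _ hd => simpa using Submodule.smul_mem _ c hd
    | zero => simp
    | add c d _ _ hc hd => simpa [TensorProduct.add_tmul] using add_mem hc hd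
    | smul c d _ hd => simpa [TensorProduct.smul_tmul'] using Submodule.smul_mem _ c hd
  · simpa using ⟨hξv, hξv'⟩
  · rintro l hl x
    induction x using TensorProduct.induction_on with
    | zero => simp
    | tmul x y => simp [hξ _ hl.1, hξ' _ hl.2]
    | add x y hx hy => rw [map_add, map_add, hx, hy, map_add]

end GLStar
end

noncomputable section

section TensorModel
variable {N : ℕ} {P : Type*} [Fintype P] [DecidableEq P]

/-- The matrix of the tensor power of `g`. -/
def tensMat (P : Type*) [Fintype P] (g : Matrix (Fin N) (Fin N) ℂ) :
    Matrix (P → Fin N) (P → Fin N) ℂ := Matrix.of fun I J => ∏ x, g (I x) (J x)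

lemma tensMat_mul (g h : Matrix (Fin N) (Fin N) ℂ) :
    tensMat P (g * h) = tensMat P g * tensMat P h := by
  ext I J
  simp only [tensMat, Matrix.of_apply, Matrix.mul_apply, Finset.prod_univ_sum,
    Fintype.piFinset_univ, Finset.prod_mul_distrib]

lemma tensMat_one [DecidableEq (P → Fin N)] : tensMat P (1 : Matrix (Fin N) (Fin N) ℂ) = 1 := by
  ext I J
  simp only [tensMat, Matrix.of_apply, Matrix.one_apply]
  by_cases h : I = J
  · simp [h]
  · obtain ⟨x, hx⟩ := Function.ne_iff.1 h
    rw [if_neg h]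
    exact Finset.prod_eq_zero (Finset.mem_univ x) (if_neg hx)

lemma tensMat_conjTranspose (g : Matrix (Fin N) (Fin N) ℂ) :
    tensMat P gᴴ = (tensMat P g)ᴴ := by
  ext I J
  simp [tensMat, conjTranspose_apply]

/-- The tensor power representation. -/
def tensRep (N : ℕ) (P : Type*) [Fintype P] [DecidableEq P] :
    Representation ℂ (GL (Fin N) ℂ) ((P → Fin N) → ℂ) where
  toFun g := Matrix.toLin' (tensMat P (g : Matrix (Fin N) (Fin N) ℂ))
  map_one' := by rw [Units.val_one, tensMat_one, Matrix.toLin'_one]; rfl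
  map_mul' g h := by rw [Units.val_mul, tensMat_mul, Matrix.toLin'_mul]; rfl

lemma tensRep_apply (g : GL (Fin N) ℂ) (x : (P → Fin N) → ℂ) :
    tensRep N P g x = tensMat P (g : Matrix (Fin N) (Fin N) ℂ) *ᵥ x := rfl

/-- The standard sesquilinear form. -/
def stdForm (ι : Type*) [Fintype ι] : (ι → ℂ) →ₗ⋆[ℂ] (ι → ℂ) →ₗ[ℂ] ℂ :=
  LinearMap.mk₂'ₛₗ (starRingEnd ℂ) (RingHom.id ℂ) (fun x y => star x ⬝ᵥ y)
    (by intros; simp [add_dotProduct]) (by intros; simp)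
    (by intros; simp [dotProduct_add]) (by intros; simp)

lemma stdForm_apply {ι : Type*} [Fintype ι] (x y : ι → ℂ) : stdForm ι x y = star x ⬝ᵥ y := rfl

open scoped ComplexOrder in
lemma stdForm_isStarForm : IsStarForm (tensRep N P) (stdForm (P → Fin N)) := by
  refine ⟨fun x hx => dotProduct_star_self_eq_zero.1 hx, fun g x y => ?_⟩
  rw [stdForm_apply, stdForm_apply, tensRep_apply, tensRep_apply, star_mulVec,
    ← tensMat_conjTranspose, ← dotProduct_mulVec]
  rfl

/-- Twist by a power of the determinant. -/
def detTwist {V : Type*} [AddCommGroup V] [Module ℂ V] (σ : Representation ℂ (GL (Fin N) ℂ) V)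
    (k : ℤ) : Representation ℂ (GL (Fin N) ℂ) V where
  toFun g := ((g : Matrix (Fin N) (Fin N) ℂ).det ^ k) • σ g
  map_one' := by simp
  map_mul' g h := by
    rw [Units.val_mul, det_mul, mul_zpow, map_mul, smul_mul_smul_comm]

section Twist
variable {V : Type*} [AddCommGroup V] [Module ℂ V] {σ : Representation ℂ (GL (Fin N) ℂ) V} {k : ℤ}

lemma detTwist_apply (g : GL (Fin N) ℂ) (x : V) :
    detTwist σ k g x = ((g : Matrix (Fin N) (Fin N) ℂ).det ^ k) • σ g x := rfl

lemma IsStarForm.detTwist {B : V →ₗ⋆[ℂ] V →ₗ[ℂ] ℂ} (hB : IsStarForm σ B) :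
    IsStarForm (detTwist σ k) B := by
  refine ⟨hB.1, fun g x y => ?_⟩
  rw [detTwist_apply, detTwist_apply, map_smulₛₗ, LinearMap.smul_apply, hB.2, map_smul]
  congr 1
  change _ = ((g : Matrix (Fin N) (Fin N) ℂ)ᴴ).det ^ k
  rw [det_conjTranspose, map_zpow₀]
  rfl

lemma IsHWVec.detTwist {a : Fin N → ℤ} {v : V} (h : IsHWVec σ a v) :
    IsHWVec (detTwist σ k) (fun i => a i + k) v := by
  refine ⟨fun g hg => ?_, fun g d hg => ?_⟩
  · have hdet : (g : Matrix (Fin N) (Fin N) ℂ).det = 1 := by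
      rw [det_of_isUpperTriangular (M := (g : Matrix (Fin N) (Fin N) ℂ))
        fun i j hij => hg.2 i j hij]
      exact Finset.prod_eq_one fun i _ => hg.1 i
    rw [detTwist_apply, h.1 g hg, hdet, _root_.one_zpow, one_smul]
  · have hdet : (g : Matrix (Fin N) (Fin N) ℂ).det ≠ 0 :=
      ((Matrix.isUnit_iff_isUnit_det _).1 g.isUnit).ne_zero
    rw [hg, det_diagonal, Finset.prod_ne_zero_iff] at hdet
    rw [detTwist_apply, h.2 g d hg, hg, det_diagonal, smul_smul, ← Finset.prod_zpow,
      ← Finset.prod_mul_distrib]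
    congr 1
    refine Finset.prod_congr rfl fun i hi => ?_
    rw [zpow_add₀ (hdet i hi), mul_comm]

end Twist

section HighestWeightVector
variable {C : ℕ} {h : Fin C → ℕ} (hN : ∀ c, h c ≤ N)

/-- Products of minors of the first columns of `A`. -/
def minorVec (hN : ∀ c, h c ≤ N) (A : Matrix (Fin N) (Fin N) ℂ) :
    ((Σ c : Fin C, Fin (h c)) → Fin N) → ℂ := fun I =>
  ∏ c, (Matrix.of fun i j : Fin (h c) => A (I ⟨c, i⟩) (Fin.castLE (hN c) j)).det

lemma det_sum_expand {r : ℕ} (G : Fin r → Fin N → ℂ) (A : Fin N → Fin r → ℂ) :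
    (Matrix.of fun i j : Fin r => ∑ k, G i k * A k j).det
      = ∑ J : Fin r → Fin N, (∏ i, G i (J i)) * (Matrix.of fun i j : Fin r => A (J i) j).det := by
  have h1 : (Matrix.of fun i j : Fin r => ∑ k, G i k * A k j).det
      = (detRowAlternating (R := ℂ) (n := Fin r)).toMultilinearMap
        (fun i => ∑ k, G i k • A k) := by
    change det _ = det _
    congr 1
    ext i j
    simp
  rw [h1, MultilinearMap.map_sum]
  refine Finset.sum_congr rfl fun J _ => ?_
  rw [MultilinearMap.map_smul_univ]
  rfl

lemma tensMat_mulVec_minorVec (g A : Matrix (Fin N) (Fin N) ℂ) :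
    tensMat (Σ c : Fin C, Fin (h c)) g *ᵥ minorVec hN A = minorVec hN (g * A) := by
  ext I
  have h1 : minorVec hN (g * A) I = ∏ c, ∑ J : Fin (h c) → Fin N,
      (∏ i, g (I ⟨c, i⟩) (J i)) *
        (Matrix.of fun i j : Fin (h c) => A (J i) (Fin.castLE (hN c) j)).det := by
    refine Finset.prod_congr rfl fun c _ => ?_
    rw [← det_sum_expand (fun i k => g (I ⟨c, i⟩) k) fun k j => A k (Fin.castLE (hN c) j)]
    rfl
  rw [h1, Finset.prod_univ_sum, Fintype.piFinset_univ]
  rw [Matrix.mulVec, dotProduct]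
  refine Fintype.sum_equiv (Equiv.piCurry fun (_ : Fin C) _ => Fin N) _ _ fun J => ?_
  rw [Finset.prod_mul_distrib, tensMat, Matrix.of_apply, Fintype.prod_sigma]
  rfl

lemma minorVec_blockTriangular {b : Matrix (Fin N) (Fin N) ℂ} (hb : b.BlockTriangular id) :
    minorVec hN b = (∏ c, ∏ j : Fin (h c), b (Fin.castLE (hN c) j) (Fin.castLE (hN c) j))
      • minorVec hN 1 := by
  ext I
  rw [Pi.smul_apply, smul_eq_mul, minorVec, minorVec, ← Finset.prod_mul_distrib]
  refine Finset.prod_congr rfl fun c _ => ?_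
  have h1 : (Matrix.of fun i j : Fin (h c) => b (I ⟨c, i⟩) (Fin.castLE (hN c) j))
      = (Matrix.of fun i j : Fin (h c) => (1 : Matrix (Fin N) (Fin N) ℂ) (I ⟨c, i⟩)
          (Fin.castLE (hN c) j))
        * (Matrix.of fun i j : Fin (h c) => b (Fin.castLE (hN c) i) (Fin.castLE (hN c) j)) := by
    ext i j
    simp only [Matrix.mul_apply, Matrix.of_apply, Matrix.one_apply]
    by_cases hi : ((I ⟨c, i⟩ : Fin N) : ℕ) < h c
    · rw [Finset.sum_eq_single ⟨_, hi⟩]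
      · simp
      · intro k _ hk
        rw [if_neg, zero_mul]
        rintro he
        refine hk (Fin.ext ?_)
        have := congrArg Fin.val he
        simpa using this.symm
      · simp
    · rw [hb, Finset.sum_eq_zero]
      · intro k _
        rw [if_neg, zero_mul]
        rintro he
        rw [he] at hi
        exact hi k.2
      · change (Fin.castLE (hN c) j : Fin N) < I ⟨c, i⟩
        rw [Fin.lt_def]
        have := j.2
        simp only [Fin.val_castLE]
        omega
  rw [h1, det_mul, mul_comm, det_of_isUpperTriangular (M := Matrix.of fun i j : Fin (h c) =>
    b (Fin.castLE (hN c) i) (Fin.castLE (hN c) j)) fun i j hij => hb hij]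
  rfl

lemma minorVec_one_ne_zero : minorVec hN 1 ≠ 0 := by
  intro h0
  have := congrFun h0 fun x => Fin.castLE (hN x.1) x.2
  rw [minorVec, Finset.prod_eq_one] at this
  · exact one_ne_zero this
  · intro c _
    convert det_one (n := Fin (h c)) (R := ℂ)
    ext i j
    simp [Matrix.one_apply]

lemma minorVec_hw (a : Fin N → ℤ)
    (ha : ∀ j : Fin N, a j = ((Finset.univ.filter fun c => (j : ℕ) < h c).card : ℤ)) :
    IsHWVec (tensRep N (Σ c : Fin C, Fin (h c))) a (minorVec hN 1) := by
  refine mem_eigSp_chi.1 (mem_eigSp.2 fun b hb => ?_)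
  rw [tensRep_apply, tensMat_mulVec_minorVec, mul_one, minorVec_blockTriangular hN hb]
  congr 1
  have h1 : ∀ c, ∏ j : Fin (h c), (b : Matrix (Fin N) (Fin N) ℂ) (Fin.castLE (hN c) j)
      (Fin.castLE (hN c) j) = ∏ j : Fin N, if (j : ℕ) < h c then
        (b : Matrix (Fin N) (Fin N) ℂ) j j else 1 := by
    intro c
    rw [← Finset.prod_filter]
    refine Finset.prod_bij (fun j _ => Fin.castLE (hN c) j) ?_ ?_ ?_ ?_
    · intro j _
      simp
    · intro i _ j _ hij
      exact Fin.castLE_injective _ hij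
    · intro j hj
      exact ⟨⟨j, (Finset.mem_filter.1 hj).2⟩, Finset.mem_univ _, rfl⟩
    · intro j _
      rfl
  simp only [h1]
  rw [Finset.prod_comm, chi]
  refine Finset.prod_congr rfl fun j _ => ?_
  rw [← Finset.prod_filter, Finset.prod_const, ha, zpow_natCast]

end HighestWeightVector

/-- Every antitone nonnegative weight is the weight of a highest weight vector in some tensor
power. -/
lemma exists_hwVec_tensRep (L : Fin N → ℕ) (hL : Antitone L) :
    ∃ (C : ℕ) (h : Fin C → ℕ) (w : ((Σ c : Fin C, Fin (h c)) → Fin N) → ℂ), w ≠ 0 ∧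
      IsHWVec (tensRep N (Σ c : Fin C, Fin (h c))) (fun i => (L i : ℤ)) w := by
  set h : Fin (∑ i, L i) → ℕ := fun c => (Finset.univ.filter fun i => (c : ℕ) < L i).card with hh
  have hN : ∀ c, h c ≤ N := fun c => (Finset.card_le_univ _).trans (by simp)
  refine ⟨_, h, minorVec hN 1, minorVec_one_ne_zero hN, minorVec_hw hN _ fun j => ?_⟩
  have hiff : ∀ c, (j : ℕ) < h c ↔ (c : ℕ) < L j := by
    intro c
    constructor
    · intro hj
      by_contra hc
      have : (Finset.univ.filter fun i => (c : ℕ) < L i) ⊆ Finset.Iio j := by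
        intro i hi
        rw [Finset.mem_Iio]
        by_contra hij
        exact hc ((Finset.mem_filter.1 hi).2.trans_le (hL (not_lt.1 hij)))
      have := Finset.card_le_card this
      rw [Fin.card_Iio] at this
      exact absurd hj (not_lt.2 this)
    · intro hc
      have : Finset.Iic j ⊆ (Finset.univ.filter fun i => (c : ℕ) < L i) := by
        intro i hi
        rw [Finset.mem_filter]
        exact ⟨Finset.mem_univ _, hc.trans_le (hL (Finset.mem_Iic.1 hi))⟩
      have := Finset.card_le_card this
      rw [Fin.card_Iic] at this
      exact this
  have hle : L j ≤ ∑ i, L i := Finset.single_le_sum (fun i _ => Nat.zero_le _) (Finset.mem_univ j)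
  simp only [hiff]
  rw [Fin.card_filter_val_lt, min_eq_right hle]

end TensorModel
end

noncomputable section

section LieModel
variable {N : ℕ} {P : Type*} [Fintype P]

/-- The tensor product of a family of matrices. -/
def famMat (M : P → Matrix (Fin N) (Fin N) ℂ) : Matrix (P → Fin N) (P → Fin N) ℂ :=
  Matrix.of fun I J => ∏ x, M x (I x) (J x)

lemma tensMat_eq_famMat (g : Matrix (Fin N) (Fin N) ℂ) : tensMat P g = famMat fun _ => g := rfl

variable [DecidableEq P]

lemma famMat_mul (M M' : P → Matrix (Fin N) (Fin N) ℂ) :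
    famMat M * famMat M' = famMat fun x => M x * M' x := by
  ext I J
  simp only [famMat, Matrix.of_apply, Matrix.mul_apply, Finset.prod_univ_sum,
    Fintype.piFinset_univ, Finset.prod_mul_distrib]

/-- The matrix `A` acting in the tensor factor `x`, and `G` in the others. -/
def opMat (G : Matrix (Fin N) (Fin N) ℂ) (x : P) (A : Matrix (Fin N) (Fin N) ℂ) :
    Matrix (P → Fin N) (P → Fin N) ℂ := famMat (Function.update (fun _ => G) x A)

lemma opMat_apply (G : Matrix (Fin N) (Fin N) ℂ) (x : P) (A : Matrix (Fin N) (Fin N) ℂ)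
    (I J : P → Fin N) :
    opMat G x A I J = (∏ y ∈ Finset.univ.erase x, G (I y) (J y)) * A (I x) (J x) := by
  rw [opMat, famMat, Matrix.of_apply, ← Finset.prod_erase_mul _ _ (Finset.mem_univ x)]
  congr 1
  · refine Finset.prod_congr rfl fun y hy => ?_
    rw [Function.update_of_ne (Finset.ne_of_mem_erase hy)]
  · rw [Function.update_self]

/-- The linear map `A ↦ opMat G x A`. -/
def opLin (G : Matrix (Fin N) (Fin N) ℂ) (x : P) :
    Matrix (Fin N) (Fin N) ℂ →ₗ[ℂ] Matrix (P → Fin N) (P → Fin N) ℂ where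
  toFun := opMat G x
  map_add' A B := by
    ext I J
    rw [Matrix.add_apply, opMat_apply, opMat_apply, opMat_apply, Matrix.add_apply, mul_add]
  map_smul' c A := by
    ext I J
    rw [RingHom.id_apply, Matrix.smul_apply, opMat_apply, opMat_apply, Matrix.smul_apply,
      smul_eq_mul, smul_eq_mul]
    ring

/-- The action of the Lie algebra on the tensor power. -/
def lieMat (P : Type*) [Fintype P] [DecidableEq P] :
    Matrix (Fin N) (Fin N) ℂ →ₗ[ℂ] Matrix (P → Fin N) (P → Fin N) ℂ :=
  ∑ x : P, opLin 1 x

lemma lieMat_apply (A : Matrix (Fin N) (Fin N) ℂ) : lieMat P A = ∑ x : P, opMat 1 x A := by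
  simp only [lieMat, LinearMap.sum_apply]
  rfl

lemma opMat_mul_self (x : P) (A B : Matrix (Fin N) (Fin N) ℂ) :
    opMat 1 x A * opMat 1 x B = opMat 1 x (A * B) := by
  rw [opMat, opMat, opMat, famMat_mul]
  congr 1
  ext1 y
  by_cases h : y = x
  · subst h; simp
  · simp [Function.update_of_ne h]

lemma opMat_comm {x y : P} (hxy : x ≠ y) (A B : Matrix (Fin N) (Fin N) ℂ) :
    opMat 1 x A * opMat 1 y B = opMat 1 y B * opMat 1 x A := by
  rw [opMat, opMat, famMat_mul, famMat_mul]
  congr 1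
  ext1 z
  by_cases h : z = x
  · subst h; simp [Function.update_of_ne hxy]
  · simp [Function.update_of_ne h]

lemma tensMat_mul_opMat (G A : Matrix (Fin N) (Fin N) ℂ) (x : P) :
    tensMat P G * opMat 1 x A = opMat G x (G * A) := by
  rw [opMat, opMat, tensMat_eq_famMat, famMat_mul]
  congr 1
  ext1 y
  by_cases h : y = x
  · subst h; simp
  · simp [Function.update_of_ne h]

lemma lieMat_comm (A B : Matrix (Fin N) (Fin N) ℂ) :
    lieMat P A * lieMat P B - lieMat P B * lieMat P A = lieMat P (A * B - B * A) := by
  simp only [lieMat_apply]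
  rw [Finset.sum_mul_sum, Finset.sum_mul_sum, Finset.sum_comm (s := Finset.univ)
    (f := fun i j => opMat 1 i B * opMat 1 j A), ← Finset.sum_sub_distrib]
  refine Finset.sum_congr rfl fun x _ => ?_
  rw [← Finset.sum_sub_distrib, Finset.sum_eq_single x]
  · rw [opMat_mul_self, opMat_mul_self]
    exact ((opLin (P := P) (1 : Matrix (Fin N) (Fin N) ℂ) x).map_sub _ _).symm
  · intro y _ hy
    rw [opMat_comm hy, sub_self]
  · simp

lemma hasDerivAt_tensMat {A A' : Matrix (Fin N) (Fin N) ℂ} {s : ℂ} (h : (1 + s • A) * A' = A)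
    (v : (P → Fin N) → ℂ) :
    HasDerivAt (fun s : ℂ => tensMat P (1 + s • A) *ᵥ v)
      (tensMat P (1 + s • A) *ᵥ (lieMat P A' *ᵥ v)) s := by
  rw [hasDerivAt_pi]
  intro I
  have h1 : tensMat P (1 + s • A) *ᵥ (lieMat P A' *ᵥ v)
      = (∑ x : P, opMat (1 + s • A) x A) *ᵥ v := by
    rw [mulVec_mulVec, lieMat_apply, Finset.mul_sum]
    simp only [tensMat_mul_opMat, h]
  rw [h1]
  simp only [Matrix.mulVec, dotProduct]
  refine HasDerivAt.fun_sum fun J _ => HasDerivAt.mul_const ?_ _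
  simp only [tensMat, Matrix.of_apply, Matrix.sum_apply, opMat_apply]
  have := HasDerivAt.fun_finsetProd (u := (Finset.univ : Finset P)) (x := s)
    (f := fun x s => (1 + s • A) (I x) (J x)) (f' := fun x => A (I x) (J x)) fun x _ => by
      simp only [Matrix.add_apply, Matrix.smul_apply, smul_eq_mul]
      simpa using ((hasDerivAt_id s).mul_const (A (I x) (J x))).const_add
        ((1 : Matrix (Fin N) (Fin N) ℂ) (I x) (J x))
  simpa only [smul_eq_mul] using this

lemma hasDerivAt_tensMat_zero (A : Matrix (Fin N) (Fin N) ℂ) (v : (P → Fin N) → ℂ) :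
    HasDerivAt (fun s : ℂ => tensMat P (1 + s • A) *ᵥ v) (lieMat P A *ᵥ v) 0 := by
  have := hasDerivAt_tensMat (P := P) (A := A) (A' := A) (s := 0) (by simp) v
  simpa [tensMat_one] using this

/-- Subrepresentations are stable under the Lie algebra. -/
lemma lieMat_mem {U : Submodule ℂ ((P → Fin N) → ℂ)} (hU : IsSubrep (tensRep N P) U)
    (A : Matrix (Fin N) (Fin N) ℂ) {v : (P → Fin N) → ℂ} (hv : v ∈ U) : lieMat P A *ᵥ v ∈ U := by
  by_contra hn
  obtain ⟨ζ, hζ, hle⟩ := Submodule.exists_le_ker_of_notMem hn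
  refine hζ ?_
  have h1 := (LinearMap.toContinuousLinearMap ζ).hasFDerivAt.comp_hasDerivAt (0 : ℂ)
    (hasDerivAt_tensMat_zero A v)
  have h2 : (LinearMap.toContinuousLinearMap ζ) ∘ (fun s : ℂ => tensMat P (1 + s • A) *ᵥ v)
      =ᶠ[nhds 0] fun _ => 0 := by
    have hc : Continuous fun s : ℂ => (1 + s • A).det := by fun_prop
    have : ∀ᶠ s in nhds (0 : ℂ), (1 + s • A).det ≠ 0 := by
      refine hc.continuousAt.eventually_ne ?_
      simp
    filter_upwards [this] with s hs
    exact hle (hU (GeneralLinearGroup.mkOfDetNeZero _ hs) v hv)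
  exact h1.unique ((hasDerivAt_const (0 : ℂ) (0 : ℂ)).congr_of_eventuallyEq h2)

/-- The matrix units acting on the tensor power. -/
def lieE (P : Type*) [Fintype P] [DecidableEq P] (i j : Fin N) :
    Module.End ℂ ((P → Fin N) → ℂ) := Matrix.toLin' (lieMat P (Matrix.single i j 1))

lemma lieE_apply (i j : Fin N) (v : (P → Fin N) → ℂ) :
    lieE P i j v = lieMat P (Matrix.single i j 1) *ᵥ v := rfl

lemma glRel_lieE : GLRel (lieE (N := N) P) := by
  intro i j k l
  have h : lieE P i j * lieE P k l - lieE P k l * lieE P i j = Matrix.toLin'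
      (lieMat P (Matrix.single i j (1 : ℂ) * Matrix.single k l 1
        - Matrix.single k l 1 * Matrix.single i j 1)) := by
    rw [← lieMat_comm, map_sub, Matrix.toLin'_mul, Matrix.toLin'_mul]
    rfl
  rw [h, map_sub, map_sub]
  congr 1
  · split_ifs with hjk
    · subst hjk
      rw [Matrix.single_mul_single_same, one_mul]
      rfl
    · rw [Matrix.single_mul_single_of_ne _ _ _ _ hjk, map_zero, map_zero]
  · split_ifs with hjk
    · subst hjk
      rw [Matrix.single_mul_single_same, one_mul]
      rfl
    · rw [Matrix.single_mul_single_of_ne _ _ _ _ hjk, map_zero, map_zero]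

lemma lieMat_mulVec_eq_sum (A : Matrix (Fin N) (Fin N) ℂ) (v : (P → Fin N) → ℂ) :
    lieMat P A *ᵥ v = ∑ i, ∑ j, A i j • lieE P i j v := by
  conv_lhs => rw [Matrix.matrix_eq_sum_single A]
  simp only [map_sum, Matrix.sum_mulVec, lieE_apply]
  refine Finset.sum_congr rfl fun i _ => Finset.sum_congr rfl fun j _ => ?_
  rw [← Matrix.smul_mulVec, ← map_smul, Matrix.smul_single, smul_eq_mul, mul_one]

end LieModel
end

noncomputable section

section BorelModel
variable {N : ℕ} {P : Type*} [Fintype P] [DecidableEq P]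

/-- The content of a word. -/
def cont (I : P → Fin N) (i : Fin N) : ℕ := (Finset.univ.filter fun x => I x = i).card

lemma tensMat_diagonal_mulVec (d : Fin N → ℂ) (v : (P → Fin N) → ℂ) (I : P → Fin N) :
    (tensMat P (Matrix.diagonal d) *ᵥ v) I = (∏ i, d i ^ cont I i) * v I := by
  have h : tensMat P (Matrix.diagonal d) = Matrix.diagonal fun I => ∏ x, d (I x) := by
    ext I J
    by_cases hIJ : I = J
    · subst hIJ
      simp [tensMat]
    · rw [Matrix.diagonal_apply_ne _ hIJ]
      obtain ⟨x, hx⟩ := Function.ne_iff.1 hIJ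
      exact Finset.prod_eq_zero (Finset.mem_univ x) (Matrix.diagonal_apply_ne _ hx)
  rw [h, mulVec_diagonal]
  congr 1
  rw [← Finset.prod_fiberwise (s := Finset.univ) (g := I)]
  refine Finset.prod_congr rfl fun i _ => ?_
  rw [cont, ← Finset.prod_const]
  refine Finset.prod_congr rfl fun x hx => ?_
  rw [(Finset.mem_filter.1 hx).2]

lemma lieE_diag_apply (i : Fin N) (v : (P → Fin N) → ℂ) (I : P → Fin N) :
    lieE P i i v I = (cont I i : ℂ) * v I := by
  have h : lieMat P (Matrix.single i i (1 : ℂ)) = Matrix.diagonal fun I => (cont I i : ℂ) := by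
    ext I J
    rw [lieMat_apply, Matrix.sum_apply]
    simp only [opMat_apply]
    by_cases hIJ : I = J
    · subst hIJ
      rw [Matrix.diagonal_apply_eq, cont, Finset.card_filter, Nat.cast_sum]
      refine Finset.sum_congr rfl fun x _ => ?_
      rw [Finset.prod_eq_one fun y _ => Matrix.one_apply_eq _, one_mul]
      by_cases hx : I x = i
      · simp [hx]
      · simp [Matrix.single, hx, Ne.symm hx]
    · rw [Matrix.diagonal_apply_ne _ hIJ]
      obtain ⟨z, hz⟩ := Function.ne_iff.1 hIJ
      refine Finset.sum_eq_zero fun x _ => ?_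
      by_cases hx : x = z
      · subst hx
        rw [mul_eq_zero]
        right
        rw [Matrix.single_apply, if_neg]
        rintro ⟨h1, h2⟩
        exact hz (h1.symm.trans h2)
      · have h0 : (1 : Matrix (Fin N) (Fin N) ℂ) (I z) (J z) = 0 := Matrix.one_apply_ne hz
        rw [Finset.prod_eq_zero (Finset.mem_erase.2 ⟨Ne.symm hx, Finset.mem_univ z⟩) h0, zero_mul]
  rw [lieE_apply, h, mulVec_diagonal]

lemma lieE_diag_iff {a : Fin N → ℤ} {v : (P → Fin N) → ℂ} :
    (∀ i, lieE P i i v = (a i : ℂ) • v) ↔ ∀ I, v I ≠ 0 → ∀ i, (cont I i : ℤ) = a i := by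
  constructor
  · intro h I hI i
    have := congrFun (h i) I
    rw [lieE_diag_apply, Pi.smul_apply, smul_eq_mul] at this
    exact_mod_cast mul_right_cancel₀ hI this
  · intro h i
    ext I
    rw [lieE_diag_apply, Pi.smul_apply, smul_eq_mul]
    by_cases hI : v I = 0
    · simp [hI]
    · rw [← h I hI i]
      simp

lemma tensMat_diagonal_iff {a : Fin N → ℤ} {v : (P → Fin N) → ℂ} :
    (∀ d : Fin N → ℂ, (∀ i, d i ≠ 0) →
      tensMat P (Matrix.diagonal d) *ᵥ v = (∏ i, d i ^ a i) • v)
      ↔ ∀ i, lieE P i i v = (a i : ℂ) • v := by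
  rw [lieE_diag_iff]
  constructor
  · intro h I hI i
    set d : Fin N → ℂ := fun j => if j = i then 2 else 1 with hd
    have := congrFun (h d fun j => by simp only [hd]; split_ifs <;> norm_num) I
    rw [tensMat_diagonal_mulVec, Pi.smul_apply, smul_eq_mul] at this
    have h1 := mul_right_cancel₀ hI this
    rw [Finset.prod_eq_single i, Finset.prod_eq_single i] at h1
    · simp only [hd, if_true] at h1
      rw [← zpow_natCast] at h1
      have h4 : ((2 : ℝ) : ℂ) ^ (cont I i : ℤ) = ((2 : ℝ) : ℂ) ^ a i := by simpa using h1
      rw [← Complex.ofReal_zpow, ← Complex.ofReal_zpow] at h4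
      exact zpow_right_injective₀ (by norm_num) (by norm_num) (Complex.ofReal_injective h4)
    · intro j _ hj
      simp [hd, hj]
    · simp
    · intro j _ hj
      simp [hd, hj]
    · simp
  · intro h d _
    ext I
    rw [tensMat_diagonal_mulVec, Pi.smul_apply, smul_eq_mul]
    by_cases hI : v I = 0
    · simp [hI]
    · congr 1
      refine Finset.prod_congr rfl fun i _ => ?_
      rw [← h I hI i, zpow_natCast]

lemma tensMat_unipotent {c : Fin N → ℕ} {v : (P → Fin N) → ℂ}
    (h : ∀ i j, i < j → c i = c j → lieE P i j v = 0) {u : Matrix (Fin N) (Fin N) ℂ}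
    (h1 : ∀ i, u i i = 1) (h2 : ∀ i j, j < i → u i j = 0) (h3 : ∀ i j, c i ≠ c j → u i j = 0) :
    tensMat P u *ᵥ v = v := by
  set A := u - 1 with hA
  have hA1 : ∀ i j, j ≤ i → A i j = 0 := by
    intro i j hij
    rw [hA, Matrix.sub_apply]
    rcases hij.lt_or_eq with hij | hij
    · rw [h2 i j hij, Matrix.one_apply_ne hij.ne', sub_zero]
    · subst hij
      rw [h1, Matrix.one_apply_eq, sub_self]
  have hA2 : ∀ i j, c i ≠ c j → A i j = 0 := by
    intro i j hij
    rw [hA, Matrix.sub_apply, h3 i j hij, Matrix.one_apply_ne (ne_of_apply_ne c hij), sub_zero]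
  have hder : ∀ s : ℂ, HasDerivAt (fun s : ℂ => tensMat P (1 + s • A) *ᵥ v) 0 s := by
    intro s
    set g := 1 + s • A with hg
    have hgtri : g.BlockTriangular id := fun i j hij => by
      rw [hg, Matrix.add_apply, Matrix.smul_apply, hA1 i j (le_of_lt hij),
        Matrix.one_apply_ne (show i ≠ j from ne_of_gt hij)]
      simp
    have hgd : g.det = 1 := by
      rw [det_of_isUpperTriangular hgtri]
      refine Finset.prod_eq_one fun i _ => ?_
      rw [hg, Matrix.add_apply, Matrix.smul_apply, hA1 i i le_rfl]
      simp
    have hgc : ∀ i j, c i ≠ c j → g i j = 0 := by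
      intro i j hij
      rw [hg, Matrix.add_apply, Matrix.smul_apply, hA2 i j hij,
        Matrix.one_apply_ne (ne_of_apply_ne c hij)]
      simp
    have hu : IsUnit g.det := by rw [hgd]; exact isUnit_one
    have : Invertible g := Matrix.invertibleOfIsUnitDet g hu
    have i1 : g⁻¹.BlockTriangular id := blockTriangular_inv_of_blockTriangular hgtri
    have i2 : g⁻¹.BlockTriangular c :=
      blockTriangular_inv_of_blockTriangular fun i j hij => hgc i j (ne_of_gt hij)
    have i3 : g⁻¹.BlockTriangular (OrderDual.toDual ∘ c) :=
      blockTriangular_inv_of_blockTriangular fun i j hij =>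
        hgc i j (ne_of_lt (OrderDual.toDual_lt_toDual.1 hij))
    have hA' : g * (g⁻¹ * A) = A := by rw [← mul_assoc, Matrix.mul_nonsing_inv _ hu, one_mul]
    have hd := hasDerivAt_tensMat (P := P) hA' v
    convert hd using 1
    rw [lieMat_mulVec_eq_sum, Finset.sum_eq_zero, mulVec_zero]
    refine fun i _ => Finset.sum_eq_zero fun j _ => ?_
    by_cases hij : i < j ∧ c i = c j
    · rw [h i j hij.1 hij.2, smul_zero]
    · rw [Matrix.mul_apply, Finset.sum_eq_zero, zero_smul]
      intro k _
      by_cases hk : i ≤ k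
      · by_cases hk2 : c i = c k
        · by_cases hk3 : k < j
          · rw [hA2, mul_zero]
            intro hc
            exact hij ⟨hk.trans_lt hk3, hk2.trans hc⟩
          · rw [hA1 _ _ (not_lt.1 hk3), mul_zero]
        · rcases lt_or_gt_of_ne hk2 with hlt | hlt
          · rw [i3 (OrderDual.toDual_lt_toDual.2 hlt), zero_mul]
          · rw [i2 hlt, zero_mul]
      · rw [i1 (not_le.1 hk), zero_mul]
  have hconst := is_const_of_deriv_eq_zero (fun s => (hder s).differentiableAt)
    (fun s => (hder s).deriv) 1 0
  simpa [hA, tensMat_one] using hconst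

/-- Eigenvectors of a block Borel subgroup are highest weight vectors for its Lie algebra. -/
lemma borel_iff (c : Fin N → ℕ) {a : Fin N → ℤ} {v : (P → Fin N) → ℂ} :
    (∀ b : GL (Fin N) ℂ, (∀ i j, j < i → b i j = 0) → (∀ i j, c i ≠ c j → b i j = 0) →
      tensMat P (b : Matrix (Fin N) (Fin N) ℂ) *ᵥ v = (∏ i, b i i ^ a i) • v)
      ↔ (∀ i, lieE P i i v = (a i : ℂ) • v) ∧ ∀ i j, i < j → c i = c j → lieE P i j v = 0 := by
  constructor
  · intro h
    refine ⟨tensMat_diagonal_iff.1 fun d hd => ?_, fun i j hij hc => ?_⟩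
    · have hdet : (Matrix.diagonal d).det ≠ 0 := by
        rw [det_diagonal]
        exact Finset.prod_ne_zero_iff.2 fun i _ => hd i
      have := h (GeneralLinearGroup.mkOfDetNeZero _ hdet)
        (fun i j hij => Matrix.diagonal_apply_ne _ (ne_of_gt hij))
        (fun i j hij => Matrix.diagonal_apply_ne _ (ne_of_apply_ne c hij))
      simpa [GeneralLinearGroup.mkOfDetNeZero] using this
    · have h1 := hasDerivAt_tensMat_zero (P := P) (Matrix.single i j 1) v
      have h2 : (fun s : ℂ => tensMat P (1 + s • Matrix.single i j 1) *ᵥ v) = fun _ => v := by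
        ext1 s
        have ht : (1 + s • Matrix.single i j (1 : ℂ)).BlockTriangular id := by
          intro k l hkl
          have : l ≠ k := ne_of_lt hkl
          rw [Matrix.add_apply, Matrix.smul_apply, Matrix.one_apply_ne this.symm,
            Matrix.single_apply, if_neg]
          · simp
          · rintro ⟨rfl, rfl⟩
            exact lt_asymm hij hkl
        have hdiag : ∀ k, (1 + s • Matrix.single i j (1 : ℂ)) k k = 1 := by
          intro k
          rw [Matrix.add_apply, Matrix.smul_apply, Matrix.one_apply_eq, Matrix.single_apply, if_neg]
          · simp
          · rintro ⟨rfl, rfl⟩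
            exact lt_irrefl _ hij
        have hdet : (1 + s • Matrix.single i j (1 : ℂ)).det ≠ 0 := by
          rw [det_of_isUpperTriangular ht, Finset.prod_eq_one fun k _ => hdiag k]
          exact one_ne_zero
        have := h (GeneralLinearGroup.mkOfDetNeZero _ hdet) (fun k l hkl => ht hkl)
          (fun k l hkl => by
            change (1 + s • Matrix.single i j (1 : ℂ)) k l = 0
            rw [Matrix.add_apply, Matrix.smul_apply, Matrix.one_apply_ne (ne_of_apply_ne c hkl),
              Matrix.single_apply, if_neg]
            · simp
            · rintro ⟨rfl, rfl⟩
              exact hkl hc)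
        refine Eq.trans this ?_
        rw [Finset.prod_eq_one, one_smul]
        intro k _
        change (1 + s • Matrix.single i j (1 : ℂ)) k k ^ a k = 1
        rw [hdiag, _root_.one_zpow]
      rw [h2] at h1
      exact h1.unique (hasDerivAt_const 0 v)
  · rintro ⟨hd, hn⟩ b hb hc
    have hne : ∀ i, b i i ≠ 0 := by
      have hdet : (b : Matrix (Fin N) (Fin N) ℂ).det ≠ 0 :=
        ((Matrix.isUnit_iff_isUnit_det _).1 b.isUnit).ne_zero
      rw [det_of_isUpperTriangular (M := (b : Matrix (Fin N) (Fin N) ℂ)) fun i j hij => hb i j hij,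
        Finset.prod_ne_zero_iff] at hdet
      exact fun i => hdet i (Finset.mem_univ i)
    set u : Matrix (Fin N) (Fin N) ℂ := Matrix.of fun i j => (b i i)⁻¹ * b i j with hu
    have hbu : (b : Matrix (Fin N) (Fin N) ℂ) = Matrix.diagonal (fun i => b i i) * u := by
      ext i j
      rw [Matrix.diagonal_mul, hu, Matrix.of_apply, mul_inv_cancel_left₀ (hne i)]
    rw [hbu, tensMat_mul, ← mulVec_mulVec, tensMat_unipotent hn (u := u) (c := c),
      tensMat_diagonal_iff.2 hd _ hne]
    · simp only [hu, Matrix.diagonal_mul, Matrix.of_apply, mul_inv_cancel_left₀ (hne _)]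
    · exact fun i => inv_mul_cancel₀ (hne i)
    · intro i j hij
      rw [hu, Matrix.of_apply, hb i j hij, mul_zero]
    · intro i j hij
      rw [hu, Matrix.of_apply, hc i j hij, mul_zero]

end BorelModel
end

noncomputable section

section Model
variable {N : ℕ} {V : Type*} [AddCommGroup V] [Module ℂ V]

/-- Irreducible rational representations embed in twisted tensor powers. -/
lemma exists_model {L : Fin N → ℤ} {ρ : Representation ℂ (GL (Fin N) ℂ) V} (hl : IsGLHW N L ρ)
    {k : ℤ} {L' : Fin N → ℕ} (hL' : Antitone L') (hk : ∀ i, L i + k = L' i) :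
    ∃ (C : ℕ) (h : Fin C → ℕ) (f : V →ₗ[ℂ] (((Σ c : Fin C, Fin (h c)) → Fin N) → ℂ))
      (w : ((Σ c : Fin C, Fin (h c)) → Fin N) → ℂ), Function.Injective f ∧
      f ∈ equivariantMaps ρ (detTwist (tensRep N (Σ c : Fin C, Fin (h c))) (-k)) ∧ w ≠ 0 ∧
      IsHWVec (tensRep N (Σ c : Fin C, Fin (h c))) (fun i => (L' i : ℤ)) w ∧
      LinearMap.range f = orbSpan (tensRep N (Σ c : Fin C, Fin (h c))) w := by
  obtain ⟨C, h, w, hw0, hw⟩ := exists_hwVec_tensRep L' hL'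
  obtain ⟨v, ξ, hv, htop, hξv, hξ⟩ := hl.exists_data
  have := hl.2.1
  have hw' := hw.detTwist (k := -k)
  have hwL : (fun i => (L' i : ℤ) + -k) = L := by
    ext i
    rw [← hk i]
    ring
  rw [hwL] at hw'
  obtain ⟨f, hf, hfv⟩ := exists_equivariant_star isTransDense_cellOf
    (fun l hl => star_loSet hl L) hv htop hξv hξ stdForm_isStarForm.detTwist
    (mem_eigSp.1 (mem_eigSp_chi.2 hw'))
  refine ⟨C, h, f, w, ?_, hf, hw0, hw, ?_⟩
  · rw [← LinearMap.ker_eq_bot]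
    refine (hl.1.2 (LinearMap.ker f) fun g x hx => ?_).resolve_right fun ht => hw0 ?_
    · have := LinearMap.congr_fun (hf g) x
      simp only [LinearMap.comp_apply] at this
      rw [LinearMap.mem_ker, this, LinearMap.mem_ker.1 hx, map_zero]
    · rw [← hfv, ← LinearMap.mem_ker, ht]
      trivial
  · have hg : ∀ g, f (ρ g v) = ((g : Matrix (Fin N) (Fin N) ℂ).det ^ (-k)) •
        tensRep N (Σ c : Fin C, Fin (h c)) g w := by
      intro g
      have := LinearMap.congr_fun (hf g) v
      simp only [LinearMap.comp_apply] at this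
      rw [this, hfv, detTwist_apply]
    rw [LinearMap.range_eq_map, ← htop, orbSpan, orbSpan, Submodule.map_span]
    apply le_antisymm
    · rw [Submodule.span_le]
      rintro _ ⟨_, ⟨g, rfl⟩, rfl⟩
      rw [hg]
      exact Submodule.smul_mem _ _ (Submodule.subset_span ⟨g, rfl⟩)
    · rw [Submodule.span_le]
      rintro _ ⟨g, rfl⟩
      have hdet : (g : Matrix (Fin N) (Fin N) ℂ).det ^ (-k) ≠ 0 :=
        zpow_ne_zero _ ((Matrix.isUnit_iff_isUnit_det _).1 g.isUnit).ne_zero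
      refine (Submodule.smul_mem_iff _ hdet).1 ?_
      change _ • tensRep N (Σ c : Fin C, Fin (h c)) g w ∈ _
      rw [← hg]
      exact Submodule.subset_span ⟨_, ⟨g, rfl⟩, rfl⟩

end Model

section Pullback
variable {Γ Δ : Type*} [Group Γ] [StarMul Γ] [Group Δ] [StarMul Δ] {V W : Type*} [AddCommGroup V]
  [Module ℂ V] [AddCommGroup W] [Module ℂ W]

lemma exists_starForm_comp {σ : Representation ℂ Γ W} {ρ : Representation ℂ Γ V}
    {f : V →ₗ[ℂ] W} (hf : f ∈ equivariantMaps ρ σ) (hinj : Function.Injective f)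
    {B : W →ₗ⋆[ℂ] W →ₗ[ℂ] ℂ} (hB : IsStarForm σ B) {φ : Δ →* Γ} (hφ : ∀ g, φ (star g) = star (φ g)) :
    ∃ B' : V →ₗ⋆[ℂ] V →ₗ[ℂ] ℂ, IsStarForm (ρ.comp φ) B' := by
  have hf' : ∀ g x, f (ρ g x) = σ g (f x) := fun g x => LinearMap.congr_fun (hf g) x
  refine ⟨LinearMap.mk₂'ₛₗ (starRingEnd ℂ) (RingHom.id ℂ) (fun x y => B (f x) (f y))
    (by intros; simp) (by intros; simp) (by intros; simp) (by intros; simp),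
    fun x hx => hinj ?_, fun g x y => ?_⟩
  · rw [map_zero]
    exact hB.1 _ hx
  · change B (f (ρ (φ g) x)) (f y) = B (f x) (f (ρ (φ (star g)) y))
    rw [hf', hf', hφ, hB.2]

end Pullback

section BlockEmbed
variable {n m : ℕ} {φ : GL (Fin n) ℂ × GL (Fin m) ℂ →* GL (Fin (n + m)) ℂ}

lemma IsBlockDiagEmbed.castAdd_castAdd (h : IsBlockDiagEmbed n m φ)
    (g : GL (Fin n) ℂ × GL (Fin m) ℂ) (i j : Fin n) :
    φ g (Fin.castAdd m i) (Fin.castAdd m j) = g.1 i j := by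
  rw [h g.1 g.2, dif_pos (by simp), dif_pos (by simp)]
  rfl

lemma IsBlockDiagEmbed.natAdd_natAdd (h : IsBlockDiagEmbed n m φ)
    (g : GL (Fin n) ℂ × GL (Fin m) ℂ) (i j : Fin m) :
    φ g (Fin.natAdd n i) (Fin.natAdd n j) = g.2 i j := by
  rw [h g.1 g.2, dif_neg (by simp), dif_neg (by simp)]
  simp

lemma IsBlockDiagEmbed.castAdd_natAdd (h : IsBlockDiagEmbed n m φ)
    (g : GL (Fin n) ℂ × GL (Fin m) ℂ) (i : Fin n) (j : Fin m) :
    φ g (Fin.castAdd m i) (Fin.natAdd n j) = 0 := by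
  rw [h g.1 g.2, dif_pos (by simp), dif_neg (by simp)]

lemma IsBlockDiagEmbed.natAdd_castAdd (h : IsBlockDiagEmbed n m φ)
    (g : GL (Fin n) ℂ × GL (Fin m) ℂ) (i : Fin m) (j : Fin n) :
    φ g (Fin.natAdd n i) (Fin.castAdd m j) = 0 := by
  rw [h g.1 g.2, dif_neg (by simp), dif_pos (by simp)]

lemma IsBlockDiagEmbed.map_star (h : IsBlockDiagEmbed n m φ)
    (g : GL (Fin n) ℂ × GL (Fin m) ℂ) : φ (star g) = star (φ g) := by
  refine Units.ext (Matrix.ext fun i j => ?_)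
  change φ (star g) i j = star (φ g j i)
  induction i using Fin.addCases <;> induction j using Fin.addCases
  · rw [h.castAdd_castAdd, h.castAdd_castAdd]; rfl
  · rw [h.castAdd_natAdd, h.natAdd_castAdd, star_zero]
  · rw [h.castAdd_natAdd, h.natAdd_castAdd, star_zero]
  · rw [h.natAdd_natAdd, h.natAdd_natAdd]; rfl

/-- The block of an index. -/
def blk (n m : ℕ) (i : Fin (n + m)) : ℕ := if (i : ℕ) < n then 0 else 1

lemma blk_castAdd (i : Fin n) : blk n m (Fin.castAdd m i) = 0 := by simp [blk]
lemma blk_natAdd (i : Fin m) : blk n m (Fin.natAdd n i) = 1 := by simp [blk]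

lemma IsBlockDiagEmbed.upper (h : IsBlockDiagEmbed n m φ)
    {g : GL (Fin n) ℂ × GL (Fin m) ℂ} (hg : g ∈ boSet n ×ˢ boSet m) :
    (∀ i j, j < i → φ g i j = 0) ∧ ∀ i j, blk n m i ≠ blk n m j → φ g i j = 0 := by
  constructor <;> intro i j hij <;>
    induction i using Fin.addCases <;> induction j using Fin.addCases
  · rw [h.castAdd_castAdd]; exact hg.1 hij
  · rw [h.castAdd_natAdd]
  · rw [h.natAdd_castAdd]
  · rw [h.natAdd_natAdd]; exact hg.2 (by simpa using hij)
  · simp [blk_castAdd] at hij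
  · rw [h.castAdd_natAdd]
  · rw [h.natAdd_castAdd]
  · simp [blk_natAdd] at hij

lemma IsBlockDiagEmbed.exists_eq (h : IsBlockDiagEmbed n m φ) {b : GL (Fin (n + m)) ℂ}
    (hb : ∀ i j, j < i → b i j = 0) (hc : ∀ i j, blk n m i ≠ blk n m j → b i j = 0) :
    ∃ g ∈ boSet n ×ˢ boSet m, φ g = b := by
  have hdet : (b : Matrix (Fin (n + m)) (Fin (n + m)) ℂ).det ≠ 0 :=
    ((Matrix.isUnit_iff_isUnit_det _).1 b.isUnit).ne_zero
  rw [det_of_isUpperTriangular (M := (b : Matrix (Fin (n + m)) (Fin (n + m)) ℂ))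
    fun i j hij => hb i j hij, Finset.prod_ne_zero_iff] at hdet
  set A : Matrix (Fin n) (Fin n) ℂ := Matrix.of fun i j => b (Fin.castAdd m i) (Fin.castAdd m j)
  set D : Matrix (Fin m) (Fin m) ℂ := Matrix.of fun i j => b (Fin.natAdd n i) (Fin.natAdd n j)
  have hA : A.BlockTriangular id := fun i j hij => hb _ _ hij
  have hD : D.BlockTriangular id := fun i j hij => hb _ _ (by simpa using hij)
  have hA0 : A.det ≠ 0 := by
    rw [det_of_isUpperTriangular hA, Finset.prod_ne_zero_iff]
    exact fun i _ => hdet _ (Finset.mem_univ _)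
  have hD0 : D.det ≠ 0 := by
    rw [det_of_isUpperTriangular hD, Finset.prod_ne_zero_iff]
    exact fun i _ => hdet _ (Finset.mem_univ _)
  refine ⟨(GeneralLinearGroup.mkOfDetNeZero A hA0, GeneralLinearGroup.mkOfDetNeZero D hD0),
    ⟨hA, hD⟩, Units.ext (Matrix.ext fun i j => ?_)⟩
  induction i using Fin.addCases <;> induction j using Fin.addCases
  · rw [h.castAdd_castAdd]; rfl
  · rw [h.castAdd_natAdd, hc _ _ (by simp [blk_castAdd, blk_natAdd])]
  · rw [h.natAdd_castAdd, hc _ _ (by simp [blk_castAdd, blk_natAdd])]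
  · rw [h.natAdd_natAdd]; rfl

lemma IsBlockDiagEmbed.prod_diag (h : IsBlockDiagEmbed n m φ) (a : Fin n → ℤ) (b : Fin m → ℤ)
    (g : GL (Fin n) ℂ × GL (Fin m) ℂ) : ∏ i, φ g i i ^ Fin.append a b i = chiProd a b g := by
  rw [Fin.prod_univ_add]
  simp only [Fin.append_left, Fin.append_right, h.castAdd_castAdd, h.natAdd_natAdd]
  rfl

end BlockEmbed

section Restrict
variable {n m : ℕ} {P : Type*} [Fintype P] [DecidableEq P]

/-- The matrix units of the first block. -/
def lieE₁ (n m : ℕ) (P : Type*) [Fintype P] [DecidableEq P] (i j : Fin n) :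
    Module.End ℂ ((P → Fin (n + m)) → ℂ) := lieE P (Fin.castAdd m i) (Fin.castAdd m j)

/-- The matrix units of the second block. -/
def lieE₂ (n m : ℕ) (P : Type*) [Fintype P] [DecidableEq P] (i j : Fin m) :
    Module.End ℂ ((P → Fin (n + m)) → ℂ) := lieE P (Fin.natAdd n i) (Fin.natAdd n j)

lemma glRel_lieE₁ : GLRel (lieE₁ n m P) := by
  intro i j k l
  have := glRel_lieE (P := P) (Fin.castAdd m i) (Fin.castAdd m j) (Fin.castAdd m k) (Fin.castAdd m l)
  simpa [lieE₁] using this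

lemma glRel_lieE₂ : GLRel (lieE₂ n m P) := by
  intro i j k l
  have := glRel_lieE (P := P) (Fin.natAdd n i) (Fin.natAdd n j) (Fin.natAdd n k) (Fin.natAdd n l)
  simpa [lieE₂] using this

lemma lieE₁_comm_lieE₂ (i j : Fin n) (k l : Fin m) :
    lieE₁ n m P i j * lieE₂ n m P k l = lieE₂ n m P k l * lieE₁ n m P i j := by
  have h1 : Fin.castAdd m j ≠ Fin.natAdd n k := by
    intro h; have := congrArg Fin.val h; simp at this; omega
  have h2 : Fin.natAdd n l ≠ Fin.castAdd m i := by
    intro h; have := congrArg Fin.val h; simp at this; omega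
  have := glRel_lieE (P := P) (Fin.castAdd m i) (Fin.castAdd m j) (Fin.natAdd n k) (Fin.natAdd n l)
  rw [if_neg h1, if_neg h2, sub_zero, sub_eq_zero] at this
  exact this

variable {V : Type*} [AddCommGroup V] [Module ℂ V]

/-- Borel eigenvectors of the block diagonal subgroup, in the tensor model. -/
lemma eigSp_eq_comap {φ : GL (Fin n) ℂ × GL (Fin m) ℂ →* GL (Fin (n + m)) ℂ}
    (hφ : IsBlockDiagEmbed n m φ) {ρ : Representation ℂ (GL (Fin (n + m)) ℂ) V} {k : ℤ}
    {f : V →ₗ[ℂ] ((P → Fin (n + m)) → ℂ)} (hinj : Function.Injective f)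
    (hf : f ∈ equivariantMaps ρ (detTwist (tensRep (n + m) P) (-k))) (a : Fin n → ℤ)
    (b : Fin m → ℤ) :
    eigSp (ρ.comp φ) (boSet n ×ˢ boSet m) (chiProd a b)
      = Submodule.comap f (hwSp (lieE₁ n m P) (fun i => a i + k)
          ⊓ hwSp (lieE₂ n m P) fun i => b i + k) := by
  have hf' : ∀ g x, f (ρ g x) = ((g : Matrix (Fin (n + m)) (Fin (n + m)) ℂ).det ^ (-k)) •
      tensMat P (g : Matrix (Fin (n + m)) (Fin (n + m)) ℂ) *ᵥ f x := by
    intro g x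
    exact LinearMap.congr_fun (hf g) x
  have key : ∀ x, (x ∈ eigSp (ρ.comp φ) (boSet n ×ˢ boSet m) (chiProd a b)) ↔
      ∀ g : GL (Fin (n + m)) ℂ, (∀ i j, j < i → g i j = 0) →
        (∀ i j, blk n m i ≠ blk n m j → g i j = 0) →
        tensMat P (g : Matrix (Fin (n + m)) (Fin (n + m)) ℂ) *ᵥ f x
          = (∏ i, g i i ^ (Fin.append (fun i => a i + k) (fun i => b i + k) i)) • f x := by
    intro x
    have hone : ∀ g ∈ boSet n ×ˢ boSet m, (ρ.comp φ g x = chiProd a b g • x ↔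
        tensMat P (φ g : Matrix (Fin (n + m)) (Fin (n + m)) ℂ) *ᵥ f x
          = (∏ i, φ g i i ^ (Fin.append (fun i => a i + k) (fun i => b i + k) i)) • f x) := by
      intro g hg
      have hdet : (φ g : Matrix (Fin (n + m)) (Fin (n + m)) ℂ).det ≠ 0 :=
        ((Matrix.isUnit_iff_isUnit_det _).1 (φ g).isUnit).ne_zero
      have hdet2 : (φ g : Matrix (Fin (n + m)) (Fin (n + m)) ℂ).det = ∏ i, φ g i i :=
        det_of_isUpperTriangular (M := (φ g : Matrix (Fin (n + m)) (Fin (n + m)) ℂ))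
          fun i j hij => (hφ.upper hg).1 i j hij
      have hne : ∀ i, φ g i i ≠ 0 := by
        rw [hdet2, Finset.prod_ne_zero_iff] at hdet
        exact fun i => hdet i (Finset.mem_univ i)
      have hprod : ∏ i, φ g i i ^ (Fin.append (fun i => a i + k) (fun i => b i + k) i)
          = chiProd a b g * (φ g : Matrix (Fin (n + m)) (Fin (n + m)) ℂ).det ^ k := by
        rw [← hφ.prod_diag, hdet2, ← Finset.prod_zpow, ← Finset.prod_mul_distrib]
        refine Finset.prod_congr rfl fun i _ => ?_
        rw [← zpow_add₀ (hne i)]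
        congr 1
        induction i using Fin.addCases <;> simp
      rw [hprod, ← hinj.eq_iff, map_smul, MonoidHom.comp_apply, hf', _root_.zpow_neg,
        inv_smul_eq_iff₀ (zpow_ne_zero _ hdet), smul_smul, mul_comm (_ ^ k)]
    rw [mem_eigSp]
    constructor
    · intro h g hg hc
      obtain ⟨g', hg', rfl⟩ := hφ.exists_eq hg hc
      exact (hone g' hg').1 (h g' hg')
    · intro h g hg
      exact (hone g hg).2 (h (φ g) (hφ.upper hg).1 (hφ.upper hg).2)
  ext x
  rw [key, borel_iff (blk n m), Submodule.mem_comap, Submodule.mem_inf, mem_hwSp, mem_hwSp]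
  constructor
  · rintro ⟨h1, h2⟩
    refine ⟨⟨fun i => ?_, fun i j hij => ?_⟩, fun i => ?_, fun i j hij => ?_⟩
    · simpa [lieE₁] using h1 (Fin.castAdd m i)
    · exact h2 _ _ hij (by rw [blk_castAdd, blk_castAdd])
    · simpa [lieE₂] using h1 (Fin.natAdd n i)
    · exact h2 _ _ (by simpa using hij) (by rw [blk_natAdd, blk_natAdd])
  · rintro ⟨⟨h1, h2⟩, h3, h4⟩
    refine ⟨fun i => ?_, fun i j hij hc => ?_⟩
    · induction i using Fin.addCases with
      | left i => simpa [lieE₁] using h1 i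
      | right i => simpa [lieE₂] using h3 i
    · induction i using Fin.addCases <;> induction j using Fin.addCases
      · exact h2 _ _ hij
      · simp [blk_castAdd, blk_natAdd] at hc
      · simp [blk_castAdd, blk_natAdd] at hc
      · exact h4 _ _ (by simpa using hij)

end Restrict
end

noncomputable section

lemma sum_mul_perm_lt {N : ℕ} {w : Equiv.Perm (Fin N)} (hw : w ≠ 1) :
    ∑ i : Fin N, (i : ℤ) * ((w i : ℕ) : ℤ) < ∑ i : Fin N, (i : ℤ) * (i : ℤ) := by
  have h1 : ∑ i : Fin N, ((w i : ℕ) : ℤ) * ((w i : ℕ) : ℤ) = ∑ i : Fin N, (i : ℤ) * (i : ℤ) :=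
    Equiv.sum_comp w fun i : Fin N => (i : ℤ) * (i : ℤ)
  have h2 : 0 < ∑ i : Fin N, ((i : ℤ) - ((w i : ℕ) : ℤ)) ^ 2 := by
    obtain ⟨i, hi⟩ : ∃ i, w i ≠ i := by
      by_contra! h
      exact hw (Equiv.ext h)
    refine Finset.sum_pos' (fun _ _ => sq_nonneg _) ⟨i, Finset.mem_univ _, ?_⟩
    have : (i : ℤ) - ((w i : ℕ) : ℤ) ≠ 0 := by
      intro h
      exact hi (Fin.ext (by omega))
    positivity
  have h3 : ∑ i : Fin N, ((i : ℤ) - ((w i : ℕ) : ℤ)) ^ 2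
      = ∑ i : Fin N, (i : ℤ) * (i : ℤ) + ∑ i : Fin N, ((w i : ℕ) : ℤ) * ((w i : ℕ) : ℤ)
        - 2 * ∑ i : Fin N, (i : ℤ) * ((w i : ℕ) : ℤ) := by
    rw [Finset.mul_sum, ← Finset.sum_add_distrib, ← Finset.sum_sub_distrib]
    exact Finset.sum_congr rfl fun i _ => by ring
  omega

/-- A symmetric finitely supported function on weights is determined by its alternating sums. -/
lemma eq_zero_of_alternating {N : ℕ} {g : (Fin N → ℤ) → ℤ} (hfin : g.support.Finite)
    (hsymm : ∀ (η : Fin N → ℤ) (w : Equiv.Perm (Fin N)), g η ≠ 0 → g (η ∘ w) ≠ 0)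
    (halt : ∀ κ : Fin N → ℤ, Antitone κ → ∑ w : Equiv.Perm (Fin N), (Equiv.Perm.sign w : ℤ) *
      g (fun i => κ i - (i : ℕ) + ((w i : ℕ) : ℤ)) = 0) : g = 0 := by
  by_contra hg
  have hne : g.support.Nonempty := Function.support_nonempty_iff.2 hg
  let H : (Fin N → ℤ) → ℤ := fun η => ∑ i : Fin N, -(i : ℤ) * η i
  obtain ⟨η, hη, hmax⟩ := hfin.exists_maximalFor H _ hne
  have hmax' : ∀ ξ, g ξ ≠ 0 → H ξ ≤ H η := fun ξ hξ => by
    by_contra h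
    exact h (hmax hξ (not_le.1 h).le)
  have hanti : Antitone η := by
    intro i j hij
    by_contra! hlt
    have hne : i ≠ j := by rintro rfl; exact lt_irrefl _ hlt
    have h1 := hmax' _ (hsymm η (Equiv.swap i j) hη)
    have h2 : H (η ∘ Equiv.swap i j) - H η = ((j : ℤ) - (i : ℤ)) * (η j - η i) := by
      simp only [H, ← Finset.sum_sub_distrib]
      rw [Fintype.sum_eq_add i j hne]
      · simp only [Function.comp, Equiv.swap_apply_left, Equiv.swap_apply_right]; ring
      · rintro x ⟨hx1, hx2⟩
        simp [Equiv.swap_apply_of_ne_of_ne hx1 hx2]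
    have h3 : (i : ℕ) < j := lt_of_le_of_ne hij fun h => hne (Fin.ext h)
    have : 0 < ((j : ℤ) - (i : ℤ)) * (η j - η i) :=
      mul_pos (by omega) (by omega)
    omega
  have h := halt η hanti
  rw [Finset.sum_eq_single 1] at h
  · simp at h
    exact hη h
  · intro w _ hw
    have : ¬ g (fun i => η i - (i : ℕ) + ((w i : ℕ) : ℤ)) ≠ 0 := by
      intro hne
      have h1 := hmax' _ hne
      have h2 := sum_mul_perm_lt hw
      have h3 : H (fun i => η i - (i : ℕ) + ((w i : ℕ) : ℤ))
          = H η + ∑ i : Fin N, (i : ℤ) * (i : ℤ) - ∑ i : Fin N, (i : ℤ) * ((w i : ℕ) : ℤ) := by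
        simp only [H, ← Finset.sum_sub_distrib, ← Finset.sum_add_distrib]
        exact Finset.sum_congr rfl fun i _ => by ring
      omega
    rw [not_not.1 this, mul_zero]
  · simp

/-- Extension of a tuple by zero. -/
def extZ {N : ℕ} (κ : Fin N → ℤ) (i : ℕ) : ℤ := if h : i < N then κ ⟨i, h⟩ else 0

@[simp] lemma extZ_val {N : ℕ} (κ : Fin N → ℤ) (i : Fin N) : extZ κ i = κ i := by simp [extZ]

lemma extZ_of_le {N : ℕ} (κ : Fin N → ℤ) {i : ℕ} (h : N ≤ i) : extZ κ i = 0 := by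
  simp [extZ, h.not_gt]

lemma extZ_letters {N : ℕ} {κ : Fin N → ℤ} (hκ : Antitone κ) (k : ℕ) (hk : k + 1 < N) :
    extZ κ (k + 1) ≤ extZ κ k := by
  rw [extZ, extZ, dif_pos hk, dif_pos (by omega)]
  exact hκ (by simp [Fin.le_def])

/-- The alternating sums of the numbers of semistandard fillings of a straight shape. -/
lemma alternating_gt {N ℓ : ℕ} {L : ℕ → ℤ} (hNℓ : N ≤ ℓ) (hL : ∀ i, N ≤ i → L i = 0)
    (hL0 : ∀ i, 0 ≤ L i) (hLa : ∀ i, L (i + 1) ≤ L i) {κ : Fin N → ℤ} (hκ : Antitone κ) :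
    ∑ w : Equiv.Perm (Fin N), (Equiv.Perm.sign w : ℤ) *
      ∑ T ∈ gtFin N L 0, (if gtwt N ℓ T = fun i => κ i - (i : ℕ) + ((w i : ℕ) : ℤ) then 1 else 0)
      = if κ = (fun i : Fin N => L i) then 1 else 0 := by
  classical
  have hLℓ : ∀ i, ℓ ≤ i → L i = 0 := fun i hi => hL i (hNℓ.trans hi)
  have h1 := (symFam_gtwt (m := N) hLℓ zero_le_zero_fun).sum_alt
    (fun i => -((i : ℕ) : ℤ)) (fun i => κ i - (i : ℕ))
  have h2 := card_goodFin_alt (m := N) (v := 0) hLℓ zero_le_zero_fun (fun _ _ => le_rfl)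
    (extZ_letters hκ)
  have e1 : ∀ w : Equiv.Perm (Fin N), ((fun i => κ i - (i : ℕ)) - (fun i : Fin N => -((i : ℕ) : ℤ)) ∘ w)
      = fun i => κ i - (i : ℕ) + ((w i : ℕ) : ℤ) := by
    intro w; funext i; simp
  have e2 : ∀ T, ((fun i : Fin N => -((i : ℕ) : ℤ)) + gtwt N ℓ T)
      = fun k : Fin N => (0 : ℕ → ℤ) k - (k : ℕ) + gtwt N ℓ T k := by
    intro T; funext i; simp
  simp only [e1] at h1
  rw [← h1]
  simp only [e2]
  simp only [extZ_val] at h2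
  rw [← h2]
  have h3 : goodFin N ℓ L 0 0 (extZ κ)
      = if κ = (fun i : Fin N => L i) then {straightGT L} else ∅ := by
    ext T
    rw [mem_goodFin hLℓ zero_le_zero_fun]
    have hs := isGT_straightGT (m := N) hL hL0 hLa
    constructor
    · rintro ⟨a, b, c⟩
      obtain rfl := eq_straightGT a b
      rw [if_pos]
      · simp
      · funext i
        have := c i i.isLt
        rw [cnt_straightGT, if_pos (lt_of_lt_of_le i.isLt hNℓ)] at this
        simpa using this.symm
    · split_ifs with h
      · intro hT
        rw [Finset.mem_singleton] at hT
        subst hT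
        refine ⟨hs.1, hs.2, fun k hk => ?_⟩
        rw [cnt_straightGT, if_pos (lt_of_lt_of_le hk hNℓ)]
        subst h
        simp [extZ, hk]
      · simp
  rw [h3]
  split_ifs <;> simp

end

noncomputable section

lemma finrank_comap_eq {V W : Type*} [AddCommGroup V] [Module ℂ V] [AddCommGroup W] [Module ℂ W]
    {f : V →ₗ[ℂ] W} (hf : Function.Injective f) (S : Submodule ℂ W) :
    Module.finrank ℂ (Submodule.comap f S) = Module.finrank ℂ ↥(LinearMap.range f ⊓ S) := by
  rw [(Submodule.equivMapOfInjective f hf (Submodule.comap f S)).finrank_eq,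
    Submodule.map_comap_eq]

section Inf
variable {n : ℕ} {V : Type*} [AddCommGroup V] [Module ℂ V] [FiniteDimensional ℂ V]

/-- Dimensions of highest weight spaces inside an invariant subspace. -/
lemma finrank_inf_hwSp {E : Fin n → Fin n → Module.End ℂ V} (hE : GLRel E) {U : Submodule ℂ V}
    (hU : ∀ i j, ∀ x ∈ U, E i j x ∈ U) {μ : Fin n → ℤ} (hμ : Antitone μ) :
    (Module.finrank ℂ ↥(U ⊓ hwSp E μ) : ℤ) = ∑ w : Equiv.Perm (Fin n), (Equiv.Perm.sign w : ℤ) *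
      Module.finrank ℂ ↥(U ⊓ wtSp E (fun i => μ i - (i : ℕ) + ((w i : ℕ) : ℤ))) := by
  let F : Fin n → Fin n → Module.End ℂ U := fun i j => (E i j).restrict (hU i j)
  have hF : GLRel F := by
    intro i j k l
    ext x
    have := LinearMap.congr_fun (hE i j k l) (x : V)
    by_cases h1 : j = k <;> by_cases h2 : l = i <;> simpa [F, h1, h2] using this
  have e1 : ∀ η, wtSp F η = Submodule.comap U.subtype (wtSp E η) := by
    intro η
    ext x
    rw [Submodule.mem_comap, mem_wtSp, mem_wtSp]
    exact forall_congr' fun i => Subtype.ext_iff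
  have e2 : hwSp F μ = Submodule.comap U.subtype (hwSp E μ) := by
    ext x
    rw [Submodule.mem_comap, mem_hwSp, mem_hwSp]
    exact and_congr (forall_congr' fun i => Subtype.ext_iff)
      (forall_congr' fun i => forall_congr' fun j => imp_congr_right fun _ => Subtype.ext_iff)
  have h := finrank_hwSp hF hμ
  have f1 : ∀ S : Submodule ℂ V, Module.finrank ℂ (Submodule.comap U.subtype S)
      = Module.finrank ℂ ↥(U ⊓ S) := fun S => by
    rw [finrank_comap_eq U.injective_subtype, Submodule.range_subtype]
  rw [e2, f1] at h
  rw [h]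
  refine Finset.sum_congr rfl fun w _ => ?_
  rw [e1, f1]

end Inf

section Weights
variable {N : ℕ} {P : Type*} [Fintype P] [DecidableEq P]

lemma cont_comp_perm (I : P → Fin N) (σ : Equiv.Perm (Fin N)) (i : Fin N) :
    cont (σ ∘ I) (σ i) = cont I i := by
  simp [cont]

/-- The permutation matrices as elements of `GL_N`. -/
def permGL (σ : Equiv.Perm (Fin N)) : GL (Fin N) ℂ :=
  Matrix.GeneralLinearGroup.mkOfDetNeZero (σ.toPEquiv.toMatrix) (by
    rw [Matrix.det_permutation]
    simp)

lemma tensMat_permGL (σ : Equiv.Perm (Fin N)) (v : (P → Fin N) → ℂ) (I : P → Fin N) :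
    (tensMat P (permGL σ : Matrix (Fin N) (Fin N) ℂ) *ᵥ v) I = v (σ ∘ I) := by
  have h : ∀ J, tensMat P (permGL σ : Matrix (Fin N) (Fin N) ℂ) I J
      = if J = σ ∘ I then 1 else 0 := by
    intro J
    have h0 : ∀ i j, (permGL σ : Matrix (Fin N) (Fin N) ℂ) i j = if σ i = j then 1 else 0 := by
      intro i j
      simp [permGL, Matrix.GeneralLinearGroup.mkOfDetNeZero, PEquiv.toMatrix_apply]
    simp only [tensMat, Matrix.of_apply, h0]
    split_ifs with hJ
    · subst hJ; simp
    · obtain ⟨x, hx⟩ := Function.ne_iff.1 hJ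
      refine Finset.prod_eq_zero (Finset.mem_univ x) (if_neg fun h => hx ?_)
      simp [h]
  simp [Matrix.mulVec, dotProduct, h]

/-- Weight multiplicities of subrepresentations are symmetric. -/
lemma finrank_inf_wtSp_le {U : Submodule ℂ ((P → Fin N) → ℂ)} (hU : IsSubrep (tensRep N P) U)
    (η : Fin N → ℤ) (σ : Equiv.Perm (Fin N)) :
    Module.finrank ℂ ↥(U ⊓ wtSp (lieE P) η) ≤ Module.finrank ℂ ↥(U ⊓ wtSp (lieE P) (η ∘ σ)) := by
  have hmap : ∀ x ∈ U ⊓ wtSp (lieE P) η,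
      tensRep N P (permGL σ) x ∈ U ⊓ wtSp (lieE P) (η ∘ σ) := by
    intro x hx
    refine ⟨hU _ _ hx.1, ?_⟩
    have h2 := lieE_diag_iff.1 (mem_wtSp.1 hx.2)
    refine mem_wtSp.2 (lieE_diag_iff.2 fun I hI i => ?_)
    rw [tensRep_apply, tensMat_permGL] at hI
    rw [← cont_comp_perm I σ i, h2 _ hI]
    rfl
  refine LinearMap.finrank_le_finrank_of_injective
    (f := (tensRep N P (permGL σ)).restrict hmap) ?_
  intro x y hxy
  have h1 := congrArg Subtype.val hxy
  simp only [LinearMap.coe_restrict_apply] at h1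
  have h2 := congrArg (tensRep N P (permGL σ)⁻¹) h1
  rw [← Module.End.mul_apply, ← Module.End.mul_apply, ← map_mul, inv_mul_cancel, map_one] at h2
  exact Subtype.ext h2

lemma finite_wtSp_ne_bot :
    {η : Fin N → ℤ | wtSp (lieE (N := N) P) η ≠ ⊥}.Finite := by
  refine (Set.finite_range fun I : P → Fin N => fun i => (cont I i : ℤ)).subset fun η hη => ?_
  obtain ⟨x, hx, hx0⟩ := Submodule.exists_mem_ne_zero_of_ne_bot hη
  obtain ⟨I, hI⟩ := Function.ne_iff.1 hx0
  exact ⟨I, funext fun i => lieE_diag_iff.1 (mem_wtSp.1 hx) I hI i⟩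

lemma mem_hwSp_lieE {a : Fin N → ℤ} {v : (P → Fin N) → ℂ} :
    v ∈ hwSp (lieE P) a ↔ IsHWVec (tensRep N P) a v := by
  rw [mem_hwSp, ← mem_eigSp_chi, mem_eigSp]
  have := borel_iff (P := P) (fun _ : Fin N => 0) (a := a) (v := v)
  simp only [forall_const, ne_eq, not_true_eq_false, false_imp_iff, imp_true_iff] at this
  exact this.symm

/-- A cyclic highest weight representation has a unique highest weight. -/
lemma finrank_orbSpan_inf_hwSp {a κ : Fin N → ℤ} {w : (P → Fin N) → ℂ} (hw0 : w ≠ 0)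
    (hw : IsHWVec (tensRep N P) a w) :
    Module.finrank ℂ ↥(orbSpan (tensRep N P) w ⊓ hwSp (lieE P) κ) = if κ = a then 1 else 0 := by
  split_ifs with h
  · subst h
    have : orbSpan (tensRep N P) w ⊓ hwSp (lieE P) κ = Submodule.span ℂ {w} := by
      apply le_antisymm
      · rintro y ⟨hy1, hy2⟩
        set B := stdForm (P → Fin N)
        have hww : B w w ≠ 0 := fun h => hw0 (stdForm_isStarForm.1 w h)
        set c : ℂ := star (B y w / B w w)
        have hz : y - c • w = 0 := by
          refine stdForm_isStarForm.hw_eq_zero hw (b := κ)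
            (Submodule.sub_mem _ hy1 (Submodule.smul_mem _ _ (mem_orbSpan_self _ _))) ?_ fun _ => ?_
          · exact mem_hwSp_lieE.1 (Submodule.sub_mem _ hy2
              (Submodule.smul_mem _ _ (mem_hwSp_lieE.2 hw)))
          · change B (y - c • w) w = 0
            rw [map_sub, map_smulₛₗ, LinearMap.sub_apply, LinearMap.smul_apply]
            simp only [c, smul_eq_mul, starRingEnd_apply, star_star]
            rw [div_mul_cancel₀ _ hww, sub_self]
        rw [sub_eq_zero] at hz
        rw [hz]
        exact Submodule.smul_mem _ _ (Submodule.mem_span_singleton_self w)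
      · rw [Submodule.span_singleton_le_iff_mem]
        exact ⟨mem_orbSpan_self _ _, mem_hwSp_lieE.2 hw⟩
    rw [this, finrank_span_singleton hw0]
  · have : orbSpan (tensRep N P) w ⊓ hwSp (lieE P) κ = ⊥ := by
      rw [eq_bot_iff]
      rintro y ⟨hy1, hy2⟩
      exact stdForm_isStarForm.hw_eq_zero hw hy1 (mem_hwSp_lieE.1 hy2) fun h' => absurd h'.symm h
    rw [this, finrank_bot]

/-- Weight multiplicities count semistandard fillings. -/
theorem finrank_orbSpan_inf_wtSp {ℓ : ℕ} {L : ℕ → ℤ} (hNℓ : N ≤ ℓ) (hL : ∀ i, N ≤ i → L i = 0)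
    (hL0 : ∀ i, 0 ≤ L i) (hLa : ∀ i, L (i + 1) ≤ L i) {w : (P → Fin N) → ℂ} (hw0 : w ≠ 0)
    (hw : IsHWVec (tensRep N P) (fun i : Fin N => L i) w) (η : Fin N → ℤ) :
    (Module.finrank ℂ ↥(orbSpan (tensRep N P) w ⊓ wtSp (lieE P) η) : ℤ)
      = ∑ T ∈ gtFin N L 0, if gtwt N ℓ T = η then 1 else 0 := by
  set U := orbSpan (tensRep N P) w
  have hU : IsSubrep (tensRep N P) U := orbSpan_subrep _ _
  have hLℓ : ∀ i, ℓ ≤ i → L i = 0 := fun i hi => hL i (hNℓ.trans hi)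
  set f : (Fin N → ℤ) → ℤ := fun η => Module.finrank ℂ ↥(U ⊓ wtSp (lieE P) η) with hf
  set K : (Fin N → ℤ) → ℤ := fun η => ∑ T ∈ gtFin N L 0, if gtwt N ℓ T = η then 1 else 0 with hK
  have hfs : ∀ η (σ : Equiv.Perm (Fin N)), f (η ∘ σ) = f η := by
    intro η σ
    refine le_antisymm ?_ (Int.ofNat_le.2 (finrank_inf_wtSp_le hU η σ))
    have := finrank_inf_wtSp_le hU (η ∘ σ) σ⁻¹
    rw [show (η ∘ σ) ∘ (σ⁻¹ : Equiv.Perm (Fin N)) = η by ext; simp] at this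
    exact Int.ofNat_le.2 this
  have hKs : ∀ η (σ : Equiv.Perm (Fin N)), K (η ∘ σ) = K η := by
    intro η σ
    have := symFam_gtwt (m := N) hLℓ zero_le_zero_fun σ fun y => if y = η ∘ σ then 1 else 0
    simp only [hK]
    rw [← this]
    refine Finset.sum_congr rfl fun T _ => ?_
    have : gtwt N ℓ T ∘ σ = η ∘ σ ↔ gtwt N ℓ T = η :=
      ⟨fun h => σ.surjective.injective_comp_right h, fun h => by rw [h]⟩
    simp only [this]
  have hg : f - K = 0 := by
    refine eq_zero_of_alternating ?_ ?_ ?_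
    · have h1 : f.support.Finite := by
        refine (finite_wtSp_ne_bot (N := N) (P := P)).subset fun η hη hbot => hη ?_
        simp only [hf]
        rw [hbot, inf_bot_eq, finrank_bot, Nat.cast_zero]
      have h2 : K.support.Finite := by
        refine ((gtFin N L 0).finite_toSet.image (gtwt N ℓ)).subset fun η hη => ?_
        obtain ⟨T, hT, hne⟩ := Finset.exists_ne_zero_of_sum_ne_zero hη
        refine ⟨T, hT, ?_⟩
        by_contra h
        exact hne (if_neg h)
      exact (h1.union h2).subset (Function.support_sub f K)
    · intro η σ h
      rwa [Pi.sub_apply, hfs, hKs]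
    · intro κ hκ
      have h1 := finrank_inf_hwSp (glRel_lieE (N := N) (P := P)) (U := U)
        (fun i j x hx => lieMat_mem hU _ hx) hκ
      have h2 := alternating_gt hNℓ hL hL0 hLa hκ
      rw [finrank_orbSpan_inf_hwSp hw0 hw] at h1
      simp only [Pi.sub_apply, mul_sub, Finset.sum_sub_distrib]
      simp only [hf, hK]
      rw [← h1, h2]
      push_cast
      simp
  exact sub_eq_zero.1 (congrFun hg η)

end Weights
end

noncomputable section

lemma IsGT.eq_zero_of_bot_zero {m : ℕ} {l : ℕ → ℤ} {T : ℕ → ℕ → ℤ} (h : IsGT m l 0 T) {k r : ℕ}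
    (hkr : k ≤ r) : T k r = 0 := by
  induction k generalizing r with
  | zero => rw [h.zero]; rfl
  | succ k ih =>
    obtain ⟨r, rfl⟩ : ∃ s, r = s + 1 := ⟨r - 1, by omega⟩
    refine le_antisymm ?_ (h.bot_le _ _)
    rw [← ih (r := r) (by omega)]
    exact (h.inter k r).2

open Classical in
/-- Splitting patterns with `n + m` levels at level `n`. -/
lemma sum_gtFin_fiber {n m ℓ : ℕ} {L g : ℕ → ℤ} (hL : ∀ i, ℓ ≤ i → L i = 0)
    (hg : ∀ i, ℓ ≤ i → g i = 0) (hg0 : ∀ i, 0 ≤ g i) (a : Fin n → ℤ) (θ : Fin m → ℤ) :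
    ∑ T ∈ (gtFin (n + m) L 0).filter (fun T => T n = g),
        (if gtwt (n + m) ℓ T = Fin.append a θ then (1 : ℤ) else 0)
      = (∑ T ∈ gtFin n g 0, if gtwt n ℓ T = a then 1 else 0)
        * ∑ R ∈ gtFin m L g, if gtwt m ℓ R = θ then 1 else 0 := by
  rw [Finset.sum_mul_sum, ← Finset.sum_product']
  refine Finset.sum_bij' (fun T _ => (fun k => T (min k n), fun k => T (n + k)))
    (fun x _ => glueGT n x.1 x.2) ?_ ?_ ?_ ?_ ?_
  · intro T hT
    obtain ⟨hT, hTg⟩ := Finset.mem_filter.1 hT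
    rw [mem_gtFin hL zero_le_zero_fun] at hT
    rw [Finset.mem_product, mem_gtFin hg zero_le_zero_fun, mem_gtFin hL hg0, ← hTg]
    exact ⟨hT.take, hT.drop⟩
  · intro x hx
    rw [Finset.mem_product, mem_gtFin hg zero_le_zero_fun, mem_gtFin hL hg0] at hx
    rw [Finset.mem_filter, mem_gtFin hL zero_le_zero_fun]
    refine ⟨isGT_glue hx.1 hx.2, ?_⟩
    simp only [glueGT, le_refl, if_true]
    exact hx.1.top n le_rfl
  · intro T hT
    exact glueGT_self T
  · intro x hx
    rw [Finset.mem_product, mem_gtFin hg zero_le_zero_fun, mem_gtFin hL hg0] at hx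
    obtain ⟨h1, h2⟩ := hx
    have hng : x.1 n = g := h1.top n le_rfl
    refine Prod.ext ?_ ?_
    · funext k
      simp only [glueGT, min_le_right, if_true]
      rcases le_total k n with h | h
      · rw [min_eq_left h]
      · rw [min_eq_right h, hng, h1.top k h]
    · funext k
      simp only [glueGT]
      split_ifs with h
      · have : k = 0 := by omega
        subst this
        rw [Nat.add_zero, hng, h2.zero]
      · rw [Nat.add_sub_cancel_left]
  · intro T hT
    have hlow : ∀ i : Fin n, gtwt n ℓ (fun k => T (min k n)) i
        = gtwt (n + m) ℓ T (Fin.castAdd m i) := by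
      intro i
      refine cnt_congr ?_ ?_ ℓ
      · simp
      · simp
    have hhigh : ∀ j : Fin m, gtwt m ℓ (fun k => T (n + k)) j
        = gtwt (n + m) ℓ T (Fin.natAdd n j) := by
      intro j
      exact cnt_congr (by simp) (by simp [add_assoc]) ℓ
    have : gtwt (n + m) ℓ T = Fin.append a θ ↔
        gtwt n ℓ (fun k => T (min k n)) = a ∧ gtwt m ℓ (fun k => T (n + k)) = θ := by
      constructor
      · intro h
        exact ⟨funext fun i => by rw [hlow, h, Fin.append_left],
          funext fun j => by rw [hhigh, h, Fin.append_right]⟩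
      · rintro ⟨h1, h2⟩
        funext i
        refine Fin.addCases (fun i => ?_) (fun j => ?_) i
        · rw [← hlow, h1, Fin.append_left]
        · rw [← hhigh, h2, Fin.append_right]
    simp only [this]
    split_ifs <;> simp_all

/-- The alternating sum over the first block isolates the patterns whose row `n` is `κ`. -/
lemma alternating_gt_append {n m : ℕ} {L : ℕ → ℤ} (hL : ∀ i, n + m ≤ i → L i = 0)
    {κ : Fin n → ℤ} (hκ : Antitone κ) (hκ0 : ∀ i, 0 ≤ κ i) (θ : Fin m → ℤ) :
    ∑ w : Equiv.Perm (Fin n), (Equiv.Perm.sign w : ℤ) *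
      ∑ T ∈ gtFin (n + m) L 0, (if gtwt (n + m) (n + m) T
        = Fin.append (fun i => κ i - (i : ℕ) + ((w i : ℕ) : ℤ)) θ then 1 else 0)
      = ∑ R ∈ gtFin m L (extZ κ), if gtwt m (n + m) R = θ then 1 else 0 := by
  classical
  set G : Finset (ℕ → ℤ) := insert (extZ κ) ((gtFin (n + m) L 0).image fun T => T n) with hG
  have hκa : ∀ i, extZ κ (i + 1) ≤ extZ κ i := by
    intro i
    unfold extZ
    split_ifs with h1 h2 h2
    · exact hκ (by simp)
    · omega
    · exact hκ0 _
    · exact le_rfl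
  have hκp : ∀ i, 0 ≤ extZ κ i := by
    intro i
    unfold extZ
    split_ifs
    · exact hκ0 _
    · exact le_rfl
  have hGprop : ∀ g ∈ G, (∀ i, n ≤ i → g i = 0) ∧ (∀ i, 0 ≤ g i) ∧ ∀ i, g (i + 1) ≤ g i := by
    intro g hg
    rcases Finset.mem_insert.1 hg with rfl | hg
    · exact ⟨fun i hi => extZ_of_le κ hi, hκp, hκa⟩
    · obtain ⟨T, hT, rfl⟩ := Finset.mem_image.1 hg
      rw [mem_gtFin hL zero_le_zero_fun] at hT
      exact ⟨fun i hi => hT.eq_zero_of_bot_zero hi, fun i => hT.bot_le n i,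
        fun i => hT.anti n (Nat.le_succ i)⟩
  have hmaps : ∀ T ∈ gtFin (n + m) L 0, T n ∈ G := fun T hT =>
    Finset.mem_insert_of_mem (Finset.mem_image_of_mem _ hT)
  have hsum : ∀ w : Equiv.Perm (Fin n),
      ∑ T ∈ gtFin (n + m) L 0, (if gtwt (n + m) (n + m) T
        = Fin.append (fun i => κ i - (i : ℕ) + ((w i : ℕ) : ℤ)) θ then (1 : ℤ) else 0)
      = ∑ g ∈ G, (∑ T ∈ gtFin n g 0, if gtwt n (n + m) T
          = (fun i => κ i - (i : ℕ) + ((w i : ℕ) : ℤ)) then 1 else 0)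
        * ∑ R ∈ gtFin m L g, if gtwt m (n + m) R = θ then 1 else 0 := by
    intro w
    rw [← Finset.sum_fiberwise_of_maps_to hmaps]
    refine Finset.sum_congr rfl fun g hg => ?_
    obtain ⟨h1, h2, -⟩ := hGprop g hg
    exact sum_gtFin_fiber hL (fun i hi => h1 i (by omega)) h2 _ _
  simp only [hsum, Finset.mul_sum (s := G)]
  rw [Finset.sum_comm]
  simp only [← mul_assoc, ← Finset.sum_mul]
  have hval : ∀ g ∈ G, (∑ w : Equiv.Perm (Fin n), (Equiv.Perm.sign w : ℤ) *
      ∑ T ∈ gtFin n g 0, if gtwt n (n + m) T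
          = (fun i => κ i - (i : ℕ) + ((w i : ℕ) : ℤ)) then 1 else 0)
      = if extZ κ = g then (1 : ℤ) else 0 := by
    intro g hg
    obtain ⟨h1, h2, h3⟩ := hGprop g hg
    rw [alternating_gt (Nat.le_add_right n m) h1 h2 h3 hκ]
    have : (κ = fun i : Fin n => g i) ↔ extZ κ = g := by
      constructor
      · intro h
        funext i
        rcases lt_or_ge i n with hi | hi
        · rw [extZ, dif_pos hi, h]
        · rw [extZ_of_le κ hi, h1 i hi]
      · rintro rfl
        simp
    simp only [this]
  rw [Finset.sum_congr rfl fun g hg => by rw [hval g hg]]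
  simp only [ite_mul, one_mul, zero_mul]
  rw [Finset.sum_ite_eq, if_pos (Finset.mem_insert_self _ _)]

end

noncomputable section

/-- The weight `kap N lp lm` shifted by `k` and extended by zero. -/
def shiftRow (k N : ℕ) (lp lm : ℕ → ℕ) (i : ℕ) : ℤ := if i < N then kap N lp lm i + k else 0

/-- Merge patterns of positive and negative parts into one with rows shifted by `k`. -/
def mergeGT (k n m : ℕ) (T S : ℕ → ℕ → ℤ) (j i : ℕ) : ℤ :=
  if i < n + min j m then T (min j m) i - S (min j m) (n + min j m - 1 - i) + k else 0

/-- The positive part of a merged pattern. -/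
def posGT (k p : ℕ) (R : ℕ → ℕ → ℤ) (j i : ℕ) : ℤ := if i < p then R j i - k else 0

/-- The negative part of a merged pattern. -/
def negGT (k n m q : ℕ) (R : ℕ → ℕ → ℤ) (j i : ℕ) : ℤ :=
  if i < q then k - R j (n + min j m - 1 - i) else 0

variable {k n m p q : ℕ} {lp lm mp mm : ℕ → ℕ}

lemma isGT_mergeGT (hlm : IsPN q lm) (hkl : lm 0 ≤ k) {T S : ℕ → ℕ → ℤ}
    (hT : IsGT m (fun i => lp i) (fun i => mp i) T) (hS : IsGT m (fun i => lm i) (fun i => mm i) S) :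
    IsGT m (shiftRow k (n + m) lp lm) (shiftRow k n mp mm) (mergeGT k n m T S) := by
  have hSk : ∀ j r, S j r ≤ k := fun j r => by
    have h1 := hS.le_top j r
    have h2 := hlm.anti (Nat.zero_le r)
    have : (lm r : ℤ) ≤ k := by exact_mod_cast h2.trans hkl
    omega
  have hT0 : ∀ j r, 0 ≤ T j r := fun j r => le_trans (by positivity) (hT.bot_le j r)
  refine ⟨?_, ?_, ?_⟩
  · funext i
    simp [mergeGT, shiftRow, kap, hT.zero, hS.zero]
  · intro j hj
    funext i
    simp [mergeGT, shiftRow, kap, min_eq_right hj, hT.top m le_rfl, hS.top m le_rfl]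
  · intro j r
    rcases lt_or_ge j m with hj | hj
    · have e1 : min j m = j := min_eq_left hj.le
      have e2 : min (j + 1) m = j + 1 := min_eq_left hj
      simp only [mergeGT, e1, e2]
      have t := hT.inter j r
      constructor
      · by_cases h1 : r < n + j
        · rw [if_pos h1, if_pos (by omega)]
          have s := (hS.inter j (n + j - 1 - r)).2
          rw [show n + j - 1 - r + 1 = n + (j + 1) - 1 - r by omega] at s
          linarith [t.1]
        · rw [if_neg h1]
          split_ifs
          · linarith [hT0 (j + 1) r, hSk (j + 1) (n + (j + 1) - 1 - r)]
          · exact le_rfl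
      · by_cases h1 : r < n + j
        · rw [if_pos h1, if_pos (by omega)]
          have s := (hS.inter j (n + j - 1 - r)).1
          rw [show n + (j + 1) - 1 - (r + 1) = n + j - 1 - r by omega]
          linarith [t.2]
        · rw [if_neg h1, if_neg (by omega)]
    · have e1 : min j m = m := min_eq_right hj
      have e2 : min (j + 1) m = m := min_eq_right (by omega)
      simp only [mergeGT, e1, e2]
      refine ⟨le_rfl, ?_⟩
      by_cases h2 : r + 1 < n + m
      · rw [if_pos h2, if_pos (by omega)]
        have t := hT.anti m (Nat.le_succ r)
        have s := hS.anti m (show n + m - 1 - (r + 1) ≤ n + m - 1 - r by omega)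
        linarith
      · rw [if_neg h2]
        split_ifs
        · linarith [hT0 m r, hSk m (n + m - 1 - r)]
        · exact le_rfl

lemma IsGT.drop_row {l u : ℕ → ℤ} {R : ℕ → ℕ → ℤ} (h : IsGT m l u R) (j s i : ℕ) :
    R (j + s) (i + s) ≤ R j i := by
  induction s with
  | zero => exact le_rfl
  | succ s ih => exact ((h.inter (j + s) (i + s)).2).trans ih

section Split

variable {R : ℕ → ℕ → ℤ}

lemma le_mergedRow (hmm : IsPN q mm) (hpq : p + q ≤ n)
    (hR : IsGT m (shiftRow k (n + m) lp lm) (shiftRow k n mp mm) R) {j i : ℕ} (hi : i < p) : (k : ℤ) + mp i ≤ R j i := by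
  refine le_trans ?_ (hR.bot_le j i)
  rw [shiftRow, if_pos (by omega), kap, hmm.supp _ (by omega)]
  push_cast
  omega

lemma mergedRow_le (hmp : IsPN p mp) (hpq : p + q ≤ n)
    (hR : IsGT m (shiftRow k (n + m) lp lm) (shiftRow k n mp mm) R) {j i : ℕ} (hi : i < q) : R j (n + j - 1 - i) ≤ k - (mm i : ℤ) := by
  have h := hR.drop_row 0 j (n - 1 - i)
  rw [zero_add, show n - 1 - i + j = n + j - 1 - i by omega] at h
  refine h.trans ?_
  rw [hR.zero, shiftRow, if_pos (by omega), kap, hmp.supp _ (by omega),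
    show n - 1 - (n - 1 - i) = i by omega]
  push_cast
  omega

lemma mergedRow_mid (hlp : IsPN p lp) (hlm : IsPN q lm)
    (hR : IsGT m (shiftRow k (n + m) lp lm) (shiftRow k n mp mm) R) {j i : ℕ} (hj : j ≤ m) (hi : p ≤ i) (hi' : i + q < n + j) : R j i = k := by
  refine le_antisymm ?_ ?_
  · refine (hR.le_top j i).trans ?_
    rw [shiftRow, if_pos (by omega), kap, hlp.supp _ hi]
    push_cast
    omega
  · have h := hR.drop_row j (m - j) i
    rw [Nat.add_sub_cancel' hj, hR.top m le_rfl, shiftRow, if_pos (by omega), kap,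
      hlm.supp _ (by omega)] at h
    push_cast at h
    omega

lemma mergedRow_zero (hmm : IsPN q mm)
    (hR : IsGT m (shiftRow k (n + m) lp lm) (shiftRow k n mp mm) R) (hkm : mm 0 ≤ k) {j i : ℕ} (hi : n + j ≤ i) : R j i = 0 := by
  refine le_antisymm ?_ ?_
  · have h := hR.drop_row 0 j (i - j)
    rw [zero_add, Nat.sub_add_cancel (by omega), hR.zero, shiftRow, if_neg (by omega)] at h
    exact h
  · refine le_trans ?_ (hR.bot_le j i)
    rw [shiftRow]
    split_ifs
    · have := hmm.anti (Nat.zero_le (n - 1 - i))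
      rw [kap]
      omega
    · exact le_rfl

lemma isGT_posGT (hlp : IsPN p lp) (hmp : IsPN p mp) (hmm : IsPN q mm) (hpq : p + q ≤ n)
    (hR : IsGT m (shiftRow k (n + m) lp lm) (shiftRow k n mp mm) R) (hlm : IsPN q lm) : IsGT m (fun i => lp i) (fun i => mp i) (posGT k p R) := by
  have hin : ∀ j, Interlace (posGT k p R j) (posGT k p R (j + 1)) := by
    intro j r
    have h := hR.inter j r
    simp only [posGT]
    refine ⟨?_, ?_⟩
    · split_ifs <;> linarith [h.1]
    · split_ifs with h1 h2 h2
      · linarith [h.2]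
      · omega
      · have := le_mergedRow (R := R) hmm hpq hR (j := j) h2
        omega
      · exact le_rfl
  refine ⟨?_, ?_, hin⟩
  · funext i
    simp only [posGT, hR.zero]
    split_ifs with h
    · rw [shiftRow, if_pos (by omega), kap, hmm.supp _ (by omega)]
      push_cast
      ring
    · rw [hmp.supp _ (by omega)]
      rfl
  · intro j hj
    funext i
    simp only [posGT, hR.top j hj]
    split_ifs with h
    · rw [shiftRow, if_pos (by omega), kap, hlm.supp _ (by omega)]
      push_cast
      ring
    · rw [hlp.supp _ (by omega)]
      rfl

lemma isGT_negGT (hlp : IsPN p lp) (hlm : IsPN q lm) (hmp : IsPN p mp) (hmm : IsPN q mm) (hpq : p + q ≤ n)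
    (hR : IsGT m (shiftRow k (n + m) lp lm) (shiftRow k n mp mm) R) : IsGT m (fun i => lm i) (fun i => mm i) (negGT k n m q R) := by
  have hle : ∀ j i, i < q → R j (n + min j m - 1 - i) ≤ k := by
    intro j i hi
    have e : R j = R (min j m) := by
      rcases le_total j m with h | h
      · rw [min_eq_left h]
      · rw [min_eq_right h, hR.top j h, hR.top m le_rfl]
    rw [e]
    have := mergedRow_le (R := R) hmp hpq hR (j := min j m) hi
    omega
  refine ⟨?_, ?_, ?_⟩
  · funext i
    simp only [negGT, hR.zero]
    split_ifs with h
    · rw [shiftRow, if_pos (by omega), kap, hmp.supp _ (by omega),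
        show n - 1 - (n + min 0 m - 1 - i) = i by omega]
      push_cast
      ring
    · rw [hmm.supp _ (by omega)]
      rfl
  · intro j hj
    funext i
    simp only [negGT, hR.top j hj]
    split_ifs with h
    · rw [shiftRow, if_pos (by omega), kap, hlp.supp _ (by omega),
        show n + m - 1 - (n + min j m - 1 - i) = i by omega]
      push_cast
      ring
    · rw [hlm.supp _ (by omega)]
      rfl
  · intro j r
    simp only [negGT]
    rcases lt_or_ge j m with hj | hj
    · rw [min_eq_left hj.le, min_eq_left (show j + 1 ≤ m from hj)]
      refine ⟨?_, ?_⟩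
      · split_ifs with h
        · have := (hR.inter j (n + j - 1 - r)).2
          rw [show n + j - 1 - r + 1 = n + (j + 1) - 1 - r by omega] at this
          linarith
        · exact le_rfl
      · split_ifs with h1 h2 h2
        · have := (hR.inter j (n + j - 1 - r)).1
          rw [show n + (j + 1) - 1 - (r + 1) = n + j - 1 - r by omega]
          linarith
        · omega
        · have := hle j r h2
          rw [min_eq_left hj.le] at this
          linarith
        · exact le_rfl
    · rw [min_eq_right hj, min_eq_right (show m ≤ j + 1 by omega), hR.top j hj,
        hR.top (j + 1) (by omega)]
      refine ⟨le_rfl, ?_⟩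
      split_ifs with h1 h2 h2
      · have := hR.anti m (show n + m - 1 - (r + 1) ≤ n + m - 1 - r by omega)
        rw [hR.top m le_rfl] at this
        linarith
      · omega
      · have := hle j r h2
        rw [min_eq_right hj, hR.top j hj] at this
        linarith
      · exact le_rfl

lemma mergeGT_posGT_negGT (hlp : IsPN p lp) (hlm : IsPN q lm) (hmm : IsPN q mm) (hpq : p + q ≤ n)
    (hR : IsGT m (shiftRow k (n + m) lp lm) (shiftRow k n mp mm) R) (hkm : mm 0 ≤ k) :
    mergeGT k n m (posGT k p R) (negGT k n m q R) = R := by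
  funext j i
  have e : R j = R (min j m) := by
    rcases le_total j m with h | h
    · rw [min_eq_left h]
    · rw [min_eq_right h, hR.top j h, hR.top m le_rfl]
  rw [e]
  have hc : min j m ≤ m := min_le_right j m
  generalize hcd : min j m = c at hc
  simp only [mergeGT, posGT, negGT, hcd, min_eq_left hc]
  split_ifs with h1 h2 h3 h3
  · omega
  · ring
  · rw [show n + c - 1 - (n + c - 1 - i) = i by omega]
    ring
  · rw [mergedRow_mid hlp hlm hR hc (by omega) (by omega)]
    ring
  · rw [mergedRow_zero hmm hR hkm (by omega)]

end Split

lemma posGT_mergeGT (hlp : IsPN p lp) (hlm : IsPN q lm) (hpq : p + q ≤ n) {T S : ℕ → ℕ → ℤ}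
    (hT : IsGT m (fun i => lp i) (fun i => mp i) T) (hS : IsGT m (fun i => lm i) (fun i => mm i) S) :
    posGT k p (mergeGT k n m T S) = T := by
  funext j i
  have e : T j = T (min j m) := by
    rcases le_total j m with h | h
    · rw [min_eq_left h]
    · rw [min_eq_right h, hT.top j h, hT.top m le_rfl]
  simp only [posGT, mergeGT]
  split_ifs with h1 h2
  · rw [hS.eq_zero (supp_cast hlm) (fun _ => by positivity) _ (by omega), e]
    ring
  · omega
  · rw [hT.eq_zero (supp_cast hlp) (fun _ => by positivity) _ (by omega)]

lemma negGT_mergeGT (hlp : IsPN p lp) (hlm : IsPN q lm) (hpq : p + q ≤ n) {T S : ℕ → ℕ → ℤ}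
    (hT : IsGT m (fun i => lp i) (fun i => mp i) T) (hS : IsGT m (fun i => lm i) (fun i => mm i) S) :
    negGT k n m q (mergeGT k n m T S) = S := by
  funext j i
  have e : S j = S (min j m) := by
    rcases le_total j m with h | h
    · rw [min_eq_left h]
    · rw [min_eq_right h, hS.top j h, hS.top m le_rfl]
  simp only [negGT, mergeGT]
  split_ifs with h1 h2
  · rw [hT.eq_zero (supp_cast hlp) (fun _ => by positivity) _ (by omega), e,
      show n + min j m - 1 - (n + min j m - 1 - i) = i by omega]
    ring
  · omega
  · rw [hS.eq_zero (supp_cast hlm) (fun _ => by positivity) _ (by omega)]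

lemma sum_mergeGT (hlp : IsPN p lp) (hlm : IsPN q lm) (hpq : p + q ≤ n) {T S : ℕ → ℕ → ℤ}
    (hT : IsGT m (fun i => lp i) (fun i => mp i) T) (hS : IsGT m (fun i => lm i) (fun i => mm i) S)
    {c : ℕ} (hc : c ≤ m) :
    ∑ r ∈ Finset.range (n + m), mergeGT k n m T S c r
      = ∑ r ∈ Finset.range (n + m), T c r - ∑ r ∈ Finset.range (n + m), S c r + (n + c) * k := by
  have cut : ∀ f : ℕ → ℤ, (∀ r, n + c ≤ r → f r = 0) →
      ∑ r ∈ Finset.range (n + m), f r = ∑ r ∈ Finset.range (n + c), f r := fun f hf =>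
    (Finset.sum_subset (Finset.range_mono (by omega)) fun r _ hr =>
      hf r (by simpa using hr)).symm
  rw [cut _ fun r hr => ?_, cut (T c) fun r hr => ?_, cut (S c) fun r hr => ?_,
    ← Finset.sum_range_reflect (S c) (n + c)]
  · rw [← Finset.sum_sub_distrib]
    have : ((n : ℤ) + c) * k = ∑ r ∈ Finset.range (n + c), (k : ℤ) := by simp
    rw [this, ← Finset.sum_add_distrib]
    refine Finset.sum_congr rfl fun r hr => ?_
    rw [mergeGT, min_eq_left hc, if_pos (Finset.mem_range.1 hr)]
  · exact hS.eq_zero (supp_cast hlm) (fun _ => by positivity) _ (by omega)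
  · exact hT.eq_zero (supp_cast hlp) (fun _ => by positivity) _ (by omega)
  · rw [mergeGT, min_eq_left hc, if_neg (by omega)]

lemma gtwt_mergeGT (hlp : IsPN p lp) (hlm : IsPN q lm) (hpq : p + q ≤ n) {T S : ℕ → ℕ → ℤ}
    (hT : IsGT m (fun i => lp i) (fun i => mp i) T) (hS : IsGT m (fun i => lm i) (fun i => mm i) S)
    (j : Fin m) : gtwt m (n + m) (mergeGT k n m T S) j
      = gtwt m (n + m) T j - gtwt m (n + m) S j + k := by
  simp only [gtwt, cnt, Finset.sum_sub_distrib]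
  rw [sum_mergeGT hlp hlm hpq hT hS j.2.le, sum_mergeGT hlp hlm hpq hT hS (Nat.succ_le_of_lt j.2)]
  push_cast
  ring

/-- Patterns for shifted mixed weights are pairs of patterns for the positive and negative parts. -/
theorem sum_gtFin_shiftRow (hlp : IsPN p lp) (hlm : IsPN q lm) (hmp : IsPN p mp) (hmm : IsPN q mm)
    (hpq : p + q ≤ n) (hkl : lm 0 ≤ k) (hkm : mm 0 ≤ k) (θ : Fin m → ℤ) :
    ∑ R ∈ gtFin m (shiftRow k (n + m) lp lm) (shiftRow k n mp mm),
        (if gtwt m (n + m) R = θ then (1 : ℤ) else 0)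
      = ∑ x ∈ gtFin m (fun i => lp i) (fun i => mp i) ×ˢ gtFin m (fun i => lm i) (fun i => mm i),
        if gtwt m (n + m) x.1 + -gtwt m (n + m) x.2 = (fun i => θ i - k) then 1 else 0 := by
  have hL : ∀ i, n + m ≤ i → shiftRow k (n + m) lp lm i = 0 := fun i hi => by
    rw [shiftRow, if_neg (by omega)]
  have hM : ∀ i, 0 ≤ shiftRow k n mp mm i := fun i => by
    rw [shiftRow]
    split_ifs
    · have := hmm.anti (Nat.zero_le (n - 1 - i))
      rw [kap]
      omega
    · exact le_rfl
  have memR : ∀ {R}, R ∈ gtFin m (shiftRow k (n + m) lp lm) (shiftRow k n mp mm) ↔ _ :=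
    mem_gtFin hL hM
  have memT : ∀ {T}, T ∈ gtFin m (fun i => (lp i : ℤ)) (fun i => mp i) ↔ _ :=
    mem_gtFin (supp_cast hlp) (fun _ => by positivity)
  have memS : ∀ {T}, T ∈ gtFin m (fun i => (lm i : ℤ)) (fun i => mm i) ↔ _ :=
    mem_gtFin (supp_cast hlm) (fun _ => by positivity)
  refine Finset.sum_bij' (fun R _ => (posGT k p R, negGT k n m q R))
    (fun x _ => mergeGT k n m x.1 x.2) ?_ ?_ ?_ ?_ ?_
  · intro R hR
    have hR := memR.1 hR
    exact Finset.mem_product.2 ⟨memT.2 (isGT_posGT hlp hmp hmm hpq hR hlm),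
      memS.2 (isGT_negGT hlp hlm hmp hmm hpq hR)⟩
  · intro x hx
    have hx := Finset.mem_product.1 hx
    exact memR.2 (isGT_mergeGT hlm hkl (memT.1 hx.1) (memS.1 hx.2))
  · intro R hR
    exact mergeGT_posGT_negGT hlp hlm hmm hpq (memR.1 hR) hkm
  · intro x hx
    have hx := Finset.mem_product.1 hx
    exact Prod.ext (posGT_mergeGT hlp hlm hpq (memT.1 hx.1) (memS.1 hx.2))
      (negGT_mergeGT hlp hlm hpq (memT.1 hx.1) (memS.1 hx.2))
  · intro R hR
    have hR := memR.1 hR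
    have hw : ∀ j, gtwt m (n + m) R j = gtwt m (n + m) (posGT k p R) j
        - gtwt m (n + m) (negGT k n m q R) j + k := by
      intro j
      rw [← gtwt_mergeGT hlp hlm hpq (isGT_posGT hlp hmp hmm hpq hR hlm)
        (isGT_negGT hlp hlm hmp hmm hpq hR) j, mergeGT_posGT_negGT hlp hlm hmm hpq hR hkm]
    have : gtwt m (n + m) R = θ ↔ gtwt m (n + m) (posGT k p R)
        + -gtwt m (n + m) (negGT k n m q R) = fun i => θ i - k := by
      rw [funext_iff, funext_iff]
      refine forall_congr' fun j => ?_
      rw [hw, Pi.add_apply, Pi.neg_apply]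
      constructor <;> intro h <;> linarith
    simp only [this]

end

noncomputable section

section Blocks

variable {n m : ℕ} {P : Type*} [Fintype P] [DecidableEq P]

lemma wtSp_lieE_append (a : Fin n → ℤ) (b : Fin m → ℤ) :
    wtSp (lieE₁ n m P) a ⊓ wtSp (lieE₂ n m P) b = wtSp (lieE P) (Fin.append a b) := by
  ext v
  rw [Submodule.mem_inf, mem_wtSp, mem_wtSp, mem_wtSp]
  constructor
  · rintro ⟨h1, h2⟩ i
    induction i using Fin.addCases with
    | left i => simpa [lieE₁] using h1 i
    | right i => simpa [lieE₂] using h2 i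
  · intro h
    exact ⟨fun i => by simpa [lieE₁] using h (Fin.castAdd m i),
      fun i => by simpa [lieE₂] using h (Fin.natAdd n i)⟩

/-- Multiplicities in the restriction to the blocks, in terms of weight multiplicities. -/
lemma finrank_inf_hwSp_blocks {U : Submodule ℂ ((P → Fin (n + m)) → ℂ)}
    (hU : IsSubrep (tensRep (n + m) P) U) {a : Fin n → ℤ} {b : Fin m → ℤ} (ha : Antitone a)
    (hb : Antitone b) :
    (Module.finrank ℂ ↥(U ⊓ (hwSp (lieE₁ n m P) a ⊓ hwSp (lieE₂ n m P) b)) : ℤ)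
      = ∑ w' : Equiv.Perm (Fin m), (Equiv.Perm.sign w' : ℤ) *
          ∑ w : Equiv.Perm (Fin n), (Equiv.Perm.sign w : ℤ) *
            Module.finrank ℂ ↥(U ⊓ wtSp (lieE P)
              (Fin.append (fun i => a i - (i : ℕ) + ((w i : ℕ) : ℤ))
                fun j => b j - (j : ℕ) + ((w' j : ℕ) : ℤ))) := by
  have hcomm : ∀ i j k l (x : (P → Fin (n + m)) → ℂ),
      lieE₁ n m P i j (lieE₂ n m P k l x) = lieE₂ n m P k l (lieE₁ n m P i j x) :=
    fun i j k l x => LinearMap.congr_fun (lieE₁_comm_lieE₂ i j k l) x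
  have h1 := finrank_inf_hwSp (glRel_lieE₂ (n := n) (m := m) (P := P))
    (U := U ⊓ hwSp (lieE₁ n m P) a) (fun k l x hx => by
      refine ⟨lieMat_mem hU _ hx.1, ?_⟩
      have hx2 := mem_hwSp.1 hx.2
      refine mem_hwSp.2 ⟨fun i => ?_, fun i j hij => ?_⟩
      · rw [hcomm, hx2.1, map_smul]
      · rw [hcomm, hx2.2 i j hij, map_zero]) hb
  rw [← inf_assoc, h1]
  refine Finset.sum_congr rfl fun w' _ => ?_
  congr 1
  set θ : Fin m → ℤ := fun j => b j - (j : ℕ) + ((w' j : ℕ) : ℤ)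
  have h2 := finrank_inf_hwSp (glRel_lieE₁ (n := n) (m := m) (P := P))
    (U := U ⊓ wtSp (lieE₂ n m P) θ) (fun k l x hx => by
      refine ⟨lieMat_mem hU _ hx.1, ?_⟩
      have hx2 := mem_wtSp.1 hx.2
      refine mem_wtSp.2 fun i => ?_
      rw [← hcomm, hx2, map_smul]) ha
  rw [inf_right_comm, h2]
  refine Finset.sum_congr rfl fun w _ => ?_
  rw [inf_assoc, inf_comm (wtSp (lieE₂ n m P) θ), wtSp_lieE_append]

end Blocks

lemma ratWeight_antitone {N p q : ℕ} {lp lm : ℕ → ℕ} (hlp : IsPN p lp) (hlm : IsPN q lm) :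
    Antitone (ratWeight N lp lm) := by
  intro i j hij
  have hij' : (i : ℕ) ≤ j := hij
  have h1 := hlp.anti hij'
  have h2 := hlm.anti (show N - 1 - (j : ℕ) ≤ N - 1 - i by omega)
  simp only [ratWeight]
  omega

lemma ratWeight_add_nonneg {N q k : ℕ} {lp lm : ℕ → ℕ} (hlm : IsPN q lm) (hk : lm 0 ≤ k)
    (i : Fin N) : 0 ≤ ratWeight N lp lm i + k := by
  have := hlm.anti (Nat.zero_le (N - 1 - i))
  simp only [ratWeight]
  omega

/-- The multiplicity as an alternating sum over pairs of patterns. -/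
theorem repMult_eq_sum_alt {n m p q : ℕ} {lp lm mp mm np nm : ℕ → ℕ} (hpq : p + q ≤ n)
    (hlp : IsPN p lp) (hlm : IsPN q lm) (hmp : IsPN p mp) (hmm : IsPN q mm) (hnp : IsPN p np)
    (hnm : IsPN q nm) {φ : GL (Fin n) ℂ × GL (Fin m) ℂ →* GL (Fin (n + m)) ℂ}
    (hφ : IsBlockDiagEmbed n m φ)
    {Vl Vm Vn : Type*} [AddCommGroup Vl] [Module ℂ Vl]
    [AddCommGroup Vm] [Module ℂ Vm] [AddCommGroup Vn] [Module ℂ Vn]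
    {ρl : Representation ℂ (GL (Fin (n + m)) ℂ) Vl}
    {ρm : Representation ℂ (GL (Fin n) ℂ) Vm}
    {ρn : Representation ℂ (GL (Fin m) ℂ) Vn}
    (hρl : IsGLHW (n + m) (ratWeight (n + m) lp lm) ρl)
    (hρm : IsGLHW n (ratWeight n mp mm) ρm)
    (hρn : IsGLHW m (ratWeight m np nm) ρn) :
    (repMult (ρl.comp φ)
        (Representation.tprod
          (ρm.comp (MonoidHom.fst (GL (Fin n) ℂ) (GL (Fin m) ℂ)))
          (ρn.comp (MonoidHom.snd (GL (Fin n) ℂ) (GL (Fin m) ℂ)))) : ℤ)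
      = ∑ T ∈ gtFin m (fun i => lp i) (fun i => mp i),
          ∑ S ∈ gtFin m (fun i => lm i) (fun i => mm i),
            alt (fun k : Fin m => kap m np nm k - k)
              (fun k => -(k : ℤ) + gtwt m (n + m) T k - gtwt m (n + m) S k) := by
  have : FiniteDimensional ℂ Vl := hρl.2.1
  set k : ℕ := lm 0 + mm 0 with hk
  set L : ℕ → ℤ := shiftRow k (n + m) lp lm with hLdef
  have hcast : ∀ i : Fin (n + m), ratWeight (n + m) lp lm i + (k : ℤ)
      = ((ratWeight (n + m) lp lm i + (k : ℤ)).toNat : ℕ) := fun i =>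
    (Int.toNat_of_nonneg (ratWeight_add_nonneg hlm (by omega) i)).symm
  have hLi : ∀ i : Fin (n + m), L i = ratWeight (n + m) lp lm i + k := fun i => by
    rw [hLdef, shiftRow, if_pos i.2]
    rfl
  have hL : ∀ i, n + m ≤ i → L i = 0 := fun i hi => by rw [hLdef, shiftRow, if_neg (by omega)]
  have hL0 : ∀ i, 0 ≤ L i := fun i => by
    rcases lt_or_ge i (n + m) with hi | hi
    · have := hLi ⟨i, hi⟩
      simp only at this
      rw [this]
      exact ratWeight_add_nonneg hlm (by omega) _
    · exact (hL i hi).ge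
  have hLa : ∀ i, L (i + 1) ≤ L i := fun i => by
    rcases lt_or_ge (i + 1) (n + m) with hi | hi
    · have h1 := hLi ⟨i, by omega⟩
      have h2 := hLi ⟨i + 1, hi⟩
      simp only at h1 h2
      rw [h1, h2]
      exact add_le_add_left (ratWeight_antitone hlp hlm (by simp)) _
    · rw [hL _ hi]
      exact hL0 i
  obtain ⟨C, h, f, w, hinj, hf, hw0, hw, hrange⟩ := exists_model hρl (k := k)
    (L' := fun i => (ratWeight (n + m) lp lm i + (k : ℤ)).toNat)
    (fun i j hij => Int.toNat_le_toNat (add_le_add_left (ratWeight_antitone hlp hlm hij) _)) hcast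
  obtain ⟨B, hB⟩ := exists_starForm_comp hf hinj stdForm_isStarForm.detTwist hφ.map_star
  have hw' : IsHWVec (tensRep (n + m) (Σ c : Fin C, Fin (h c))) (fun i => L i) w := by
    have : (fun i : Fin (n + m) => L i)
        = fun i => (((ratWeight (n + m) lp lm i + (k : ℤ)).toNat : ℕ) : ℤ) := by
      funext i
      exact (hLi i).trans (hcast i)
    rw [this]
    exact hw
  set κ : Fin n → ℤ := fun i => ratWeight n mp mm i + k with hκ
  have hκa : Antitone κ := fun i j hij => add_le_add_left (ratWeight_antitone hmp hmm hij) _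
  have hκ0 : ∀ i, 0 ≤ κ i := fun i => ratWeight_add_nonneg hmm (by omega) i
  have hκe : extZ κ = shiftRow k n mp mm := by
    funext i
    simp only [extZ, shiftRow]
    split_ifs <;> rfl
  have hba : Antitone fun j => ratWeight m np nm j + (k : ℤ) := fun i j hij =>
    add_le_add_left (ratWeight_antitone hnp hnm hij) _
  rw [repMult_tprod_eq hρm hρn hB, eigSp_eq_comap hφ hinj hf, finrank_comap_eq hinj, hrange,
    finrank_inf_hwSp_blocks (orbSpan_subrep _ _) hκa hba]
  have hsym := (symFam_gtwt (m := m) (ℓ := n + m) (l := fun i => (lp i : ℤ))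
      (u := fun i => (mp i : ℤ)) (fun i hi => supp_cast hlp i (by omega))
      (fun _ => by positivity)).prod
    (symFam_gtwt (m := m) (ℓ := n + m) (l := fun i => (lm i : ℤ))
      (u := fun i => (mm i : ℤ)) (fun i hi => supp_cast hlm i (by omega))
      (fun _ => by positivity)).neg
  rw [← Finset.sum_product']
  have halt := hsym.sum_alt (fun j : Fin m => -(j : ℤ)) fun j : Fin m => kap m np nm j - j
  refine Eq.trans ?_ (halt.symm.trans ?_)
  · refine Finset.sum_congr rfl fun w' _ => ?_
    congr 1
    simp only [finrank_orbSpan_inf_wtSp le_rfl hL hL0 hLa hw0 hw']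
    rw [alternating_gt_append hL hκa hκ0, hκe,
      sum_gtFin_shiftRow hlp hlm hmp hmm hpq (by omega) (by omega)]
    refine Finset.sum_congr rfl fun x _ => ?_
    have : (fun j : Fin m => ratWeight m np nm j + (k : ℤ) - (j : ℕ) + ((w' j : ℕ) : ℤ) - k)
        = (fun j : Fin m => kap m np nm j - j) - (fun j : Fin m => -(j : ℤ)) ∘ w' := by
      funext j
      simp only [ratWeight, kap, Pi.sub_apply, Function.comp_apply]
      ring
    rw [this]
  · refine Finset.sum_congr rfl fun x _ => ?_
    congr 1
    funext j
    simp only [Pi.add_apply, Pi.neg_apply]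
    ring

end

/-- Stable branching rule for `GL_n × GL_m ⊂ GL_{n+m}`, direct sum.
For `p + q ≤ min(n,m)` and partitions `lp, mp, np'` with at most `p` parts and
`lm, mm, nm'` with at most `q` parts, the multiplicity of
`F^{(mp,mm)}_(n) ⊠ F^{(np',nm')}_(m)` in the restriction of `F^{(lp,lm)}_(n+m)` to the
block-diagonally embedded `GL_n × GL_m` is
`∑ c^{γ⁺}_{mp np'} c^{γ⁻}_{mm nm'} c^{lp}_{γ⁺ δ} c^{lm}_{γ⁻ δ}`,
the sum over all triples of partitions `(γ⁺, γ⁻, δ)`. -/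
theorem stable_branching_rule_GLn_GLm_sub_GLnm
    (n m p q : ℕ) (hpq : p + q ≤ min n m)
    (lp lm mp mm np' nm' : ℕ → ℕ)
    (hlp : IsPartition lp) (hlm : IsPartition lm) (hmp : IsPartition mp)
    (hmm : IsPartition mm) (hnp : IsPartition np') (hnm : IsPartition nm')
    (hlp' : plen lp ≤ p) (hmp' : plen mp ≤ p) (hnp' : plen np' ≤ p)
    (hlm' : plen lm ≤ q) (hmm' : plen mm ≤ q) (hnm' : plen nm' ≤ q)
    (φ : GL (Fin n) ℂ × GL (Fin m) ℂ →* GL (Fin (n + m)) ℂ)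
    (hφ : IsBlockDiagEmbed n m φ)
    {Vl Vm Vn : Type*} [AddCommGroup Vl] [Module ℂ Vl]
    [AddCommGroup Vm] [Module ℂ Vm] [AddCommGroup Vn] [Module ℂ Vn]
    (ρl : Representation ℂ (GL (Fin (n + m)) ℂ) Vl)
    (ρm : Representation ℂ (GL (Fin n) ℂ) Vm)
    (ρn : Representation ℂ (GL (Fin m) ℂ) Vn)
    (hρl : IsGLHW (n + m) (ratWeight (n + m) lp lm) ρl)
    (hρm : IsGLHW n (ratWeight n mp mm) ρm)
    (hρn : IsGLHW m (ratWeight m np' nm') ρn) :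
    repMult (ρl.comp φ)
        (Representation.tprod
          (ρm.comp (MonoidHom.fst (GL (Fin n) ℂ) (GL (Fin m) ℂ)))
          (ρn.comp (MonoidHom.snd (GL (Fin n) ℂ) (GL (Fin m) ℂ))))
      = ∑ᶠ (gp : Ptn) (gm : Ptn) (d : Ptn),
          lrCoeff gp.1 mp np' * lrCoeff gm.1 mm nm' *
          lrCoeff lp gp.1 d.1 * lrCoeff lm gm.1 d.1 := by
  have hlp₁ := plen_supp hlp hlp'
  have hlm₁ := plen_supp hlm hlm'
  have hmp₁ := plen_supp hmp hmp'
  have hmm₁ := plen_supp hmm hmm'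
  have hnp₁ := plen_supp hnp hnp'
  have hnm₁ := plen_supp hnm hnm'
  have hBp : ∀ k, lp k ≤ lp 0 + lm 0 := fun k => (hlp₁.anti (Nat.zero_le k)).trans (by omega)
  have hBm : ∀ k, lm k ≤ lp 0 + lm 0 := fun k => (hlm₁.anti (Nat.zero_le k)).trans (by omega)
  rw [finsum_lrCoeff hlp₁ hlm₁ mp np' mm nm' hBp hBm, ← Nat.cast_inj (R := ℤ),
    repMult_eq_sum_alt (by omega) hlp₁ hlm₁ hmp₁ hmm₁ hnp₁ hnm₁ hφ hρl hρm hρn,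
    sum_alt_pair_eq hlp₁ hmp₁ hnp₁ hlm₁ hmm₁ hnm₁ (by omega) (by omega) (by omega) hBp hBm]
  push_cast
  rfl

end
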